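/- arXiv:1907.08016 — 2 statements merged into one kernel-verified Lean document; each statement's English description precedes it below -/
import Mathlib

section
/- Let 2 ≤ n, let q ≥ 4 be a prime power with q = p^s, and let t ≥ 1 with r = q^t satisfying r ≥ (3n + 2 + √(9n² + 4n + 4))/2. Then there exists an algebraic Laurent series α ∈ F_q((T⁻¹)) of degree r + 1 over F_q(T) such that w_n(α) ≠ w_n*(α). (Specifically, one may take α = Θ₀ᵗ(λ) for λ ∈ F_q* with λ ≠ 1 and, if p ≠ 2, λ ≠ 2, in which case w_n*(α) = r − 1 and w_n(α) = r.) -/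
open Polynomial
open scoped Classical

noncomputable section

namespace CFq

variable (Fq : Type) [Field Fq] [Fintype Fq]

/-- The element `T` of `F_q((T⁻¹))`, realized as `X⁻¹` in the Laurent series field. -/
def Tls : LaurentSeries Fq := HahnSeries.single (-1 : ℤ) (1 : Fq)

/-- The embedding of `F_q[T]` into `F_q((T⁻¹))`. -/
def toLS : Polynomial Fq →+* LaurentSeries Fq :=
  (Polynomial.aeval (Tls Fq)).toRingHom

/-- The absolute value `|ξ| = q^{-N}` where `ξ = Σ_{n ≥ N} a_n T^{-n}`, `a_N ≠ 0`. -/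
def absQ (ξ : LaurentSeries Fq) : ℝ :=
  if ξ = 0 then 0 else (Fintype.card Fq : ℝ) ^ (-ξ.order)

/-- Absolute value of a polynomial in `T`:  `|f| = q^{deg f}`. -/
def pabs (f : Polynomial Fq) : ℝ := absQ Fq (toLS Fq f)

/-- The height of a polynomial `P(X) ∈ (F_q[T])[X]`: the maximum of the absolute
values of its coefficients. -/
def Hpoly (P : Polynomial (Polynomial Fq)) : ℝ :=
  sSup {x : ℝ | ∃ i, x = pabs Fq (P.coeff i)}

/-- `ξ` has the (infinite) continued fraction expansion `[a₀; a₁, a₂, …]`, where all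
partial quotients `aₙ`, `n ≥ 1`, have positive degree.  This is expressed via the
sequence of complete quotients (tails) `t n`, which satisfy `t n = a n + 1/(t (n+1))`
and `|t n| > 1` for `n ≥ 1`. -/
def IsCF (ξ : LaurentSeries Fq) (a : ℕ → Polynomial Fq) : Prop :=
  (∀ n, 1 ≤ n → 1 ≤ (a n).natDegree) ∧
  ∃ t : ℕ → LaurentSeries Fq, t 0 = ξ ∧
    (∀ n, t n = toLS Fq (a n) + (t (n + 1))⁻¹) ∧
    (∀ n, 1 ≤ n → 1 < absQ Fq (t n))

/-- Denominators of the convergents: `q₀ = 1`, `q₁ = a₁`, `qₙ = aₙ q_{n-1} + q_{n-2}`. -/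
def qden (a : ℕ → Polynomial Fq) : ℕ → Polynomial Fq
  | 0 => 1
  | 1 => a 1
  | n + 2 => a (n + 2) * qden a (n + 1) + qden a n

/-- Evaluation of `P(X) ∈ (F_q[T])[X]` at a Laurent series. -/
def evalLS (P : Polynomial (Polynomial Fq)) (ξ : LaurentSeries Fq) : LaurentSeries Fq :=
  Polynomial.eval₂ (toLS Fq) ξ P

/-- The degree of an algebraic Laurent series over `F_q(T)`: the least degree of a
nonzero polynomial over `F_q[T]` annihilating it. -/
def degLS (ξ : LaurentSeries Fq) : ℕ :=
  sInf {d | ∃ P : Polynomial (Polynomial Fq), P ≠ 0 ∧ P.natDegree = d ∧ evalLS Fq P ξ = 0}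

/-- The height of an algebraic Laurent series: the least height of a nonzero annihilating
polynomial of minimal degree (this is the height of the primitive minimal polynomial). -/
def heightLS (ξ : LaurentSeries Fq) : ℝ :=
  sInf {x | ∃ P : Polynomial (Polynomial Fq),
    P ≠ 0 ∧ P.natDegree = degLS Fq ξ ∧ evalLS Fq P ξ = 0 ∧ x = Hpoly Fq P}

/-- The Diophantine exponent `w_n(ξ)`. -/
def wExp (n : ℕ) (ξ : LaurentSeries Fq) : EReal :=
  sSup ((fun w : ℝ => (w : EReal)) ''
    {w | {P : Polynomial (Polynomial Fq) | P.natDegree ≤ n ∧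
      0 < absQ Fq (evalLS Fq P ξ) ∧
      absQ Fq (evalLS Fq P ξ) ≤ Hpoly Fq P ^ (-w)}.Infinite})

variable (L : Type) [Field L] [Algebra (LaurentSeries Fq) L]

/-- The embedding of `F_q[T]` into a field extension `L` of `F_q((T⁻¹))`. -/
def embRing : Polynomial Fq →+* L :=
  (algebraMap (LaurentSeries Fq) L).comp (toLS Fq)

/-- Evaluation of `P(X) ∈ (F_q[T])[X]` at `α ∈ L`. -/
def evalA (P : Polynomial (Polynomial Fq)) (α : L) : L :=
  Polynomial.eval₂ (embRing Fq L) α P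

/-- The degree of an algebraic `α ∈ L` over `F_q(T)`. -/
def degA (α : L) : ℕ :=
  sInf {d | ∃ P : Polynomial (Polynomial Fq), P ≠ 0 ∧ P.natDegree = d ∧ evalA Fq L P α = 0}

/-- The height of an algebraic `α ∈ L`: the height of its primitive minimal polynomial
over `F_q[T]`. -/
def heightA (α : L) : ℝ :=
  sInf {x | ∃ P : Polynomial (Polynomial Fq),
    P ≠ 0 ∧ P.natDegree = degA Fq L α ∧ evalA Fq L P α = 0 ∧ x = Hpoly Fq P}

/-- `α ∈ L` is algebraic of degree at most `n` over `F_q(T)`. -/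
def IsAlgDeg (n : ℕ) (α : L) : Prop :=
  ∃ P : Polynomial (Polynomial Fq), P ≠ 0 ∧ P.natDegree ≤ n ∧ evalA Fq L P α = 0

/-- The Diophantine exponent `w_n^*(ξ)`, computed with respect to an extension `L` of
`F_q((T⁻¹))` (to be taken algebraically closed) endowed with an absolute value `v`
extending `absQ`. -/
def wstarExp (n : ℕ) (ξ : LaurentSeries Fq) (v : AbsoluteValue L ℝ) : EReal :=
  sSup ((fun w : ℝ => (w : EReal)) ''
    {w | {α : L | IsAlgDeg Fq L n α ∧
      0 < v (algebraMap (LaurentSeries Fq) L ξ - α) ∧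
      v (algebraMap (LaurentSeries Fq) L ξ - α) ≤ heightA Fq L α ^ (-w - 1)}.Infinite})

end CFq

end

namespace CFq

section AbsoluteValue

@[simp] lemma toLS_X {k : Type} [Field k] : toLS k X = Tls k := by simp [toLS]

variable {Fq : Type} [Field Fq] [Fintype Fq]

variable (Fq) in
lemma one_lt_card_real : (1 : ℝ) < Fintype.card Fq := by
  exact_mod_cast Fintype.one_lt_card

variable (Fq) in
lemma card_real_pos : (0 : ℝ) < Fintype.card Fq := zero_lt_one.trans (one_lt_card_real Fq)

@[simp] lemma absQ_zero : absQ Fq 0 = 0 := by simp [absQ]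

lemma absQ_of_ne_zero {x : LaurentSeries Fq} (hx : x ≠ 0) :
    absQ Fq x = (Fintype.card Fq : ℝ) ^ (-x.order) := by simp [absQ, hx]

lemma absQ_pos {x : LaurentSeries Fq} (hx : x ≠ 0) : 0 < absQ Fq x := by
  rw [absQ_of_ne_zero hx]
  exact zpow_pos (card_real_pos Fq) _

lemma absQ_nonneg (x : LaurentSeries Fq) : 0 ≤ absQ Fq x := by
  rcases eq_or_ne x 0 with rfl | hx
  · simp
  · exact (absQ_pos hx).le

@[simp] lemma absQ_one : absQ Fq 1 = 1 := by
  rw [absQ_of_ne_zero one_ne_zero, HahnSeries.order_one]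
  simp

lemma absQ_mul (x y : LaurentSeries Fq) : absQ Fq (x * y) = absQ Fq x * absQ Fq y := by
  rcases eq_or_ne x 0 with rfl | hx
  · simp
  rcases eq_or_ne y 0 with rfl | hy
  · simp
  rw [absQ_of_ne_zero hx, absQ_of_ne_zero hy, absQ_of_ne_zero (mul_ne_zero hx hy),
    HahnSeries.order_mul hx hy, neg_add, zpow_add₀ (card_real_pos Fq).ne']

lemma absQ_pow (x : LaurentSeries Fq) (n : ℕ) : absQ Fq (x ^ n) = absQ Fq x ^ n := by
  induction n with
  | zero => simp
  | succ n ih => rw [pow_succ, absQ_mul, ih, pow_succ]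

lemma absQ_div (x y : LaurentSeries Fq) : absQ Fq (x / y) = absQ Fq x / absQ Fq y := by
  rcases eq_or_ne y 0 with rfl | hy
  · simp
  rw [eq_div_iff (absQ_pos hy).ne', ← absQ_mul, div_mul_cancel₀ _ hy]

@[simp] lemma absQ_neg (x : LaurentSeries Fq) : absQ Fq (-x) = absQ Fq x := by
  simp [absQ, HahnSeries.order_neg]

lemma absQ_add_le_max (x y : LaurentSeries Fq) :
    absQ Fq (x + y) ≤ max (absQ Fq x) (absQ Fq y) := by
  rcases eq_or_ne x 0 with rfl | hx
  · simp
  rcases eq_or_ne y 0 with rfl | hy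
  · simp
  rcases eq_or_ne (x + y) 0 with h | h
  · rw [h, absQ_zero]
    exact le_max_of_le_left (absQ_nonneg x)
  have h1 := HahnSeries.min_order_le_order_add h
  rw [absQ_of_ne_zero hx, absQ_of_ne_zero hy, absQ_of_ne_zero h, le_max_iff]
  rcases min_le_iff.1 h1 with h2 | h2
  · exact Or.inl (zpow_le_zpow_right₀ (one_lt_card_real Fq).le (neg_le_neg h2))
  · exact Or.inr (zpow_le_zpow_right₀ (one_lt_card_real Fq).le (neg_le_neg h2))

lemma absQ_add_le_of_le {x y : LaurentSeries Fq} {B : ℝ} (hx : absQ Fq x ≤ B)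
    (hy : absQ Fq y ≤ B) : absQ Fq (x + y) ≤ B :=
  (absQ_add_le_max x y).trans (max_le hx hy)

lemma absQ_sub_le_of_le {x y : LaurentSeries Fq} {B : ℝ} (hx : absQ Fq x ≤ B)
    (hy : absQ Fq y ≤ B) : absQ Fq (x - y) ≤ B := by
  rw [sub_eq_add_neg]
  exact absQ_add_le_of_le hx (by rwa [absQ_neg])

lemma absQ_sum_le_of_le {ι : Type*} (s : Finset ι) (f : ι → LaurentSeries Fq) {B : ℝ}
    (hB : 0 ≤ B) (h : ∀ i ∈ s, absQ Fq (f i) ≤ B) : absQ Fq (∑ i ∈ s, f i) ≤ B := by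
  induction s using Finset.induction_on with
  | empty => simpa using hB
  | insert a s ha ih =>
    rw [Finset.sum_insert ha]
    exact absQ_add_le_of_le (h a (Finset.mem_insert_self a s))
      (ih fun i hi => h i (Finset.mem_insert_of_mem hi))

lemma absQ_add_eq_left {x y : LaurentSeries Fq} (h : absQ Fq y < absQ Fq x) :
    absQ Fq (x + y) = absQ Fq x := by
  refine le_antisymm (absQ_add_le_of_le le_rfl h.le) ?_
  by_contra! hlt
  have h1 := absQ_add_le_max (x + y) (-y)
  rw [add_neg_cancel_right, absQ_neg] at h1
  exact absurd h1 (not_le.2 (max_lt hlt h))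

lemma absQ_prod {ι : Type*} (s : Finset ι) (f : ι → LaurentSeries Fq) :
    absQ Fq (∏ i ∈ s, f i) = ∏ i ∈ s, absQ Fq (f i) := by
  induction s using Finset.induction_on with
  | empty => simp
  | insert a s ha ih => rw [Finset.prod_insert ha, Finset.prod_insert ha, absQ_mul, ih]

lemma absQ_le_zpow_iff (x : LaurentSeries Fq) (N : ℤ) :
    absQ Fq x ≤ (Fintype.card Fq : ℝ) ^ (-N) ↔ ∀ k < N, x.coeff k = 0 := by
  rcases eq_or_ne x 0 with rfl | hx
  · simp [(zpow_pos (card_real_pos Fq) N).le]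
  rw [absQ_of_ne_zero hx, zpow_le_zpow_iff_right₀ (one_lt_card_real Fq), neg_le_neg_iff,
    HahnSeries.le_order_iff_forall hx]

lemma absQ_Tls : absQ Fq (Tls Fq) = Fintype.card Fq := by
  have h : Tls Fq ≠ 0 := by simp [Tls]
  rw [absQ_of_ne_zero h, Tls, HahnSeries.order_single one_ne_zero]
  simp

lemma absQ_toLS_C {c : Fq} (hc : c ≠ 0) : absQ Fq (toLS Fq (C c)) = 1 := by
  have h : toLS Fq (C c) = HahnSeries.C c := by
    simp [toLS, LaurentSeries.algebraMap_apply]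
  have h0 : (HahnSeries.C c : LaurentSeries Fq) ≠ 0 := by simpa using hc
  rw [h, absQ_of_ne_zero h0, HahnSeries.order_C]
  simp

lemma absQ_toLS_monomial {c : Fq} (hc : c ≠ 0) (n : ℕ) :
    absQ Fq (toLS Fq (C c * X ^ n)) = (Fintype.card Fq : ℝ) ^ n := by
  rw [map_mul, map_pow, absQ_mul, absQ_pow, absQ_toLS_C hc, toLS_X, absQ_Tls, one_mul]

lemma absQ_toLS_le {f : Fq[X]} {n : ℕ} (h : f.natDegree ≤ n) :
    absQ Fq (toLS Fq f) ≤ (Fintype.card Fq : ℝ) ^ n := by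
  rw [f.as_sum_range_C_mul_X_pow, map_sum]
  refine absQ_sum_le_of_le _ _ (pow_pos (card_real_pos Fq) n).le fun i hi => ?_
  rcases eq_or_ne (f.coeff i) 0 with h0 | h0
  · simp [h0]
  rw [absQ_toLS_monomial h0]
  exact pow_le_pow_right₀ (one_lt_card_real Fq).le
    ((Nat.lt_succ_iff.1 (Finset.mem_range.1 hi)).trans h)

lemma absQ_toLS {f : Fq[X]} (hf : f ≠ 0) :
    absQ Fq (toLS Fq f) = (Fintype.card Fq : ℝ) ^ f.natDegree := by
  have hm := absQ_toLS_monomial (leadingCoeff_ne_zero.2 hf) f.natDegree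
  rw [← f.eraseLead_add_C_mul_X_pow, map_add, add_comm, absQ_add_eq_left]
  · rw [f.eraseLead_add_C_mul_X_pow, hm]
  rw [hm]
  rcases eq_or_ne f.eraseLead 0 with h0 | h0
  · simpa [h0] using pow_pos (card_real_pos Fq) _
  have hlt := eraseLead_natDegree_lt_or_eraseLead_eq_zero f
  have hlt := hlt.resolve_right h0
  exact (absQ_toLS_le le_rfl).trans_lt (pow_lt_pow_right₀ (one_lt_card_real Fq) hlt)

lemma toLS_injective : Function.Injective (toLS Fq) := by
  rw [injective_iff_map_eq_zero]
  intro f hf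
  by_contra h
  have h1 := absQ_toLS h
  rw [hf, absQ_zero] at h1
  exact (pow_pos (card_real_pos Fq) _).ne h1

lemma toLS_ne_zero {f : Fq[X]} (hf : f ≠ 0) : toLS Fq f ≠ 0 :=
  (map_ne_zero_iff _ toLS_injective).2 hf

lemma one_le_absQ_toLS {f : Fq[X]} (hf : f ≠ 0) : 1 ≤ absQ Fq (toLS Fq f) := by
  rw [absQ_toLS hf]
  exact one_le_pow₀ (one_lt_card_real Fq).le

end AbsoluteValue

section Height

variable {k : Type*} [Field k]

/-- The maximal degree in `T` of the coefficients of `P`. -/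
noncomputable def hdeg (P : k[X][X]) : ℕ := P.support.sup fun i => (P.coeff i).natDegree

lemma natDegree_coeff_le_hdeg (P : k[X][X]) (i : ℕ) : (P.coeff i).natDegree ≤ hdeg P := by
  by_cases h : i ∈ P.support
  · exact Finset.le_sup (f := fun i => (P.coeff i).natDegree) h
  · simp [notMem_support_iff.1 h]

lemma exists_natDegree_coeff_eq_hdeg {P : k[X][X]} (hP : P ≠ 0) :
    ∃ i, P.coeff i ≠ 0 ∧ (P.coeff i).natDegree = hdeg P := by
  obtain ⟨i, hi, h⟩ := Finset.exists_mem_eq_sup P.support (nonempty_support_iff.2 hP)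
    fun i => (P.coeff i).natDegree
  exact ⟨i, mem_support_iff.1 hi, h.symm⟩

variable {Fq : Type} [Field Fq] [Fintype Fq]

lemma Hpoly_eq {P : Fq[X][X]} (hP : P ≠ 0) :
    Hpoly Fq P = (Fintype.card Fq : ℝ) ^ hdeg P := by
  refine IsGreatest.csSup_eq ⟨?_, ?_⟩
  · obtain ⟨i, h0, hi⟩ := exists_natDegree_coeff_eq_hdeg hP
    exact ⟨i, by rw [pabs, absQ_toLS h0, hi]⟩
  · rintro _ ⟨i, rfl⟩
    exact absQ_toLS_le (natDegree_coeff_le_hdeg P i)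

lemma finite_setOf_natDegree_le (n : ℕ) : {f : Fq[X] | f.natDegree ≤ n}.Finite := by
  refine Set.Finite.of_finite_image (f := fun f : Fq[X] => fun i : Fin (n + 1) => f.coeff i)
    (Set.toFinite _) ?_
  intro f hf g hg h
  ext i
  by_cases hi : i ≤ n
  · exact congrFun h ⟨i, Nat.lt_succ_of_le hi⟩
  · rw [coeff_eq_zero_of_natDegree_lt (lt_of_le_of_lt hf (not_le.1 hi)),
      coeff_eq_zero_of_natDegree_lt (lt_of_le_of_lt hg (not_le.1 hi))]

lemma finite_setOf_hdeg_le (n K : ℕ) :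
    {P : Fq[X][X] | P.natDegree ≤ n ∧ hdeg P ≤ K}.Finite := by
  have hfin := finite_setOf_natDegree_le (Fq := Fq) K
  refine Set.Finite.of_finite_image (f := fun P : Fq[X][X] => fun i : Fin (n + 1) => P.coeff i)
    ((Set.Finite.pi' fun _ => hfin).subset ?_) ?_
  · rintro _ ⟨P, hP, rfl⟩ i
    exact (natDegree_coeff_le_hdeg P i).trans hP.2
  · intro f hf g hg h
    refine Polynomial.ext fun i => ?_
    by_cases hi : i ≤ n
    · exact congrFun h ⟨i, Nat.lt_succ_of_le hi⟩
    · rw [coeff_eq_zero_of_natDegree_lt (lt_of_le_of_lt hf.1 (not_le.1 hi)),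
        coeff_eq_zero_of_natDegree_lt (lt_of_le_of_lt hg.1 (not_le.1 hi))]

end Height

section Frobenius

variable (Fq : Type) [Field Fq] [Fintype Fq] (R : Type*) [CommRing R] [Algebra Fq R]

/-- The ring endomorphism `x ↦ x ^ (q ^ t)` of an `F_q`-algebra. -/
noncomputable def powHom (t : ℕ) : R →+* R where
  toFun x := x ^ Fintype.card Fq ^ t
  map_one' := one_pow _
  map_zero' := zero_pow (pow_ne_zero _ Fintype.card_ne_zero)
  map_mul' x y := mul_pow x y _
  map_add' x y := by
    rcases subsingleton_or_nontrivial R with h | h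
    · exact Subsingleton.elim _ _
    obtain ⟨s, hp, hs⟩ := FiniteField.card Fq (ringChar Fq)
    have hchar : CharP R (ringChar Fq) :=
      charP_of_injective_algebraMap (algebraMap Fq R).injective _
    have : Fact (ringChar Fq).Prime := ⟨hp⟩
    rw [hs, ← pow_mul, add_pow_char_pow]

@[simp] lemma powHom_apply (t : ℕ) (x : R) : powHom Fq R t x = x ^ Fintype.card Fq ^ t := rfl

variable {R}

lemma add_pow_card_pow (t : ℕ) (x y : R) :
    (x + y) ^ Fintype.card Fq ^ t = x ^ Fintype.card Fq ^ t + y ^ Fintype.card Fq ^ t :=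
  map_add (powHom Fq R t) x y

lemma sub_pow_card_pow (t : ℕ) (x y : R) :
    (x - y) ^ Fintype.card Fq ^ t = x ^ Fintype.card Fq ^ t - y ^ Fintype.card Fq ^ t :=
  map_sub (powHom Fq R t) x y

end Frobenius

/-- A binary quadratic form `a x ^ 2 + b x y + c y ^ 2`. -/
structure BinForm (R : Type*) where
  /-- The coefficient of `x ^ 2`. -/
  a : R
  /-- The coefficient of `x y`. -/
  b : R
  /-- The coefficient of `y ^ 2`. -/
  c : R

namespace BinForm

variable {R S : Type*} [CommRing R] [CommRing S]

/-- The value of a binary quadratic form. -/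
def eval (F : BinForm R) (x y : R) : R := F.a * x ^ 2 + F.b * (x * y) + F.c * y ^ 2

/-- The discriminant of a binary quadratic form. -/
def disc (F : BinForm R) : R := F.b ^ 2 - 4 * (F.a * F.c)

/-- The image of a binary quadratic form under a ring homomorphism. -/
def map (φ : R →+* S) (F : BinForm R) : BinForm S := ⟨φ F.a, φ F.b, φ F.c⟩

/-- The form `F (D x - B y, A y - C x)`. -/
def subst (F : BinForm R) (A B C D : R) : BinForm R where
  a := F.a * D ^ 2 - F.b * (D * C) + F.c * C ^ 2
  b := F.b * (D * A + B * C) - 2 * (F.a * (D * B)) - 2 * (F.c * (A * C))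
  c := F.a * B ^ 2 - F.b * (A * B) + F.c * A ^ 2

lemma eval_subst (F : BinForm R) (A B C D x y : R) :
    (F.subst A B C D).eval x y = F.eval (D * x - B * y) (A * y - C * x) := by
  simp only [eval, subst]; ring

lemma disc_subst (F : BinForm R) (A B C D : R) :
    (F.subst A B C D).disc = F.disc * (A * D - B * C) ^ 2 := by
  simp only [disc, subst]; ring

lemma map_subst (φ : R →+* S) (F : BinForm R) (A B C D : R) :
    (F.subst A B C D).map φ = (F.map φ).subst (φ A) (φ B) (φ C) (φ D) := by
  simp only [map, subst, map_sub, map_add, map_mul, map_pow, map_ofNat]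

lemma eval_map (φ : R →+* S) (F : BinForm R) (x y : R) :
    (F.map φ).eval (φ x) (φ y) = φ (F.eval x y) := by
  simp [map, eval]

lemma disc_map (φ : R →+* S) (F : BinForm R) : (F.map φ).disc = φ F.disc := by
  simp only [map, disc, map_sub, map_mul, map_pow, map_ofNat]

lemma map_map {U : Type*} [CommRing U] (φ : R →+* S) (ψ : S →+* U) (F : BinForm R) :
    (F.map φ).map ψ = F.map (ψ.comp φ) := rfl

end BinForm

section FibPair

variable {k : Type*} [Field k]

/-- `(u, v)` satisfies `u ^ 2 + T u v - v ^ 2 = -1`, like a pair of consecutive Fibonacci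
polynomials of even and odd index; `d` is the degree of `v`. -/
structure FibPair (d : ℕ) (u v : k[X]) : Prop where
  norm : u ^ 2 + X * (u * v) - v ^ 2 = -1
  dvd : X ∣ u
  monic : v.Monic
  natDegree : v.natDegree = d
  degree_lt : u.degree < v.degree

lemma FibPair.exists (k : Type*) [Field k] (j : ℕ) : ∃ u v : k[X], FibPair (2 * j) u v := by
  induction j with
  | zero => exact ⟨0, 1, by ring, dvd_zero _, monic_one, natDegree_one, by simp⟩
  | succ j ih =>
    obtain ⟨u, v, h⟩ := ih
    have hXv : (X * v).Monic := monic_X.mul h.monic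
    have hdeg : v.degree < (X * v).degree := mul_comm v X ▸ degree_lt_degree_mul_X h.monic.ne_zero
    have hw : (X * v + u).Monic := hXv.add_of_left (h.degree_lt.trans hdeg)
    have hwd : (X * v + u).degree = (X * v).degree :=
      degree_add_eq_left_of_degree_lt (h.degree_lt.trans hdeg)
    have hXw : (X * (X * v + u)).Monic := monic_X.mul hw
    have hdeg2 : (X * v + u).degree < (X * (X * v + u)).degree :=
      mul_comm (X * v + u) X ▸ degree_lt_degree_mul_X hw.ne_zero
    have hlt : v.degree < (X * (X * v + u)).degree := hdeg.trans (hwd ▸ hdeg2)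
    have hfin : (X * (X * v + u) + v).degree = (X * (X * v + u)).degree :=
      degree_add_eq_left_of_degree_lt hlt
    refine ⟨X * v + u, X * (X * v + u) + v, ?_, ?_, hXw.add_of_left hlt, ?_, ?_⟩
    · linear_combination h.norm
    · exact dvd_add (dvd_mul_right _ _) h.dvd
    · rw [natDegree_eq_of_degree_eq hfin, natDegree_X_mul hw.ne_zero,
        natDegree_eq_of_degree_eq hwd, natDegree_X_mul h.monic.ne_zero, h.natDegree]
      ring
    · rw [hfin]; exact hdeg2

namespace FibPair

variable {d : ℕ} {u v : k[X]} (h : FibPair d u v)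

include h

lemma natDegree_left : u.natDegree ≤ d := by
  rw [← h.natDegree]; exact natDegree_le_natDegree h.degree_lt.le

lemma coeff_left : u.coeff d = 0 := by
  apply coeff_eq_zero_of_degree_lt
  rw [← h.natDegree, ← degree_eq_natDegree h.monic.ne_zero]
  exact h.degree_lt

lemma coeff_right : v.coeff d = 1 := by
  rw [← h.natDegree]; exact h.monic

lemma det : X * u * (X * v + u) - v * (X * v) = -X := by
  linear_combination X * h.norm

end FibPair

end FibPair

section ApproxForm

/-- The exponents of the heights of the approximating quadratic forms. -/
def hExp (r d : ℕ) : ℕ → ℕ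
  | 0 => 1
  | i + 1 => r * hExp r d i + 2 * (d + 1)

/-- The exponents of the values of the approximating quadratic forms. -/
def eExp (r d : ℕ) : ℕ → ℕ
  | 0 => 2 * (d + 1)
  | i + 1 => r * eExp r d i + 2 * d

/-- Half of the degrees of the discriminants of the approximating quadratic forms. -/
def dExp (r : ℕ) : ℕ → ℕ
  | 0 => 1
  | i + 1 => r * dExp r i + 1

lemma BinForm.eval_mul_right {R : Type*} [CommRing R] (F : BinForm R) (x y s : R) :
    F.eval (x * s) (y * s) = s ^ 2 * F.eval x y := by
  simp only [BinForm.eval]; ring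

variable (Fq : Type) [Field Fq] [Fintype Fq]

/-- The binary quadratic forms `P_i` over `F_q[T]` obtained from `x ^ 2 + T x y - y ^ 2` by
iterating Frobenius followed by a substitution of determinant `-T`. -/
noncomputable def approxForm (t : ℕ) (u v : Fq[X]) : ℕ → BinForm Fq[X]
  | 0 => ⟨1, X, -1⟩
  | i + 1 => ((approxForm t u v i).map (powHom Fq Fq[X] t)).subst (X * u) v (X * v) (X * v + u)

variable {Fq} {d : ℕ} {u v : Fq[X]} (h : FibPair d u v) (t : ℕ)

lemma powHom_comp (R : Type*) [CommRing R] [Algebra Fq R] (s t : ℕ) :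
    (powHom Fq R s).comp (powHom Fq R t) = powHom Fq R (t + s) := by
  ext x
  simp [pow_add, pow_mul]

lemma eq_zero_of_quadratic_eq_zero {k : Type*} [Field k] {s : ℕ} (hs : s ≠ 0) {x y : k[X]}
    (hxy : x ^ 2 + X ^ s * (x * y) - y ^ 2 = 0) : x = 0 ∧ y = 0 := by
  rcases eq_or_ne x 0 with rfl | hx
  · exact ⟨rfl, by simpa using hxy⟩
  exfalso
  obtain ⟨x', hx'⟩ := EuclideanDomain.gcd_dvd_left x y
  obtain ⟨y', hy'⟩ := EuclideanDomain.gcd_dvd_right x y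
  have hbez := EuclideanDomain.gcd_eq_gcd_ab x y
  set g := EuclideanDomain.gcd x y
  have hg : g ≠ 0 := fun h0 => hx (by rw [hx', h0, zero_mul])
  have hcop : IsCoprime x' y' := by
    refine ⟨EuclideanDomain.gcdA x y, EuclideanDomain.gcdB x y, mul_left_cancel₀ hg ?_⟩
    linear_combination -hbez - EuclideanDomain.gcdA x y * hx' - EuclideanDomain.gcdB x y * hy'
  have hxy' : x' ^ 2 + X ^ s * (x' * y') - y' ^ 2 = 0 := by
    apply (mul_eq_zero.1 (_ : g ^ 2 * _ = 0)).resolve_left (pow_ne_zero 2 hg)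
    rw [hx', hy'] at hxy
    linear_combination hxy
  have hux : IsUnit x' := (hcop.pow_right (n := 2)).isUnit_of_dvd' dvd_rfl
    ⟨x' + X ^ s * y', by linear_combination -hxy'⟩
  have huy : IsUnit y' := (hcop.pow_left (m := 2)).isUnit_of_dvd'
    ⟨y' - X ^ s * x', by linear_combination hxy'⟩ dvd_rfl
  obtain ⟨p, hp, hp'⟩ := isUnit_iff.1 hux
  obtain ⟨p2, hp2, hp2'⟩ := isUnit_iff.1 huy
  have h1 := congrArg natDegree (show X ^ s * (x' * y') = y' ^ 2 - x' ^ 2 by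
    linear_combination hxy')
  rw [← hp', ← hp2', ← C_mul, ← C_pow, ← C_pow, ← C_sub, natDegree_C, mul_comm,
    natDegree_C_mul_X_pow _ _ (hp.mul hp2).ne_zero] at h1
  exact hs h1

include h

lemma natDegree_approxForm_le (i : ℕ) :
    (approxForm Fq t u v i).a.natDegree ≤ hExp (Fintype.card Fq ^ t) d i ∧
    (approxForm Fq t u v i).b.natDegree ≤ hExp (Fintype.card Fq ^ t) d i ∧
    (approxForm Fq t u v i).c.natDegree ≤ hExp (Fintype.card Fq ^ t) d i := by
  induction i with
  | zero => simp [approxForm, hExp]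
  | succ i ih =>
    set F := approxForm Fq t u v i
    set r := Fintype.card Fq ^ t
    obtain ⟨ha, hb, hc⟩ := ih
    have hA : (X * u).natDegree ≤ d + 1 :=
      natDegree_mul_le.trans (by have := h.natDegree_left; rw [natDegree_X]; omega)
    have hB : v.natDegree ≤ d + 1 := by rw [h.natDegree]; omega
    have hC : (X * v).natDegree ≤ d + 1 :=
      natDegree_mul_le.trans (by have := h.natDegree; rw [natDegree_X]; omega)
    have hD : (X * v + u).natDegree ≤ d + 1 :=
      natDegree_add_le_of_degree_le hC (h.natDegree_left.trans (by omega))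
    have key : ∀ {f x y : Fq[X]}, f.natDegree ≤ hExp r d i → x.natDegree ≤ d + 1 →
        y.natDegree ≤ d + 1 → (f ^ r * (x * y)).natDegree ≤ r * hExp r d i + 2 * (d + 1) := by
      intro f x y hf hx hy
      rw [two_mul]
      exact natDegree_mul_le_of_le (natDegree_pow_le_of_le r hf) (natDegree_mul_le_of_le hx hy)
    have key2 : ∀ {f : Fq[X]} {N : ℕ}, f.natDegree ≤ N → (2 * f).natDegree ≤ N := by
      intro f N hf
      rw [two_mul]
      exact natDegree_add_le_of_degree_le hf hf
    simp only [approxForm, BinForm.subst, BinForm.map, powHom_apply, hExp, sq]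
    refine ⟨?_, ?_, ?_⟩
    · exact natDegree_add_le_of_degree_le (natDegree_sub_le_of_le (key ha hD hD) (key hb hD hC)
        |>.trans (max_self _).le) (key hc hC hC)
    · rw [mul_add]
      refine (natDegree_sub_le_of_le (natDegree_sub_le_of_le (natDegree_add_le_of_degree_le
        (key hb hD hA) (key hb hB hC)) (key2 (key ha hD hB))) (key2 (key hc hA hC))).trans ?_
      simp
    · exact natDegree_add_le_of_degree_le (natDegree_sub_le_of_le (key ha hB hB) (key hb hA hB)
        |>.trans (max_self _).le) (key hc hA hA)

lemma coeff_approxForm_ne_zero (i : ℕ) :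
    ((approxForm Fq t u v i).a - (approxForm Fq t u v i).b + (approxForm Fq t u v i).c).coeff
      (hExp (Fintype.card Fq ^ t) d i) ≠ 0 := by
  induction i with
  | zero => simp [approxForm, hExp, coeff_one]
  | succ i ih =>
    obtain ⟨ha, hb, hc⟩ := natDegree_approxForm_le h t i
    set F := approxForm Fq t u v i
    have hr := sub_pow_card_pow Fq t (F.a.coeff (hExp (Fintype.card Fq ^ t) d i))
      (F.b.coeff (hExp (Fintype.card Fq ^ t) d i))
    have hr2 := add_pow_card_pow Fq t (F.a.coeff (hExp (Fintype.card Fq ^ t) d i) -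
      F.b.coeff (hExp (Fintype.card Fq ^ t) d i)) (F.c.coeff (hExp (Fintype.card Fq ^ t) d i))
    set r := Fintype.card Fq ^ t
    have hE : (X * v + u + v).natDegree ≤ d + 1 := by
      refine natDegree_add_le_of_degree_le (natDegree_add_le_of_degree_le
        (natDegree_mul_le.trans ?_) (h.natDegree_left.trans ?_)) ?_ <;>
      simp [h.natDegree]
      omega
    have hF : (X * v + X * u).natDegree ≤ d + 1 := by
      have := h.natDegree_left
      refine natDegree_add_le_of_degree_le (natDegree_mul_le.trans ?_)
        (natDegree_mul_le.trans ?_) <;>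
      simp [h.natDegree] <;> omega
    have hu : u.coeff (d + 1) = 0 := coeff_eq_zero_of_natDegree_lt (by
      have := h.natDegree_left; omega)
    have hv : v.coeff (d + 1) = 0 := coeff_eq_zero_of_natDegree_lt (by
      have := h.natDegree; omega)
    have hE1 : (X * v + u + v).coeff (d + 1) = 1 := by
      simp [coeff_X_mul, h.coeff_right, hu, hv]
    have hF1 : (X * v + X * u).coeff (d + 1) = 1 := by
      simp [coeff_X_mul, h.coeff_right, h.coeff_left]
    have key : ∀ {f x y : Fq[X]}, f.natDegree ≤ hExp r d i → x.natDegree ≤ d + 1 →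
        y.natDegree ≤ d + 1 → x.coeff (d + 1) = 1 → y.coeff (d + 1) = 1 →
        (f ^ r * (x * y)).coeff (r * hExp r d i + ((d + 1) + (d + 1))) =
          f.coeff (hExp r d i) ^ r := by
      intro f x y hf hx hy hx1 hy1
      rw [coeff_mul_add_eq_of_natDegree_le (natDegree_pow_le_of_le r hf)
        (natDegree_mul_le_of_le hx hy), coeff_mul_add_eq_of_natDegree_le hx hy, hx1, hy1,
        coeff_pow_of_natDegree_le hf]
      simp
    have hsum : (approxForm Fq t u v (i + 1)).a - (approxForm Fq t u v (i + 1)).b +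
        (approxForm Fq t u v (i + 1)).c =
        F.a ^ r * ((X * v + u + v) * (X * v + u + v)) -
        F.b ^ r * ((X * v + u + v) * (X * v + X * u)) +
        F.c ^ r * ((X * v + X * u) * (X * v + X * u)) := by
      simp only [approxForm, BinForm.subst, BinForm.map, powHom_apply, F, r]
      ring
    rw [hsum, hExp, two_mul, coeff_add, coeff_sub, key ha hE hE hE1 hE1, key hb hE hF hE1 hF1,
      key hc hF hF hF1 hF1, ← hr, ← hr2]
    simpa using pow_ne_zero r ih

lemma disc_approxForm (i : ℕ) : (approxForm Fq t u v i).disc ≠ 0 ∧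
    (approxForm Fq t u v i).disc.natDegree = 2 * dExp (Fintype.card Fq ^ t) i := by
  induction i with
  | zero =>
    have h4 : (approxForm Fq t u v 0).disc = X ^ 2 + C 4 := by
      simp only [approxForm, BinForm.disc, map_ofNat]; ring
    rw [h4]
    exact ⟨X_pow_add_C_ne_zero two_pos _, by rw [natDegree_X_pow_add_C]; rfl⟩
  | succ i ih =>
    rw [approxForm, BinForm.disc_subst, h.det, BinForm.disc_map, powHom_apply]
    refine ⟨by simp [ih.1, X_ne_zero], ?_⟩
    rw [natDegree_mul (pow_ne_zero _ ih.1) (by simp [X_ne_zero]), natDegree_pow, natDegree_pow,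
      natDegree_neg, natDegree_X, ih.2, dExp]
    ring

lemma approxForm_map_anisotropic (i s : ℕ) {x y : Fq[X]}
    (hxy : ((approxForm Fq t u v i).map (powHom Fq Fq[X] s)).eval x y = 0) : x = 0 ∧ y = 0 := by
  induction i generalizing s x y with
  | zero =>
    refine eq_zero_of_quadratic_eq_zero (s := Fintype.card Fq ^ s)
      (pow_ne_zero _ Fintype.card_ne_zero) ?_
    simpa [approxForm, BinForm.eval, BinForm.map, sub_eq_add_neg, ← powHom_apply] using hxy
  | succ i ih =>
    rw [approxForm, BinForm.map_subst, BinForm.map_map, powHom_comp, BinForm.eval_subst] at hxy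
    obtain ⟨h1, h2⟩ := ih _ hxy
    have hdet := congrArg (powHom Fq Fq[X] s) h.det
    rw [map_sub, map_mul _ (X * u), map_mul _ v] at hdet
    have hX : powHom Fq Fq[X] s (-X) ≠ 0 := by simp [X_ne_zero]
    set φ := powHom Fq Fq[X] s
    constructor
    · apply (mul_eq_zero.1 (_ : φ (-X) * _ = 0)).resolve_left hX
      rw [← hdet]
      linear_combination φ (X * u) * h1 + φ v * h2
    · apply (mul_eq_zero.1 (_ : φ (-X) * _ = 0)).resolve_left hX
      rw [← hdet]
      linear_combination φ (X * v) * h1 + φ (X * v + u) * h2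

lemma approxForm_anisotropic (i : ℕ) {x y : Fq[X]}
    (hxy : (approxForm Fq t u v i).eval x y = 0) : x = 0 ∧ y = 0 := by
  refine approxForm_map_anisotropic h t i 0 ?_
  convert hxy
  simp [BinForm.map]

end ApproxForm

section FixedPoint

variable {Fq : Type} [Field Fq] [Fintype Fq]

/-- Contraction principle on the maximal ideal of `F_q[[T⁻¹]]`. -/
lemma exists_fixedPoint_of_contraction (f : LaurentSeries Fq → LaurentSeries Fq)
    (hmaps : ∀ x, absQ Fq x ≤ (Fintype.card Fq : ℝ)⁻¹ → absQ Fq (f x) ≤ (Fintype.card Fq : ℝ)⁻¹)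
    (hlip : ∀ x y, absQ Fq x ≤ (Fintype.card Fq : ℝ)⁻¹ → absQ Fq y ≤ (Fintype.card Fq : ℝ)⁻¹ →
      absQ Fq (f x - f y) ≤ (Fintype.card Fq : ℝ)⁻¹ * absQ Fq (x - y)) :
    ∃ x, absQ Fq x ≤ (Fintype.card Fq : ℝ)⁻¹ ∧ f x = x := by
  have hq := card_real_pos Fq
  set x : ℕ → LaurentSeries Fq := fun n => f^[n] 0 with hx
  have hsucc : ∀ n, x (n + 1) = f (x n) := fun n => Function.iterate_succ_apply' f n 0
  have hball : ∀ n, absQ Fq (x n) ≤ (Fintype.card Fq : ℝ)⁻¹ := by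
    intro n
    induction n with
    | zero => simp [hx]
    | succ n ih => rw [hsucc]; exact hmaps _ ih
  have hdist : ∀ n : ℕ, absQ Fq (x (n + 1) - x n) ≤ (Fintype.card Fq : ℝ) ^ (-(n + 1 : ℤ)) := by
    intro n
    induction n with
    | zero => simpa [hx] using hball 1
    | succ n ih =>
      rw [hsucc (n + 1)]
      nth_rw 2 [hsucc n]
      refine (hlip _ _ (hball _) (hball _)).trans ?_
      have : (Fintype.card Fq : ℝ) ^ (-((n + 1 : ℕ) + 1 : ℤ)) =
          (Fintype.card Fq : ℝ)⁻¹ * (Fintype.card Fq : ℝ) ^ (-(n + 1 : ℤ)) := by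
        rw [← zpow_neg_one, ← zpow_add₀ hq.ne']
        push_cast
        ring_nf
      rw [this]
      exact mul_le_mul_of_nonneg_left ih (inv_nonneg.2 hq.le)
  have hcoef : ∀ n : ℕ, ∀ k : ℤ, k < 1 → (x n).coeff k = 0 := by
    intro n
    exact (absQ_le_zpow_iff (x n) 1).1 (by simpa using hball n)
  have hstab : ∀ (j k : ℕ), (x (k + j)).coeff k = (x k).coeff k := by
    intro j k
    induction j with
    | zero => rfl
    | succ j ih =>
      have := (absQ_le_zpow_iff _ ((k + j : ℕ) + 1 : ℤ)).1 (hdist (k + j)) k (by push_cast; omega)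
      rw [HahnSeries.coeff_sub, sub_eq_zero] at this
      rw [← add_assoc, this, ih]
  let ξ : LaurentSeries Fq := HahnSeries.ofSuppBddBelow (fun k => (x k.toNat).coeff k)
    ⟨0, fun k hk => by
      by_contra hlt
      exact hk (hcoef _ _ (by omega))⟩
  have hξ : ∀ k : ℤ, ξ.coeff k = (x k.toNat).coeff k := fun k => rfl
  have happrox : ∀ n : ℕ, absQ Fq (ξ - x n) ≤ (Fintype.card Fq : ℝ) ^ (-(n + 1 : ℤ)) := by
    intro n
    rw [absQ_le_zpow_iff]
    intro k hk
    rw [HahnSeries.coeff_sub, sub_eq_zero, hξ]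
    by_cases hk1 : k < 1
    · rw [hcoef _ _ hk1, hcoef _ _ hk1]
    · obtain ⟨k, rfl⟩ := Int.eq_ofNat_of_zero_le (by omega : 0 ≤ k)
      obtain ⟨j, rfl⟩ := Nat.exists_eq_add_of_le (by omega : k ≤ n)
      rw [Int.toNat_natCast, hstab]
  have hξball : absQ Fq ξ ≤ (Fintype.card Fq : ℝ)⁻¹ := by
    simpa [hx] using happrox 0
  refine ⟨ξ, hξball, ?_⟩
  rw [← sub_eq_zero]
  ext k
  have hle : absQ Fq (f ξ - ξ) ≤ (Fintype.card Fq : ℝ) ^ (-(k.toNat + 1 : ℤ)) := by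
    have h1 : absQ Fq (f ξ - f (x k.toNat)) ≤ (Fintype.card Fq : ℝ) ^ (-(k.toNat + 1 : ℤ)) := by
      refine (hlip _ _ hξball (hball _)).trans ((mul_le_of_le_one_left (absQ_nonneg _) ?_).trans
        (happrox _))
      exact inv_le_one_of_one_le₀ (one_lt_card_real Fq).le
    have h2 : absQ Fq (x (k.toNat + 1) - ξ) ≤ (Fintype.card Fq : ℝ) ^ (-(k.toNat + 1 : ℤ)) := by
      rw [← absQ_neg, neg_sub]
      refine (happrox _).trans (zpow_le_zpow_right₀ (one_lt_card_real Fq).le ?_)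
      push_cast
      omega
    rw [hsucc] at h2
    have := absQ_add_le_of_le h1 h2
    rwa [sub_add_sub_cancel] at this
  exact (absQ_le_zpow_iff _ _).1 hle k (by have := Int.self_le_toNat k; omega)

end FixedPoint

section Root

variable {Fq : Type} [Field Fq] [Fintype Fq] {d : ℕ} {u v : Fq[X]}

lemma FibPair.absQ_left_le (h : FibPair d u v) :
    absQ Fq (toLS Fq u) ≤ (Fintype.card Fq : ℝ) ^ d := absQ_toLS_le h.natDegree_left

lemma FibPair.absQ_right (h : FibPair d u v) :
    absQ Fq (toLS Fq v) = (Fintype.card Fq : ℝ) ^ d := by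
  rw [absQ_toLS h.monic.ne_zero, h.natDegree]

lemma FibPair.absQ_X_mul_add (h : FibPair d u v) :
    absQ Fq (toLS Fq (X * v + u)) = (Fintype.card Fq : ℝ) ^ (d + 1) := by
  have h1 : absQ Fq (toLS Fq (X * v)) = (Fintype.card Fq : ℝ) ^ (d + 1) := by
    rw [map_mul, absQ_mul, toLS_X, absQ_Tls, h.absQ_right, pow_succ']
  rw [map_add, absQ_add_eq_left, h1]
  rw [h1]
  exact h.absQ_left_le.trans_lt (pow_lt_pow_right₀ (one_lt_card_real Fq) d.lt_succ_self)

/-- A root in the maximal ideal of `F_q[[T⁻¹]]` of the hyperquadratic equation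
`ξ = (T u ξ ^ r + v) / (T v ξ ^ r + T v + u)`, `r = q ^ t`. -/
structure IsHyperRoot (t : ℕ) (u v : Fq[X]) (ξ : LaurentSeries Fq) : Prop where
  eq : ξ * (toLS Fq (X * v) * ξ ^ Fintype.card Fq ^ t + toLS Fq (X * v + u)) =
    toLS Fq (X * u) * ξ ^ Fintype.card Fq ^ t + toLS Fq v
  absQ_le : absQ Fq ξ ≤ (Fintype.card Fq : ℝ)⁻¹

lemma exists_isHyperRoot (h : FibPair d u v) {t : ℕ} (ht : 2 ≤ Fintype.card Fq ^ t) :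
    ∃ ξ, IsHyperRoot t u v ξ := by
  have hq := card_real_pos Fq
  have hq1 := one_lt_card_real Fq
  have hD := h.absQ_X_mul_add
  have hD0 : toLS Fq (X * v + u) ≠ 0 := by
    intro h0
    rw [h0, absQ_zero] at hD
    exact (pow_pos hq (d + 1)).ne hD
  have hadd := fun x y : LaurentSeries Fq => sub_pow_card_pow Fq t x y
  have hfr : ∀ {x : LaurentSeries Fq}, absQ Fq x ≤ (Fintype.card Fq : ℝ)⁻¹ →
      absQ Fq (x ^ Fintype.card Fq ^ t) ≤ (Fintype.card Fq : ℝ)⁻¹ * absQ Fq x := by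
    intro x hx
    obtain ⟨s, hs⟩ := Nat.exists_eq_add_of_le' ht
    rw [absQ_pow, hs, pow_succ, pow_succ]
    refine mul_le_mul_of_nonneg_right ?_ (absQ_nonneg _)
    refine (mul_le_of_le_one_left (absQ_nonneg _) (pow_le_one₀ (absQ_nonneg _) ?_)).trans hx
    exact hx.trans (inv_le_one_of_one_le₀ hq1.le)
  have hXu : absQ Fq (toLS Fq (X * u)) ≤ (Fintype.card Fq : ℝ) ^ (d + 1) := by
    rw [map_mul, absQ_mul, toLS_X, absQ_Tls, pow_succ']
    exact mul_le_mul_of_nonneg_left h.absQ_left_le hq.le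
  have hXv : absQ Fq (toLS Fq (X * v)) ≤ (Fintype.card Fq : ℝ) ^ (d + 1) := by
    rw [map_mul, absQ_mul, toLS_X, absQ_Tls, h.absQ_right, pow_succ']
  set r := Fintype.card Fq ^ t with hr
  have hinv : (Fintype.card Fq : ℝ)⁻¹ ≤ 1 := inv_le_one_of_one_le₀ hq1.le
  have hpos := pow_pos hq (d + 1)
  suffices hfp : ∃ ξ, absQ Fq ξ ≤ (Fintype.card Fq : ℝ)⁻¹ ∧
      (toLS Fq v + toLS Fq (X * u) * ξ ^ r - toLS Fq (X * v) * (ξ ^ r * ξ)) /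
        toLS Fq (X * v + u) = ξ by
    obtain ⟨ξ, hξ, hfix⟩ := hfp
    refine ⟨ξ, ?_, hξ⟩
    rw [div_eq_iff hD0] at hfix
    linear_combination -hfix
  refine exists_fixedPoint_of_contraction (fun x : LaurentSeries Fq =>
    (toLS Fq v + toLS Fq (X * u) * x ^ r - toLS Fq (X * v) * (x ^ r * x)) /
      toLS Fq (X * v + u)) ?_ ?_
  · intro x hx
    rw [absQ_div, hD, div_le_iff₀ hpos]
    have hxr := hfr hx
    have hx1 := hx.trans hinv
    have hxr' : absQ Fq (x ^ r) ≤ (Fintype.card Fq : ℝ)⁻¹ :=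
      hxr.trans (mul_le_of_le_one_right (inv_nonneg.2 hq.le) hx1)
    have key : ∀ {a y : LaurentSeries Fq}, absQ Fq a ≤ (Fintype.card Fq : ℝ) ^ (d + 1) →
        absQ Fq y ≤ (Fintype.card Fq : ℝ)⁻¹ →
        absQ Fq (a * y) ≤ (Fintype.card Fq : ℝ)⁻¹ * (Fintype.card Fq : ℝ) ^ (d + 1) := by
      intro a y ha hy
      rw [absQ_mul, mul_comm]
      exact mul_le_mul hy ha (absQ_nonneg _) (inv_nonneg.2 hq.le)
    refine absQ_sub_le_of_le (absQ_add_le_of_le ?_ (key hXu hxr')) (key hXv ?_)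
    · rw [h.absQ_right, pow_succ', inv_mul_cancel_left₀ hq.ne']
    · rw [absQ_mul]
      exact (mul_le_of_le_one_right (absQ_nonneg _) hx1).trans hxr'
  · intro x y hx hy
    rw [← sub_div, absQ_div, hD, div_le_iff₀ hpos]
    have hxy := hfr (absQ_sub_le_of_le hx hy)
    have hx1 := hx.trans hinv
    have hxr : absQ Fq (x ^ r) ≤ (Fintype.card Fq : ℝ)⁻¹ :=
      (hfr hx).trans (mul_le_of_le_one_right (inv_nonneg.2 hq.le) hx1)
    have hkey : toLS Fq v + toLS Fq (X * u) * x ^ r - toLS Fq (X * v) * (x ^ r * x) -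
        (toLS Fq v + toLS Fq (X * u) * y ^ r - toLS Fq (X * v) * (y ^ r * y)) =
        toLS Fq (X * u) * (x - y) ^ r -
          toLS Fq (X * v) * (x ^ r * (x - y) + y * (x - y) ^ r) := by
      rw [hadd]; ring
    have key : ∀ {a z : LaurentSeries Fq}, absQ Fq a ≤ (Fintype.card Fq : ℝ) ^ (d + 1) →
        absQ Fq z ≤ (Fintype.card Fq : ℝ)⁻¹ * absQ Fq (x - y) →
        absQ Fq (a * z) ≤
          (Fintype.card Fq : ℝ)⁻¹ * absQ Fq (x - y) * (Fintype.card Fq : ℝ) ^ (d + 1) := by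
      intro a z ha hz
      rw [absQ_mul, mul_comm]
      exact mul_le_mul hz ha (absQ_nonneg _) (mul_nonneg (inv_nonneg.2 hq.le) (absQ_nonneg _))
    rw [hkey]
    refine absQ_sub_le_of_le (key hXu hxy) (key hXv (absQ_add_le_of_le ?_ ?_))
    · rw [absQ_mul]
      exact mul_le_mul_of_nonneg_right hxr (absQ_nonneg _)
    · rw [absQ_mul]
      exact (mul_le_of_le_one_left (absQ_nonneg _) (hy.trans hinv)).trans hxy

lemma IsHyperRoot.absQ_denom {t : ℕ} (ht : 2 ≤ Fintype.card Fq ^ t) (h : FibPair d u v)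
    {ξ : LaurentSeries Fq} (hξ : IsHyperRoot t u v ξ) :
    absQ Fq (toLS Fq (X * v) * ξ ^ Fintype.card Fq ^ t + toLS Fq (X * v + u)) =
      (Fintype.card Fq : ℝ) ^ (d + 1) := by
  have hq1 := one_lt_card_real Fq
  rw [add_comm, absQ_add_eq_left, h.absQ_X_mul_add]
  rw [h.absQ_X_mul_add, absQ_mul, map_mul, absQ_mul, toLS_X, absQ_Tls, h.absQ_right, absQ_pow,
    ← pow_succ']
  refine mul_lt_of_lt_one_right (pow_pos (card_real_pos Fq) _) (pow_lt_one₀ (absQ_nonneg _)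
    (hξ.absQ_le.trans_lt (inv_lt_one_of_one_lt₀ hq1)) (by omega))

lemma IsHyperRoot.absQ_approxForm {t : ℕ} (ht : 3 ≤ Fintype.card Fq ^ t) (h : FibPair d u v)
    {ξ : LaurentSeries Fq} (hξ : IsHyperRoot t u v ξ) (i : ℕ) :
    absQ Fq (((approxForm Fq t u v i).map (toLS Fq)).eval ξ 1) =
      (Fintype.card Fq : ℝ) ^ (-(eExp (Fintype.card Fq ^ t) d i : ℤ)) := by
  have hq := card_real_pos Fq
  have hq1 := one_lt_card_real Fq
  have hy := hξ.absQ_denom (by omega) h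
  have heq := hξ.eq
  have hdet := congrArg (toLS Fq) h.det
  have hnorm := congrArg (toLS Fq) h.norm
  set r := Fintype.card Fq ^ t with hr
  generalize hydef : toLS Fq (X * v) * ξ ^ r + toLS Fq (X * v + u) = y at hy heq
  have hy0 : y ≠ 0 := by
    intro h0
    rw [h0, absQ_zero] at hy
    exact (pow_pos hq (d + 1)).ne hy
  induction i with
  | zero =>
    have hz : absQ Fq (Tls Fq * ξ ^ r) ≤ (Fintype.card Fq : ℝ)⁻¹ ^ 2 := by
      obtain ⟨s, hs⟩ := Nat.exists_eq_add_of_le' ht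
      rw [absQ_mul, absQ_Tls, absQ_pow]
      calc (Fintype.card Fq : ℝ) * absQ Fq ξ ^ r
          ≤ (Fintype.card Fq : ℝ) * (Fintype.card Fq : ℝ)⁻¹ ^ 3 := by
            refine mul_le_mul_of_nonneg_left ?_ hq.le
            refine (pow_le_pow_of_le_one (absQ_nonneg _) (hξ.absQ_le.trans
              (inv_le_one_of_one_le₀ hq1.le)) ht).trans
              (pow_le_pow_left₀ (absQ_nonneg _) hξ.absQ_le 3)
        _ = (Fintype.card Fq : ℝ)⁻¹ ^ 2 := by field_simp
    have hinv : (Fintype.card Fq : ℝ)⁻¹ < 1 := inv_lt_one_of_one_lt₀ hq1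
    have hmul : ((approxForm Fq t u v 0).map (toLS Fq)).eval ξ 1 * y ^ 2 =
        1 + -(Tls Fq * ξ ^ r * (Tls Fq * ξ ^ r + Tls Fq)) := by
      simp only [map_mul, map_sub, map_add, map_pow, map_neg, map_one, toLS_X] at hnorm heq hydef
      simp only [approxForm, BinForm.map, BinForm.eval, map_one, map_neg, toLS_X]
      linear_combination (ξ * y + (Tls Fq * toLS Fq u * ξ ^ r + toLS Fq v)) * heq +
        Tls Fq * y * heq - (Tls Fq * (Tls Fq * toLS Fq u * ξ ^ r + toLS Fq v) - (y +
          (Tls Fq * toLS Fq v * ξ ^ r + (Tls Fq * toLS Fq v + toLS Fq u)))) * hydef +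
        ((Tls Fq * ξ ^ r) ^ 2 + Tls Fq * (Tls Fq * ξ ^ r) - 1) * hnorm
    have hone : absQ Fq (1 + -(Tls Fq * ξ ^ r * (Tls Fq * ξ ^ r + Tls Fq))) = 1 := by
      rw [absQ_add_eq_left, absQ_one]
      rw [absQ_one, absQ_neg, absQ_mul]
      refine (mul_le_mul hz (absQ_add_le_of_le (B := Fintype.card Fq) (hz.trans ?_)
        absQ_Tls.le) (absQ_nonneg _) (by positivity)).trans_lt ?_
      · exact (pow_le_one₀ (by positivity) hinv.le).trans hq1.le
      · rw [sq, mul_assoc, inv_mul_cancel₀ hq.ne', mul_one]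
        exact hinv
    rw [← hmul, absQ_mul, absQ_pow, hy] at hone
    rw [eq_one_div_of_mul_eq_one_left hone, eExp, zpow_neg, zpow_natCast, one_div, ← pow_mul,
      mul_comm]
  | succ i ih =>
    have hκ : (toLS Fq (X * u) - toLS Fq (X * v) * ξ) * y = -Tls Fq := by
      simp only [map_mul, map_sub, map_add, map_neg, toLS_X] at hdet heq hydef ⊢
      linear_combination hdet - toLS Fq v * Tls Fq * heq - Tls Fq * toLS Fq u * hydef
    have hκabs : absQ Fq (toLS Fq (X * u) - toLS Fq (X * v) * ξ) =
        (Fintype.card Fq : ℝ) ^ (-(d : ℤ)) := by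
      have := congrArg (absQ Fq) hκ
      rw [absQ_mul, hy, absQ_neg, absQ_Tls, pow_succ] at this
      rw [zpow_neg, zpow_natCast]
      field_simp at this ⊢
      linear_combination this
    have h1 : toLS Fq (X * v + u) * ξ - toLS Fq v * 1 =
        ξ ^ r * (toLS Fq (X * u) - toLS Fq (X * v) * ξ) := by
      linear_combination heq + ξ * hydef
    have h2 : toLS Fq (X * u) * 1 - toLS Fq (X * v) * ξ =
        1 ^ r * (toLS Fq (X * u) - toLS Fq (X * v) * ξ) := by
      rw [one_pow]; ring
    have hcomm : ((approxForm Fq t u v i).map (powHom Fq Fq[X] t)).map (toLS Fq) =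
        ((approxForm Fq t u v i).map (toLS Fq)).map (powHom Fq _ t) := by
      simp [BinForm.map]
    rw [approxForm, BinForm.map_subst, hcomm, BinForm.eval_subst, h1, h2, BinForm.eval_mul_right,
      ← powHom_apply Fq _ t ξ, ← powHom_apply Fq _ t 1, BinForm.eval_map, powHom_apply,
      absQ_mul, absQ_pow, absQ_pow, ih, hκabs, eExp, ← zpow_natCast, ← zpow_natCast, ← zpow_mul,
      ← zpow_mul, ← zpow_add₀ hq.ne']
    congr 1
    push_cast [r]
    ring

end Root

section CommonRoot

variable {k : Type*} [Field k] {F : Type*} [Field F]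

/-- A polynomial which is irreducible over the fraction field divides, over the fraction field,
every polynomial with which it shares a root in a field. -/
lemma map_dvd_map_of_common_root {φ : k[X] →+* F} (hφ : Function.Injective φ) {E Q : k[X][X]}
    (hE : Irreducible (E.map (algebraMap k[X] (FractionRing k[X])))) {x : F}
    (hEx : E.eval₂ φ x = 0) (hQx : Q.eval₂ φ x = 0) :
    E.map (algebraMap k[X] (FractionRing k[X])) ∣ Q.map (algebraMap k[X] (FractionRing k[X])) := by
  by_contra hnd
  obtain ⟨a, b, hab⟩ := (hE.coprime_iff_not_dvd).2 hnd
  have hcomp : (IsFractionRing.lift (K := FractionRing k[X]) hφ).comp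
      (algebraMap k[X] (FractionRing k[X])) = φ :=
    RingHom.ext fun y => IsFractionRing.lift_algebraMap hφ y
  have := congrArg (eval₂ (IsFractionRing.lift (K := FractionRing k[X]) hφ) x) hab
  rw [eval₂_add, eval₂_mul, eval₂_mul, eval₂_map, eval₂_map, hcomp, hEx, hQx, eval₂_one] at this
  simp at this

end CommonRoot

section Degree

variable {k : Type*} [Field k] {d : ℕ} {u v : k[X]}

/-- The reciprocal of the polynomial defining a hyperquadratic root; it is an Eisenstein
polynomial at `T`. -/
noncomputable def eisPoly (r : ℕ) (u v : k[X]) : k[X][X] :=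
  C v * X ^ (r + 1) - C (X * v + u) * X ^ r + C (X * u) * X - C (X * v)

lemma coeff_eisPoly (r : ℕ) (u v : k[X]) (n : ℕ) : (eisPoly r u v).coeff n =
    (if n = r + 1 then v else 0) - (if n = r then X * v + u else 0) +
      (if n = 1 then X * u else 0) - if n = 0 then X * v else 0 := by
  simp only [eisPoly, coeff_sub, coeff_add, coeff_C_mul, coeff_X_pow, coeff_C, coeff_X,
    mul_ite, mul_one, mul_zero, eq_comm (a := 1) (b := n)]

namespace FibPair

variable (h : FibPair d u v) {r : ℕ} (hr : 2 ≤ r)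

include h

lemma not_X_dvd : ¬ X ∣ v := by
  intro hv
  have : (X : k[X]) ∣ 1 := by
    have h1 : (1 : k[X]) = v * v - u * (u + X * v) := by linear_combination h.norm
    rw [h1]
    exact dvd_sub (hv.mul_right _) (h.dvd.mul_right _)
  exact not_isUnit_X (isUnit_of_dvd_one this)

include hr

lemma natDegree_eisPoly : (eisPoly r u v).natDegree = r + 1 := by
  refine natDegree_eq_of_le_of_coeff_ne_zero (natDegree_le_iff_coeff_eq_zero.2 fun n hn => ?_) ?_
  · rw [coeff_eisPoly, if_neg (by omega), if_neg (by omega), if_neg (by omega), if_neg (by omega)]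
    simp
  · rw [coeff_eisPoly, if_pos rfl, if_neg (by omega), if_neg (by omega), if_neg (by omega)]
    simpa using h.monic.ne_zero

lemma isPrimitive_eisPoly : (eisPoly r u v).IsPrimitive := by
  intro s hs
  rw [C_dvd_iff_dvd_coeff] at hs
  have h1 := hs (r + 1)
  have h2 := hs r
  rw [coeff_eisPoly, if_pos rfl, if_neg (by omega), if_neg (by omega), if_neg (by omega)] at h1
  rw [coeff_eisPoly, if_neg (by omega), if_pos rfl, if_neg (by omega), if_neg (by omega)] at h2
  simp only [sub_zero, add_zero, zero_sub, dvd_neg] at h1 h2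
  have h3 : s ∣ u := (dvd_add_right (h1.mul_left X)).1 h2
  refine isUnit_of_dvd_one ?_
  have h4 : (1 : k[X]) = v * v - u * (u + X * v) := by linear_combination h.norm
  rw [h4]
  exact dvd_sub (h1.mul_right _) (h3.mul_right _)

lemma irreducible_eisPoly : Irreducible (eisPoly r u v) := by
  have hdeg := h.natDegree_eisPoly hr
  have hne : eisPoly r u v ≠ 0 := fun h0 => by simp [h0] at hdeg
  refine irreducible_of_eisenstein_criterion (P := Ideal.span {X})
    ((Ideal.span_singleton_prime X_ne_zero).2 prime_X) ?_ ?_ ?_ ?_ (h.isPrimitive_eisPoly hr)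
  · rw [leadingCoeff, hdeg, coeff_eisPoly, if_pos rfl, if_neg (by omega), if_neg (by omega),
      if_neg (by omega), Ideal.mem_span_singleton]
    simpa using h.not_X_dvd
  · intro n hn
    rw [degree_eq_natDegree hne, hdeg] at hn
    have hn : n < r + 1 := by exact_mod_cast hn
    rw [coeff_eisPoly, if_neg hn.ne, Ideal.mem_span_singleton]
    refine dvd_sub (dvd_add (dvd_sub (dvd_zero _) ?_) ?_) ?_
    · split_ifs
      · exact dvd_add (dvd_mul_right _ _) h.dvd
      · exact dvd_zero _
    · split_ifs
      · exact dvd_mul_right _ _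
      · exact dvd_zero _
    · split_ifs
      · exact dvd_mul_right _ _
      · exact dvd_zero _
  · rw [degree_eq_natDegree hne, hdeg]
    exact_mod_cast r.succ_pos
  · rw [coeff_eisPoly, if_neg (by omega), if_neg (by omega), if_neg (by omega), if_pos rfl,
      Ideal.span_singleton_pow, Ideal.mem_span_singleton, sq]
    simp only [sub_zero, add_zero, zero_sub, dvd_neg]
    rw [mul_dvd_mul_iff_left X_ne_zero]
    exact h.not_X_dvd

end FibPair

end Degree

section DegreeLS

variable {Fq : Type} [Field Fq] [Fintype Fq] {d : ℕ} {u v : Fq[X]}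

lemma IsHyperRoot.degLS_eq {t : ℕ} (ht : 2 ≤ Fintype.card Fq ^ t) (h : FibPair d u v)
    {ξ : LaurentSeries Fq} (hξ : IsHyperRoot t u v ξ) :
    degLS Fq ξ = Fintype.card Fq ^ t + 1 := by
  have heq := hξ.eq
  set r := Fintype.card Fq ^ t
  have hξ0 : ξ ≠ 0 := by
    rintro rfl
    rw [zero_mul, zero_pow (by omega), mul_zero, zero_add] at heq
    exact toLS_ne_zero h.monic.ne_zero heq.symm
  let : Invertible ξ := invertibleOfNonzero hξ0
  have hroot : (eisPoly r u v).eval₂ (toLS Fq) (⅟ξ) = 0 := by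
    have hinv : ξ * ⅟ξ = 1 := mul_invOf_self ξ
    have hinvr : ξ ^ r * (⅟ξ) ^ r = 1 := by rw [← mul_pow, hinv, one_pow]
    simp only [eisPoly, eval₂_sub, eval₂_add, eval₂_mul, eval₂_C, eval₂_pow, eval₂_X]
    rw [pow_succ]
    generalize (⅟ξ) ^ r = yr at *
    generalize ⅟ξ = y at *
    linear_combination (-yr * y) * heq +
      (toLS Fq (X * v + u) * yr + toLS Fq (X * v) * (yr * ξ ^ r)) * hinv + (toLS Fq (X * v) - toLS Fq (X * u) * y) * hinvr
  set G : Fq[X][X] := C (X * v) * X ^ (r + 1) - C (X * u) * X ^ r + C (X * v + u) * X - C v with hG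
  have hcoeff : ∀ n, G.coeff n = (if n = r + 1 then X * v else 0) - (if n = r then X * u else 0) +
      (if n = 1 then X * v + u else 0) - if n = 0 then v else 0 := by
    intro n
    simp only [hG, coeff_sub, coeff_add, coeff_C_mul, coeff_X_pow, coeff_C, coeff_X,
      mul_ite, mul_one, mul_zero, eq_comm (a := 1) (b := n)]
  have hlead : G.coeff (r + 1) ≠ 0 := by
    rw [hcoeff, if_pos rfl, if_neg (by omega), if_neg (by omega), if_neg (by omega)]
    simpa using h.monic.ne_zero
  refine IsLeast.csInf_eq ⟨⟨G, fun h0 => hlead (by simp [h0]),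
    natDegree_eq_of_le_of_coeff_ne_zero (natDegree_le_iff_coeff_eq_zero.2 fun n hn => ?_) hlead,
    ?_⟩, ?_⟩
  · rw [hcoeff, if_neg (by omega), if_neg (by omega), if_neg (by omega), if_neg (by omega)]
    simp
  · simp only [hG, evalLS, eval₂_sub, eval₂_add, eval₂_mul, eval₂_C, eval₂_pow, eval₂_X]
    linear_combination heq
  · rintro _ ⟨P, hP, rfl, hPξ⟩
    rw [← h.natDegree_eisPoly ht]
    have hrev : P.reverse.eval₂ (toLS Fq) (⅟ξ) = 0 := (eval₂_reverse_eq_zero_iff _ _ _).2 hPξ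
    have hirr := ((h.isPrimitive_eisPoly ht).irreducible_iff_irreducible_map_fraction_map
      (K := FractionRing Fq[X])).1 (h.irreducible_eisPoly ht)
    have hdvd := map_dvd_map_of_common_root toLS_injective hirr hroot hrev
    have hinj := IsFractionRing.injective Fq[X] (FractionRing Fq[X])
    have hle := natDegree_le_of_dvd hdvd
      ((Polynomial.map_ne_zero_iff hinj).2 (reverse_eq_zero.not.2 hP))
    rw [natDegree_map_eq_of_injective hinj, natDegree_map_eq_of_injective hinj] at hle
    exact hle.trans (reverse_natDegree_le P)

end DegreeLS

section ToPoly

namespace BinForm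

variable {k : Type*} [Field k]

/-- The quadratic polynomial `a X ^ 2 + b X + c`. -/
noncomputable def toPoly {R : Type*} [CommRing R] (F : BinForm R) : R[X] :=
  C F.a * X ^ 2 + C F.b * X + C F.c

lemma eval₂_toPoly {R S : Type*} [CommRing R] [CommRing S] (F : BinForm R) (φ : R →+* S) (x : S) :
    F.toPoly.eval₂ φ x = (F.map φ).eval x 1 := by
  simp [toPoly, eval, map]

lemma natDegree_toPoly {R : Type*} [CommRing R] {F : BinForm R} (ha : F.a ≠ 0) :
    F.toPoly.natDegree = 2 := natDegree_quadratic ha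

lemma irreducible_map_toPoly {F : BinForm k[X]} (hF : ∀ x y, F.eval x y = 0 → x = 0 ∧ y = 0) :
    Irreducible (F.toPoly.map (algebraMap k[X] (FractionRing k[X]))) := by
  have ha : F.a ≠ 0 := fun h0 => one_ne_zero (hF 1 0 (by simp [eval, h0])).1
  have hinj := IsFractionRing.injective k[X] (FractionRing k[X])
  have hdeg : (F.toPoly.map (algebraMap k[X] (FractionRing k[X]))).natDegree = 2 := by
    rw [natDegree_map_eq_of_injective hinj, natDegree_toPoly ha]
  refine irreducible_of_degree_le_three_of_not_isRoot (by rw [hdeg]; decide) fun z hz => ?_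
  rw [IsRoot, Polynomial.eval_map, eval₂_toPoly] at hz
  obtain ⟨x, y, hy, rfl⟩ := IsFractionRing.div_surjective (A := k[X]) z
  have hy0 : y ≠ 0 := nonZeroDivisors.ne_zero hy
  have hy' : algebraMap k[X] (FractionRing k[X]) y ≠ 0 := (map_ne_zero_iff _ hinj).2 hy0
  refine hy0 (hF x y (hinj ?_)).2
  rw [map_zero, ← BinForm.eval_map]
  have := BinForm.eval_mul_right (F.map (algebraMap k[X] (FractionRing k[X])))
    (algebraMap k[X] (FractionRing k[X]) x / algebraMap k[X] (FractionRing k[X]) y) 1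
    (algebraMap k[X] (FractionRing k[X]) y)
  rwa [div_mul_cancel₀ _ hy', one_mul, hz, mul_zero] at this

end BinForm

end ToPoly

section Resultant

variable {Fq : Type} [Field Fq] [Fintype Fq]

lemma absQ_det_le {ι : Type*} [Fintype ι] [DecidableEq ι] (M : Matrix ι ι (LaurentSeries Fq))
    (i₀ : ι) {B : ι → ℝ} (hB : ∀ j, 0 ≤ B j) {V : ℝ} (hV : 0 ≤ V)
    (h : ∀ i, i ≠ i₀ → ∀ j, absQ Fq (M i j) ≤ B j) (h₀ : ∀ j, absQ Fq (M i₀ j) ≤ V * B j) :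
    absQ Fq M.det ≤ V * ∏ j, B j := by
  rw [Matrix.det_apply]
  refine absQ_sum_le_of_le _ _ (mul_nonneg hV (Finset.prod_nonneg fun j _ => hB j)) fun σ _ => ?_
  have hsign : absQ Fq (Equiv.Perm.sign σ • ∏ j, M (σ j) j) = absQ Fq (∏ j, M (σ j) j) := by
    rcases Int.units_eq_one_or (Equiv.Perm.sign σ) with hs | hs <;> simp [hs]
  have hprod : ∏ j, (if σ j = i₀ then V else 1) = V := by
    simp_rw [← Equiv.eq_symm_apply]
    simp
  rw [hsign, absQ_prod]
  refine (Finset.prod_le_prod (fun j _ => absQ_nonneg _)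
    (fun j _ => ?_ : ∀ j ∈ Finset.univ, absQ Fq (M (σ j) j) ≤
      (if σ j = i₀ then V else 1) * B j)).trans_eq ?_
  · split_ifs with hj
    · rw [hj]; exact h₀ j
    · rw [one_mul]; exact h _ hj j
  · rw [Finset.prod_mul_distrib, hprod]

lemma sum_pow_mul_shift {R : Type*} [CommRing R] (x : R) (c : ℕ → R) {m n N : ℕ}
    (hN : m + n < N) :
    ∑ i : Fin N, x ^ (i : ℕ) * (if (i : ℕ) ∈ Set.Icc m (m + n) then c (i - m) else 0) =
      x ^ m * ∑ l ∈ Finset.range (n + 1), c l * x ^ l := by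
  rw [Fin.sum_univ_eq_sum_range fun i => x ^ i * (if i ∈ Set.Icc m (m + n) then c (i - m) else 0)]
  simp_rw [mul_ite, mul_zero]
  rw [← Finset.sum_filter]
  have : (Finset.range N).filter (fun i => i ∈ Set.Icc m (m + n)) = Finset.Ico m (m + n + 1) := by
    ext i
    simp only [Finset.mem_filter, Finset.mem_range, Set.mem_Icc, Finset.mem_Ico]
    omega
  rw [this, Finset.sum_Ico_eq_sum_range, Finset.mul_sum]
  refine Finset.sum_congr (by congr 1; omega) fun l _ => ?_
  rw [Nat.add_sub_cancel_left, pow_add]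
  ring

/-- Two coprime polynomials cannot both be very small at a point of the unit disc. -/
lemma one_le_of_isCoprime_map {P Q : Fq[X][X]} {ξ : LaurentSeries Fq} (hξ : absQ Fq ξ ≤ 1)
    (hP : 0 < P.natDegree) {h k : ℕ} (hh : hdeg P ≤ h) (hk : hdeg Q ≤ k)
    (hcop : IsCoprime (P.map (algebraMap Fq[X] (FractionRing Fq[X])))
      (Q.map (algebraMap Fq[X] (FractionRing Fq[X])))) :
    1 ≤ max (absQ Fq (evalLS Fq Q ξ) / (Fintype.card Fq : ℝ) ^ k)
        (absQ Fq (evalLS Fq P ξ) / (Fintype.card Fq : ℝ) ^ h) *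
      (Fintype.card Fq : ℝ) ^ (P.natDegree * k + Q.natDegree * h) := by
  have hq := card_real_pos Fq
  have hinj := IsFractionRing.injective Fq[X] (FractionRing Fq[X])
  have hres : P.resultant Q P.natDegree Q.natDegree ≠ 0 := by
    intro h0
    have h1 := resultant_map_map P Q P.natDegree Q.natDegree
      (algebraMap Fq[X] (FractionRing Fq[X]))
    rw [h0, map_zero] at h1
    have h2 := resultant_eq_zero_iff (f := P.map (algebraMap Fq[X] (FractionRing Fq[X])))
      (g := Q.map (algebraMap Fq[X] (FractionRing Fq[X])))
    rw [natDegree_map_eq_of_injective hinj, natDegree_map_eq_of_injective hinj] at h2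
    exact (h2.1 h1).2 hcop
  refine (one_le_absQ_toLS hres).trans ?_
  rw [← resultant_map_map, resultant]
  set M := sylvester (P.map (toLS Fq)) (Q.map (toLS Fq)) P.natDegree Q.natDegree with hM
  let i₀ : Fin (P.natDegree + Q.natDegree) := ⟨0, by omega⟩
  have hrow := Matrix.det_updateRow_sum M i₀ fun i => ξ ^ (i : ℕ)
  rw [show ξ ^ (i₀ : ℕ) = 1 from pow_zero ξ, one_smul] at hrow
  rw [← hrow]
  set V := max (absQ Fq (evalLS Fq Q ξ) / (Fintype.card Fq : ℝ) ^ k)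
    (absQ Fq (evalLS Fq P ξ) / (Fintype.card Fq : ℝ) ^ h) with hV
  have hVQ : absQ Fq (evalLS Fq Q ξ) ≤ V * (Fintype.card Fq : ℝ) ^ k :=
    (div_le_iff₀ (pow_pos hq k)).1 (le_max_left _ _)
  have hVP : absQ Fq (evalLS Fq P ξ) ≤ V * (Fintype.card Fq : ℝ) ^ h :=
    (div_le_iff₀ (pow_pos hq h)).1 (le_max_right _ _)
  have hV0 : 0 ≤ V := (div_nonneg (absQ_nonneg _) (pow_pos hq k).le).trans (le_max_left _ _)
  let B : Fin (P.natDegree + Q.natDegree) → ℝ := Fin.addCases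
    (fun _ => (Fintype.card Fq : ℝ) ^ k) fun _ => (Fintype.card Fq : ℝ) ^ h
  have hB : ∏ j, B j = (Fintype.card Fq : ℝ) ^ (P.natDegree * k + Q.natDegree * h) := by
    rw [Fin.prod_univ_add]
    simp [B, pow_add, pow_mul']
  have hB0 : ∀ j, 0 ≤ B j := by
    intro j
    refine Fin.addCases (fun j => ?_) (fun j => ?_) j <;> simp [B, (pow_pos hq _).le]
  rw [← hB]
  refine absQ_det_le _ i₀ hB0 hV0 (fun i hi j => ?_) fun j => ?_
  · rw [Matrix.updateRow_ne hi]
    refine Fin.addCases (fun j => ?_) (fun j => ?_) j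
    · simp only [hM, sylvester, Matrix.of_apply, Fin.addCases_left, B, coeff_map]
      split_ifs
      · exact (absQ_toLS_le (natDegree_coeff_le_hdeg _ _)).trans
          (pow_le_pow_right₀ (one_lt_card_real Fq).le hk)
      · simp [(pow_pos hq k).le]
    · simp only [hM, sylvester, Matrix.of_apply, Fin.addCases_right, B, coeff_map]
      split_ifs
      · exact (absQ_toLS_le (natDegree_coeff_le_hdeg _ _)).trans
          (pow_le_pow_right₀ (one_lt_card_real Fq).le hh)
      · simp [(pow_pos hq h).le]
  · rw [Matrix.updateRow_self]
    simp only [Finset.sum_apply, Pi.smul_apply, smul_eq_mul]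
    refine Fin.addCases (fun j => ?_) (fun j => ?_) j
    · simp only [hM, sylvester, Matrix.of_apply, Fin.addCases_left, B, coeff_map]
      rw [sum_pow_mul_shift ξ (fun l => toLS Fq (Q.coeff l)) (by omega),
        ← eval₂_eq_sum_range, absQ_mul, absQ_pow]
      exact (mul_le_of_le_one_left (absQ_nonneg _) (pow_le_one₀ (absQ_nonneg _) hξ)).trans hVQ
    · simp only [hM, sylvester, Matrix.of_apply, Fin.addCases_right, B, coeff_map]
      rw [sum_pow_mul_shift ξ (fun l => toLS Fq (P.coeff l)) (by omega),
        ← eval₂_eq_sum_range, absQ_mul, absQ_pow]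
      exact (mul_le_of_le_one_left (absQ_nonneg _) (pow_le_one₀ (absQ_nonneg _) hξ)).trans hVP

end Resultant

section Exponents

lemma hExp_formula (r d i : ℕ) :
    ((r : ℝ) - 1) * hExp r d i = r ^ i * (r - 1 + 2 * (d + 1)) - 2 * (d + 1) := by
  induction i with
  | zero => simp [hExp]
  | succ i ih => push_cast [hExp]; linear_combination (r : ℝ) * ih

lemma eExp_formula (r d i : ℕ) :
    ((r : ℝ) - 1) * eExp r d i = r ^ i * (2 * (d + 1) * r - 2) - 2 * d := by
  induction i with
  | zero => push_cast [eExp]; ring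
  | succ i ih => push_cast [eExp]; linear_combination (r : ℝ) * ih

lemma dExp_formula (r i : ℕ) : ((r : ℝ) - 1) * dExp r i = r ^ i * r - 1 := by
  induction i with
  | zero => simp [dExp]
  | succ i ih => push_cast [dExp]; linear_combination (r : ℝ) * ih

variable {r d : ℕ} (hr : 4 ≤ r) (hd : 8 * r ^ 2 ≤ d)

include hr

lemma hExp_strictMono : StrictMono (hExp r d) := by
  refine strictMono_nat_of_lt_succ fun i => ?_
  rw [hExp]
  nlinarith [Nat.zero_le (hExp r d i)]

include hd

lemma eExp_strictMono : StrictMono (eExp r d) := by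
  refine strictMono_nat_of_lt_succ fun i => ?_
  rw [eExp]
  nlinarith [Nat.zero_le (eExp r d i)]

lemma hExp_mul_le_eExp (i : ℕ) : (hExp r d i : ℝ) * (r - 1 / 4) ≤ eExp r d i := by
  have hr' : (4 : ℝ) ≤ r := by exact_mod_cast hr
  have hd' : 8 * (r : ℝ) ^ 2 ≤ d := by exact_mod_cast hd
  have hR : (1 : ℝ) ≤ r ^ i := one_le_pow₀ (by linarith)
  have h1 := hExp_formula r d i
  have h2 := eExp_formula r d i
  refine le_of_mul_le_mul_left ?_ (by linarith : (0 : ℝ) < r - 1)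
  rw [← mul_assoc, h1, h2]
  generalize (r : ℝ) ^ i = R at *
  generalize (r : ℝ) = r at *
  generalize (d : ℝ) = d at *
  nlinarith [mul_le_mul_of_nonneg_right hR (by nlinarith : 0 ≤ d - 8 * r ^ 2)]

/-- The gap which prevents roots of the forms `P_i` from being very close to the point. -/
lemma eExp_add_lt {i : ℕ} (hi : 2 ≤ i) :
    (eExp r d i : ℝ) + dExp r i + 1 < ((hExp r d i : ℝ) - dExp r i) * (r + 1 / 2) := by
  have hr' : (4 : ℝ) ≤ r := by exact_mod_cast hr
  have hd' : 8 * (r : ℝ) ^ 2 ≤ d := by exact_mod_cast hd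
  have hR : (r : ℝ) ^ 2 ≤ r ^ i := pow_le_pow_right₀ (by linarith) hi
  have h1 := hExp_formula r d i
  have h2 := eExp_formula r d i
  have h3 := dExp_formula r i
  refine lt_of_mul_lt_mul_left ?_ (by linarith : (0 : ℝ) ≤ r - 1)
  have h4 : ((r : ℝ) - 1) * (eExp r d i + dExp r i + 1) =
      r ^ i * (2 * (d + 1) * r - 2) - 2 * d + (r ^ i * r - 1) + (r - 1) := by
    linear_combination h2 + h3
  have h5 : ((r : ℝ) - 1) * ((hExp r d i - dExp r i) * (r + 1 / 2)) =
      (r ^ i * (r - 1 + 2 * (d + 1)) - 2 * (d + 1) - (r ^ i * r - 1)) * (r + 1 / 2) := by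
    linear_combination (r + 1 / 2 : ℝ) * (h1 - h3)
  rw [h4, h5]
  clear h1 h2 h3 h4 h5
  generalize (r : ℝ) ^ i = R at *
  generalize (r : ℝ) = r at *
  generalize (d : ℝ) = d at *
  have hrr : 4 * r ≤ r ^ 2 := by nlinarith
  have h4 : r ^ 2 * (d - 2 * r) ≤ R * (d - 2 * r) :=
    mul_le_mul_of_nonneg_right hR (by nlinarith)
  have h5 : 4 * r * (d - 2 * r) ≤ r ^ 2 * (d - 2 * r) :=
    mul_le_mul_of_nonneg_right hrr (by nlinarith)
  have h6 : 0 < d := by nlinarith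
  nlinarith

end Exponents

section LowerBound

lemma BinForm.coeff_toPoly {k : Type*} [Field k] (F : BinForm k[X]) (j : ℕ) : F.toPoly.coeff j =
    if j = 2 then F.a else if j = 1 then F.b else if j = 0 then F.c else 0 := by
  simp only [BinForm.toPoly, coeff_add, coeff_C_mul, coeff_X_pow, coeff_X, coeff_C]
  rcases j with _ | _ | _ | j <;> simp

variable {Fq : Type} [Field Fq] [Fintype Fq] {d : ℕ} {u v : Fq[X]}

lemma approxForm_a_ne_zero (h : FibPair d u v) (t i : ℕ) : (approxForm Fq t u v i).a ≠ 0 :=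
  fun h0 => one_ne_zero (approxForm_anisotropic h t i (x := 1) (y := 0)
    (by simp [BinForm.eval, h0])).1

lemma hdeg_approxForm (h : FibPair d u v) (t i : ℕ) :
    hdeg (approxForm Fq t u v i).toPoly = hExp (Fintype.card Fq ^ t) d i := by
  obtain ⟨ha, hb, hc⟩ := natDegree_approxForm_le h t i
  have hne := coeff_approxForm_ne_zero h t i
  apply le_antisymm
  · refine Finset.sup_le fun j _ => ?_
    rw [BinForm.coeff_toPoly]
    split_ifs
    · exact ha
    · exact hb
    · exact hc
    · simp
  · by_contra! hlt
    have h2 := (natDegree_coeff_le_hdeg (approxForm Fq t u v i).toPoly 2).trans_lt hlt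
    have h1 := (natDegree_coeff_le_hdeg (approxForm Fq t u v i).toPoly 1).trans_lt hlt
    have h0 := (natDegree_coeff_le_hdeg (approxForm Fq t u v i).toPoly 0).trans_lt hlt
    rw [BinForm.coeff_toPoly, if_pos rfl] at h2
    rw [BinForm.coeff_toPoly, if_neg (by decide), if_pos rfl] at h1
    rw [BinForm.coeff_toPoly, if_neg (by decide), if_neg (by decide), if_pos rfl] at h0
    refine hne ?_
    rw [coeff_add, coeff_sub, coeff_eq_zero_of_natDegree_lt h2,
      coeff_eq_zero_of_natDegree_lt h1, coeff_eq_zero_of_natDegree_lt h0]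
    simp

lemma toPoly_approxForm_ne_zero (h : FibPair d u v) (t i : ℕ) :
    (approxForm Fq t u v i).toPoly ≠ 0 := fun h0 => by
  have := BinForm.natDegree_toPoly (approxForm_a_ne_zero h t i)
  simp [h0] at this

lemma IsHyperRoot.absQ_evalLS {t : ℕ} (ht : 3 ≤ Fintype.card Fq ^ t) (h : FibPair d u v)
    {ξ : LaurentSeries Fq} (hξ : IsHyperRoot t u v ξ) (i : ℕ) :
    absQ Fq (evalLS Fq (approxForm Fq t u v i).toPoly ξ) =
      (Fintype.card Fq : ℝ) ^ (-(eExp (Fintype.card Fq ^ t) d i : ℝ)) := by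
  rw [evalLS, BinForm.eval₂_toPoly, hξ.absQ_approxForm ht h, ← Real.rpow_intCast]
  push_cast
  rfl

lemma IsHyperRoot.le_wExp {t n : ℕ} (hn : 2 ≤ n) (ht : 4 ≤ Fintype.card Fq ^ t)
    (h : FibPair d u v) (hd : 8 * (Fintype.card Fq ^ t) ^ 2 ≤ d)
    {ξ : LaurentSeries Fq} (hξ : IsHyperRoot t u v ξ) :
    (((Fintype.card Fq : ℝ) ^ t - 1 / 4 : ℝ) : EReal) ≤ wExp Fq n ξ := by
  have hq := card_real_pos Fq
  have hq1 := one_lt_card_real Fq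
  refine le_sSup ⟨_, ?_, rfl⟩
  refine Set.infinite_of_injective_forall_mem
    (f := fun i : ℕ => (approxForm Fq t u v i).toPoly) (fun i j hij => ?_) fun i => ⟨?_, ?_, ?_⟩
  · have h1 := hξ.absQ_evalLS (by omega) h i
    have h2 := hξ.absQ_evalLS (by omega) h j
    dsimp only at hij
    rw [hij, h2, Real.rpow_right_inj hq hq1.ne'] at h1
    exact ((eExp_strictMono ht hd).injective (by exact_mod_cast neg_injective h1)).symm
  · rw [BinForm.natDegree_toPoly (approxForm_a_ne_zero h t i)]
    exact hn
  · rw [hξ.absQ_evalLS (by omega) h]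
    exact Real.rpow_pos_of_pos hq _
  · rw [hξ.absQ_evalLS (by omega) h, Hpoly_eq (toPoly_approxForm_ne_zero h t i),
      hdeg_approxForm h, ← Real.rpow_natCast, ← Real.rpow_mul hq.le,
      Real.rpow_le_rpow_left_iff hq1]
    have := hExp_mul_le_eExp ht hd i
    push_cast at this ⊢
    linarith

end LowerBound

section Divisibility

variable {k : Type} [Field k]

lemma exists_C_mul_eq_of_map_dvd {P Q : k[X][X]}
    (hPQ : P.map (algebraMap k[X] (FractionRing k[X])) ∣
      Q.map (algebraMap k[X] (FractionRing k[X]))) :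
    ∃ s : k[X], s ≠ 0 ∧ ∃ S : k[X][X], C s * Q = P * S := by
  obtain ⟨g, hg⟩ := hPQ
  obtain ⟨b, hb0, hb⟩ := IsLocalization.integerNormalization_spec (nonZeroDivisors k[X]) g
  refine ⟨b, nonZeroDivisors.ne_zero hb0,
    IsLocalization.integerNormalization (nonZeroDivisors k[X]) g, ?_⟩
  apply map_injective _ (IsFractionRing.injective k[X] (FractionRing k[X]))
  rw [Polynomial.map_mul, Polynomial.map_mul, map_C, hg, hb,
    ← IsScalarTower.algebraMap_smul (FractionRing k[X]) b, smul_eq_C_mul]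
  ring

lemma hdeg_C_mul {s : k[X]} (hs : s ≠ 0) {Q : k[X][X]} (hQ : Q ≠ 0) :
    hdeg (C s * Q) = s.natDegree + hdeg Q := by
  apply le_antisymm
  · refine Finset.sup_le fun j _ => ?_
    rw [coeff_C_mul]
    exact natDegree_mul_le.trans (Nat.add_le_add_left (natDegree_coeff_le_hdeg Q j) _)
  · obtain ⟨j, hj0, hj⟩ := exists_natDegree_coeff_eq_hdeg hQ
    rw [← hj, ← natDegree_mul hs hj0, ← coeff_C_mul]
    exact natDegree_coeff_le_hdeg _ _

end Divisibility

section Extension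

variable {Fq : Type} [Field Fq] {L : Type} [Field L] [Algebra (LaurentSeries Fq) L]

lemma algebraMap_evalLS (P : Fq[X][X]) (ξ : LaurentSeries Fq) :
    algebraMap (LaurentSeries Fq) L (evalLS Fq P ξ) = evalA Fq L P (algebraMap _ L ξ) := by
  rw [evalLS, evalA, embRing, hom_eval₂]

lemma degA_le {P : Fq[X][X]} (hP : P ≠ 0) {α : L} (hα : evalA Fq L P α = 0) :
    degA Fq L α ≤ P.natDegree :=
  Nat.sInf_le ⟨P, hP, rfl, hα⟩

variable [Fintype Fq]

lemma embRing_injective : Function.Injective (embRing Fq L) :=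
  (algebraMap (LaurentSeries Fq) L).injective.comp toLS_injective

lemma IsAlgDeg.exists_heightA_eq {n : ℕ} {α : L} (hα : IsAlgDeg Fq L n α) :
    ∃ Q : Fq[X][X], Q ≠ 0 ∧ Q.natDegree = degA Fq L α ∧ Q.natDegree ≤ n ∧
      evalA Fq L Q α = 0 ∧ heightA Fq L α = (Fintype.card Fq : ℝ) ^ hdeg Q := by
  obtain ⟨P, hP, hPn, hPα⟩ := hα
  have hdeg_le : degA Fq L α ≤ n := (degA_le hP hPα).trans hPn
  have hne : {P : Fq[X][X] | P ≠ 0 ∧ P.natDegree = degA Fq L α ∧ evalA Fq L P α = 0}.Nonempty :=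
    Nat.sInf_mem (s := {d | ∃ P : Fq[X][X], P ≠ 0 ∧ P.natDegree = d ∧ evalA Fq L P α = 0})
      ⟨_, P, hP, rfl, hPα⟩
  obtain ⟨Q, ⟨hQ, hQd, hQα⟩, hmin⟩ := exists_minimalFor_of_wellFoundedLT _ hdeg hne
  refine ⟨Q, hQ, hQd, hQd.trans_le hdeg_le, hQα, IsLeast.csInf_eq ⟨?_, ?_⟩⟩
  · exact ⟨Q, hQ, hQd, hQα, (Hpoly_eq hQ).symm⟩
  · rintro _ ⟨R, hR, hRd, hRα, rfl⟩
    rw [Hpoly_eq hR]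
    refine pow_le_pow_right₀ (one_lt_card_real Fq).le ?_
    rcases le_total (hdeg R) (hdeg Q) with h | h
    · exact hmin ⟨hR, hRd, hRα⟩ h
    · exact h

lemma finite_setOf_root_hdeg_le (n K : ℕ) :
    {α : L | ∃ Q : Fq[X][X], Q ≠ 0 ∧ Q.natDegree ≤ n ∧ hdeg Q ≤ K ∧
      evalA Fq L Q α = 0}.Finite := by
  refine ((finite_setOf_hdeg_le n K).biUnion
    fun Q : Fq[X][X] => fun _ => (Q.map (embRing Fq L)).roots.toFinset.finite_toSet).subset ?_
  rintro α ⟨Q, hQ, hQn, hQK, hQα⟩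
  refine Set.mem_biUnion ⟨hQn, hQK⟩ ?_
  have hQ0 : Q.map (embRing Fq L) ≠ 0 := (Polynomial.map_ne_zero_iff embRing_injective).2 hQ
  simpa [hQ0, eval_map] using! hQα

variable {v : AbsoluteValue L ℝ}
  (hv : ∀ x : LaurentSeries Fq, v (algebraMap (LaurentSeries Fq) L x) = absQ Fq x)

include hv

lemma apply_embRing_le {f : Fq[X]} {m : ℕ} (hf : f.natDegree ≤ m) :
    v (embRing Fq L f) ≤ (Fintype.card Fq : ℝ) ^ m := by
  rw [embRing, RingHom.comp_apply, hv]
  exact absQ_toLS_le hf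

lemma apply_pow_sub_pow_le {ξ : LaurentSeries Fq} (hξ : absQ Fq ξ ≤ 1) {α : L}
    (hα : v (algebraMap _ L ξ - α) ≤ 1) (j : ℕ) :
    v (algebraMap _ L ξ ^ j - α ^ j) ≤ 2 ^ j * v (algebraMap _ L ξ - α) := by
  set x := algebraMap (LaurentSeries Fq) L ξ
  have hx : v x ≤ 1 := (hv ξ).trans_le hξ
  have hα2 : v α ≤ 2 := by
    have h := v.add_le x (-(x - α))
    rw [v.map_neg, neg_sub, add_sub_cancel] at h
    linarith
  induction j with
  | zero => simp
  | succ j ih =>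
    have h : x ^ (j + 1) - α ^ (j + 1) = x * (x ^ j - α ^ j) + (x - α) * α ^ j := by ring
    rw [h]
    refine (v.add_le _ _).trans ?_
    rw [v.map_mul, v.map_mul, v.map_pow]
    have h1 := mul_le_mul hx ih (v.nonneg _) zero_le_one
    have h2 := mul_le_mul_of_nonneg_left (pow_le_pow_left₀ (v.nonneg _) hα2 j) (v.nonneg (x - α))
    rw [pow_succ]
    linarith

/-- An approximation to `ξ` yields a small value of any polynomial vanishing at it. -/
lemma absQ_evalLS_le_of_root {ξ : LaurentSeries Fq} (hξ : absQ Fq ξ ≤ 1) {α : L}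
    (hα : v (algebraMap _ L ξ - α) ≤ 1) {Q : Fq[X][X]} {n k : ℕ} (hQn : Q.natDegree ≤ n)
    (hQk : hdeg Q ≤ k) (hQα : evalA Fq L Q α = 0) :
    absQ Fq (evalLS Fq Q ξ) ≤
      (n + 1) * 2 ^ n * ((Fintype.card Fq : ℝ) ^ k * v (algebraMap _ L ξ - α)) := by
  rw [← hv, algebraMap_evalLS, ← sub_zero (evalA Fq L Q _), ← hQα, evalA, evalA,
    eval₂_eq_sum_range' _ (Nat.lt_succ_of_le hQn), eval₂_eq_sum_range' _ (Nat.lt_succ_of_le hQn),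
    ← Finset.sum_sub_distrib]
  refine (v.sum_le _ _).trans ((Finset.sum_le_card_nsmul _ _
    (2 ^ n * ((Fintype.card Fq : ℝ) ^ k * v (algebraMap _ L ξ - α))) fun j hj => ?_).trans_eq ?_)
  · rw [← mul_sub, v.map_mul]
    have h1 := apply_embRing_le hv ((natDegree_coeff_le_hdeg Q j).trans hQk)
    have h2 := apply_pow_sub_pow_le hv hξ hα j
    have h3 : (2 : ℝ) ^ j ≤ 2 ^ n :=
      pow_le_pow_right₀ one_le_two (Nat.lt_succ_iff.1 (Finset.mem_range.1 hj))
    refine (mul_le_mul h1 (h2.trans (mul_le_mul_of_nonneg_right h3 (v.nonneg _)))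
      (v.nonneg _) (by positivity)).trans_eq ?_
    ring
  · simp [mul_assoc]

lemma absQ_evalLS_toPoly_le_of_root {F : BinForm Fq[X]} {ξ : LaurentSeries Fq} {α : L}
    (hα : evalA Fq L F.toPoly α = 0) {h δ : ℕ} (ha : F.a.natDegree ≤ h)
    (hδ : F.disc.natDegree ≤ 2 * δ)
    (hP : absQ Fq (evalLS Fq F.toPoly ξ) * (Fintype.card Fq : ℝ) ^ h ≤ 1)
    (hX : v (algebraMap _ L ξ - α) * (Fintype.card Fq : ℝ) ^ h ≤ 1) :
    absQ Fq (evalLS Fq F.toPoly ξ) ≤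
      v (algebraMap _ L ξ - α) * ((Fintype.card Fq : ℝ) ^ δ + 1) := by
  have hq := one_lt_card_real Fq
  set G := F.map (toLS Fq) with hG
  have hGξ : evalLS Fq F.toPoly ξ = G.eval ξ 1 := BinForm.eval₂_toPoly _ _ _
  have hderiv : absQ Fq (2 * G.a * ξ + G.b) ≤ (Fintype.card Fq : ℝ) ^ δ := by
    refine le_of_sq_le_sq ?_ (by positivity)
    have h1 : (2 * G.a * ξ + G.b) ^ 2 =
        toLS Fq F.disc + toLS Fq (4 * F.a) * evalLS Fq F.toPoly ξ := by
      rw [hGξ]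
      simp only [hG, BinForm.eval, BinForm.map, BinForm.disc, map_sub, map_mul, map_pow,
        map_ofNat]
      ring
    rw [← absQ_pow, h1, ← pow_mul, mul_comm δ]
    refine absQ_add_le_of_le (absQ_toLS_le hδ) ?_
    rw [absQ_mul, mul_comm]
    have h4 : (4 * F.a).natDegree ≤ h := by
      refine natDegree_mul_le.trans ?_
      simpa using ha
    exact (mul_le_mul_of_nonneg_left (absQ_toLS_le h4) (absQ_nonneg _)).trans
      (hP.trans (one_le_pow₀ hq.le))
  set x := algebraMap (LaurentSeries Fq) L ξ with hx
  have ha' : v (algebraMap _ L G.a) ≤ (Fintype.card Fq : ℝ) ^ h := apply_embRing_le hv ha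
  have hexp : algebraMap _ L (evalLS Fq F.toPoly ξ) =
      (x - α) * algebraMap _ L (2 * G.a * ξ + G.b) - algebraMap _ L G.a * (x - α) * (x - α) := by
    have hα' : algebraMap _ L G.a * α ^ 2 + algebraMap _ L G.b * α + algebraMap _ L G.c = 0 := by
      rw [evalA, BinForm.eval₂_toPoly] at hα
      simpa [BinForm.eval, BinForm.map, embRing, hG] using hα
    rw [hGξ]
    simp only [BinForm.eval, map_add, map_mul, map_pow, map_one, map_ofNat]
    linear_combination hα'
  rw [← hv, hexp]
  refine (v.sub_le_add _ _).trans ?_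
  rw [v.map_mul, v.map_mul, v.map_mul, hv, mul_add, mul_one]
  have h2 : v (algebraMap _ L G.a) * v (x - α) ≤ 1 :=
    (mul_le_mul_of_nonneg_right ha' (v.nonneg _)).trans (by rwa [mul_comm])
  have h3 := mul_le_mul_of_nonneg_right h2 (v.nonneg (x - α))
  have h5 := mul_le_mul_of_nonneg_left hderiv (v.nonneg (x - α))
  linarith

end Extension

section MinimalPolynomial

lemma natDegree_le_of_C_mul_eq_C_mul_toPoly {k : Type*} [Field k] {F : BinForm k[X]}
    {Q : k[X][X]} {s w : k[X]} (hw : w ≠ 0) (hdisc : F.disc ≠ 0) {δ : ℕ}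
    (hδ : F.disc.natDegree = 2 * δ) (h : C s * Q = C w * F.toPoly) :
    s.natDegree ≤ w.natDegree + δ := by
  have hcoeff (j : ℕ) : s * Q.coeff j = w * F.toPoly.coeff j := by
    rw [← coeff_C_mul, h, coeff_C_mul]
  have hc2 : s * Q.coeff 2 = w * F.a := by
    rw [hcoeff, BinForm.coeff_toPoly, if_pos rfl]
  have hc1 : s * Q.coeff 1 = w * F.b := by
    rw [hcoeff, BinForm.coeff_toPoly, if_neg (by decide), if_pos rfl]
  have hc0 : s * Q.coeff 0 = w * F.c := by
    rw [hcoeff, BinForm.coeff_toPoly, if_neg (by decide), if_neg (by decide), if_pos rfl]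
  generalize Q.coeff 2 = x at hc2
  generalize Q.coeff 1 = y at hc1
  generalize Q.coeff 0 = z at hc0
  have hD : s ^ 2 * (y ^ 2 - 4 * (x * z)) = w ^ 2 * F.disc := by
    rw [BinForm.disc]
    linear_combination (s * y + w * F.b) * hc1 - 4 * s * x * hc0 - 4 * w * F.c * hc2
  have hD0 : w ^ 2 * F.disc ≠ 0 := mul_ne_zero (pow_ne_zero 2 hw) hdisc
  have h1 := congrArg natDegree hD
  rw [← hD] at hD0
  rw [natDegree_mul (left_ne_zero_of_mul hD0) (right_ne_zero_of_mul hD0),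
    natDegree_mul (pow_ne_zero 2 hw) hdisc, natDegree_pow, natDegree_pow, hδ] at h1
  omega

variable {Fq : Type} [Field Fq] {L : Type} [Field L] [Algebra (LaurentSeries Fq) L]

/-- If a quadratic form divides a minimal polynomial of `α` over `F_q(T)`, then `α` is a root of
it, and the heights are comparable. -/
lemma eval_eq_zero_and_hdeg_le_of_map_dvd {F : BinForm Fq[X]} (ha : F.a ≠ 0) (hdisc : F.disc ≠ 0)
    {δ : ℕ} (hδ : F.disc.natDegree = 2 * δ) {α : L} {Q : Fq[X][X]} (hQ : Q ≠ 0)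
    (hQd : Q.natDegree = degA Fq L α) (hQα : evalA Fq L Q α = 0)
    (hdvd : F.toPoly.map (algebraMap Fq[X] (FractionRing Fq[X])) ∣
      Q.map (algebraMap Fq[X] (FractionRing Fq[X]))) :
    evalA Fq L F.toPoly α = 0 ∧ hdeg F.toPoly ≤ hdeg Q + δ := by
  have hP2 := BinForm.natDegree_toPoly ha
  have hP0 : F.toPoly ≠ 0 := fun h => by simp [h] at hP2
  obtain ⟨s, hs, S, hS⟩ := exists_C_mul_eq_of_map_dvd hdvd
  have hne : F.toPoly * S ≠ 0 := hS ▸ mul_ne_zero (C_ne_zero.2 hs) hQ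
  have hS0 := right_ne_zero_of_mul hne
  have hdegS : Q.natDegree = 2 + S.natDegree := by
    rw [← hP2, ← natDegree_mul hP0 hS0, ← hS, natDegree_C_mul hs]
  have hroot : evalA Fq L F.toPoly α * evalA Fq L S α = 0 := by
    rw [evalA, evalA, ← eval₂_mul, ← hS, eval₂_mul]
    exact mul_eq_zero_of_right _ hQα
  have hα : evalA Fq L F.toPoly α = 0 := by
    refine (mul_eq_zero.1 hroot).resolve_right fun h => ?_
    have := degA_le hS0 h
    omega
  refine ⟨hα, ?_⟩
  obtain ⟨w, rfl⟩ : ∃ w, S = C w := by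
    refine ⟨_, eq_C_of_natDegree_eq_zero ?_⟩
    have := degA_le hP0 hα
    omega
  have hw : w ≠ 0 := C_ne_zero.1 hS0
  rw [mul_comm F.toPoly] at hS
  have h1 := natDegree_le_of_C_mul_eq_C_mul_toPoly hw hdisc hδ hS
  have h2 := congrArg hdeg hS
  rw [hdeg_C_mul hs hQ, hdeg_C_mul hw hP0] at h2
  omega

end MinimalPolynomial

section Approximation

lemma lt_mul_of_quadratic {n r d h e k c : ℝ} (hn : 2 ≤ n) (hr : 4 ≤ r)
    (hrn : (3 * n + 2) * r ≤ r ^ 2 + 2 * n) (hh : 4 * n * (d + 1) + 2 * c < h)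
    (hh0 : 0 ≤ h) (he : h * (r - 1 / 4) ≤ e)
    (hk : 2 * k * (r - 3 / 2) ≤ 2 * (n * (r * h + 2 * (d + 1)) + c)) :
    2 * k + (n - 1) * h < e := by
  have h1 : 2 * n * r + 1 ≤ (r - 3 / 2) * (r - n + 3 / 4) := by nlinarith
  have h2 := mul_le_mul_of_nonneg_left h1 hh0
  have h3 := mul_le_mul_of_nonneg_left he (by linarith : 0 ≤ r - 3 / 2)
  refine lt_of_mul_lt_mul_right ?_ (by linarith : 0 ≤ r - 3 / 2)
  nlinarith

variable {Fq : Type} [Field Fq] [Fintype Fq] {L : Type} [Field L]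
  [Algebra (LaurentSeries Fq) L] {v : AbsoluteValue L ℝ}
  (hv : ∀ x : LaurentSeries Fq, v (algebraMap (LaurentSeries Fq) L x) = absQ Fq x)
  {ξ : LaurentSeries Fq} {α : L} {Q : Fq[X][X]} (hQα : evalA Fq L Q α = 0) {W : ℝ}
  (hX : v (algebraMap _ L ξ - α) ≤ (Fintype.card Fq : ℝ) ^ (-(hdeg Q * W)))

include hv hQα hX

lemma not_isCoprime_map_of_approx (hW : 0 ≤ W) (hξ : absQ Fq ξ ≤ 1) {n : ℕ}
    (hQn : Q.natDegree ≤ n) {c : ℕ} (hc : (n + 1) * 2 ^ n ≤ (Fintype.card Fq : ℝ) ^ c)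
    {P : Fq[X][X]} (hP : P.natDegree = 2) {E : ℝ} (hE : absQ Fq (evalLS Fq P ξ) ≤ (Fintype.card Fq : ℝ) ^ (-E))
    (hlt : c + n * hdeg P + 2 * hdeg Q < hdeg Q * W)
    (hlt' : 2 * hdeg Q + n * hdeg P < E + hdeg P) :
    ¬ IsCoprime (P.map (algebraMap Fq[X] (FractionRing Fq[X])))
      (Q.map (algebraMap Fq[X] (FractionRing Fq[X]))) := by
  intro hcop
  have hb := one_lt_card_real Fq
  have hb0 := card_real_pos Fq
  have hone := one_le_of_isCoprime_map hξ (by rw [hP]; norm_num) le_rfl le_rfl hcop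
  rw [hP] at hone
  set b := (Fintype.card Fq : ℝ)
  have hX1 : v (algebraMap _ L ξ - α) ≤ 1 := by
    refine hX.trans (Real.rpow_le_one_of_one_le_of_nonpos hb.le ?_)
    rw [neg_nonpos]
    positivity
  have hpow : b ^ (2 * hdeg Q + Q.natDegree * hdeg P) ≤ b ^ (2 * hdeg Q + n * hdeg P : ℝ) := by
    have h1 : 2 * hdeg Q + Q.natDegree * hdeg P ≤ 2 * hdeg Q + n * hdeg P := by gcongr
    refine (pow_le_pow_right₀ hb.le h1).trans_eq ?_
    rw [← Real.rpow_natCast]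
    push_cast
    rfl
  rcases max_choice (absQ Fq (evalLS Fq Q ξ) / b ^ hdeg Q) (absQ Fq (evalLS Fq P ξ) / b ^ hdeg P)
    with hm | hm
  · rw [hm] at hone
    have hA := absQ_evalLS_le_of_root hv hξ hX1 hQn le_rfl hQα
    have hA' : absQ Fq (evalLS Fq Q ξ) / b ^ hdeg Q ≤ b ^ (c - hdeg Q * W) := by
      rw [div_le_iff₀ (by positivity), sub_eq_add_neg, Real.rpow_add hb0, Real.rpow_natCast]
      refine hA.trans ((mul_le_mul hc (mul_le_mul_of_nonneg_left hX (by positivity))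
        (mul_nonneg (by positivity) (v.nonneg _)) (by positivity)).trans_eq ?_)
      ring
    have hfin := hone.trans (mul_le_mul hA' hpow (by positivity) (by positivity))
    rw [← Real.rpow_add hb0, ← Real.rpow_zero b, Real.rpow_le_rpow_left_iff hb] at hfin
    linarith
  · rw [hm] at hone
    have hB : absQ Fq (evalLS Fq P ξ) / b ^ hdeg P ≤ b ^ (-E - hdeg P) := by
      rw [Real.rpow_sub hb0, Real.rpow_natCast]
      gcongr
    have hfin := hone.trans (mul_le_mul hB hpow (by positivity) (by positivity))
    rw [← Real.rpow_add hb0, ← Real.rpow_zero b, Real.rpow_le_rpow_left_iff hb] at hfin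
    linarith

lemma le_of_map_dvd_of_approx (hQ : Q ≠ 0) (hQd : Q.natDegree = degA Fq L α) {F : BinForm Fq[X]}
    (ha : F.a ≠ 0) (hdisc : F.disc ≠ 0) {δ : ℕ} (hδ : F.disc.natDegree = 2 * δ) {E : ℝ}
    (hE : absQ Fq (evalLS Fq F.toPoly ξ) = (Fintype.card Fq : ℝ) ^ (-E))
    (hHE : hdeg F.toPoly ≤ E) (hHW : hdeg F.toPoly ≤ hdeg Q * W)
    (hdvd : F.toPoly.map (algebraMap Fq[X] (FractionRing Fq[X])) ∣
      Q.map (algebraMap Fq[X] (FractionRing Fq[X]))) :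
    (hdeg F.toPoly : ℝ) ≤ hdeg Q + δ ∧ hdeg Q * W ≤ E + δ + 1 := by
  have hb := one_lt_card_real Fq
  have hb0 := card_real_pos Fq
  have hb2 : (2 : ℝ) ≤ Fintype.card Fq := by exact_mod_cast Fintype.one_lt_card
  obtain ⟨hPα, hHk⟩ := eval_eq_zero_and_hdeg_le_of_map_dvd ha hdisc hδ hQ hQd hQα hdvd
  refine ⟨by exact_mod_cast hHk, ?_⟩
  have haH : F.a.natDegree ≤ hdeg F.toPoly := by
    simpa [BinForm.coeff_toPoly] using natDegree_coeff_le_hdeg F.toPoly 2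
  set b := (Fintype.card Fq : ℝ)
  have hbound := absQ_evalLS_toPoly_le_of_root hv hPα haH hδ.le
    (by
      rw [hE, ← Real.rpow_natCast, ← Real.rpow_add hb0]
      exact Real.rpow_le_one_of_one_le_of_nonpos hb.le (by linarith))
    (by
      refine (mul_le_mul_of_nonneg_right hX (by positivity)).trans ?_
      rw [← Real.rpow_natCast, ← Real.rpow_add hb0]
      exact Real.rpow_le_one_of_one_le_of_nonpos hb.le (by linarith))
  rw [hE] at hbound
  have hD : b ^ δ + 1 ≤ b ^ ((δ : ℝ) + 1) := by
    rw [Real.rpow_add hb0, Real.rpow_one, Real.rpow_natCast]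
    have h1 : 1 ≤ b ^ δ := one_le_pow₀ hb.le
    nlinarith
  have hfin := hbound.trans (mul_le_mul hX hD (by positivity) (by positivity))
  rw [← Real.rpow_add hb0, Real.rpow_le_rpow_left_iff hb] at hfin
  linarith

end Approximation

section UpperBound

variable {Fq : Type} [Field Fq] [Fintype Fq] {L : Type} [Field L]
  [Algebra (LaurentSeries Fq) L] {v : AbsoluteValue L ℝ}
  (hv : ∀ x : LaurentSeries Fq, v (algebraMap (LaurentSeries Fq) L x) = absQ Fq x)
  {t n d : ℕ} {a b : Fq[X]} (hn : 2 ≤ n) (ht : 4 ≤ Fintype.card Fq ^ t)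
  (hrn : (3 * (n : ℝ) + 2) * (Fintype.card Fq ^ t : ℕ) ≤
    ((Fintype.card Fq ^ t : ℕ) : ℝ) ^ 2 + 2 * n)
  (h : FibPair d a b) (hd : 8 * (Fintype.card Fq ^ t) ^ 2 ≤ d)
  {ξ : LaurentSeries Fq} (hξ : IsHyperRoot t a b ξ)

include hv hn ht hrn h hd hξ

/-- No root of a minimal polynomial whose height is suitably placed between those of two
consecutive forms `P_i` is a very good approximation to `ξ`. -/
lemma IsHyperRoot.lt_of_approx
    {α : L} {Q : Fq[X][X]} (hQ : Q ≠ 0) (hQd : Q.natDegree = degA Fq L α)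
    (hQn : Q.natDegree ≤ n) (hQα : evalA Fq L Q α = 0)
    {c : ℕ} (hc : (n + 1) * 2 ^ n ≤ (Fintype.card Fq : ℝ) ^ c) {i : ℕ} (hi : 2 ≤ i)
    (hh : 4 * n * (d + 1) + 2 * c < hExp (Fintype.card Fq ^ t) d i)
    (hlt : 2 * (n * hExp (Fintype.card Fq ^ t) d i + c) + 3 * hdeg Q <
      2 * Fintype.card Fq ^ t * hdeg Q)
    (hle : 2 * Fintype.card Fq ^ t * hdeg Q ≤
      2 * (n * hExp (Fintype.card Fq ^ t) d (i + 1) + c) + 3 * hdeg Q) :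
    (Fintype.card Fq : ℝ) ^ (-(hdeg Q * ((Fintype.card Fq ^ t : ℕ) + 1 / 2)) : ℝ) <
      v (algebraMap _ L ξ - α) := by
  by_contra! hX
  have hξ1 : absQ Fq ξ ≤ 1 :=
    hξ.absQ_le.trans (inv_le_one_of_one_le₀ (one_lt_card_real Fq).le)
  have hval := hξ.absQ_evalLS (by omega) h i
  have hPh := hdeg_approxForm h t i
  have ha := approxForm_a_ne_zero h t i
  obtain ⟨hdisc, hδ⟩ := disc_approxForm h t i
  have hirr := BinForm.irreducible_map_toPoly fun x y =>
    approxForm_anisotropic h t i (x := x) (y := y)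
  have he := hExp_mul_le_eExp ht hd i
  have hgap := eExp_add_lt ht hd hi
  rw [hExp] at hle
  generalize approxForm Fq t a b i = F at *
  generalize Fintype.card Fq ^ t = r at *
  generalize hExp r d i = H at *
  generalize eExp r d i = E at *
  generalize dExp r i = D at *
  have hr' : (4 : ℝ) ≤ r := by exact_mod_cast ht
  have hn' : (2 : ℝ) ≤ n := by exact_mod_cast hn
  have hH' : (0 : ℝ) ≤ H := by positivity
  have hlt' : 2 * ((n : ℝ) * H + c) + 3 * hdeg Q < 2 * r * hdeg Q := by exact_mod_cast hlt
  have hle' : 2 * (r : ℝ) * hdeg Q ≤ 2 * (n * (r * H + 2 * (d + 1)) + c) + 3 * hdeg Q := by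
    exact_mod_cast hle
  have hh' : 4 * (n : ℝ) * (d + 1) + 2 * c < H := by exact_mod_cast hh
  have hHE : (H : ℝ) ≤ E := by nlinarith
  have hHk : (H : ℝ) ≤ hdeg Q * (r + 1 / 2) := by nlinarith
  by_cases hdvd : F.toPoly.map (algebraMap Fq[X] (FractionRing Fq[X])) ∣
      Q.map (algebraMap Fq[X] (FractionRing Fq[X]))
  · obtain ⟨h1, h2⟩ := le_of_map_dvd_of_approx hv hQα hX hQ hQd ha hdisc hδ hval
      (by rwa [hPh]) (by rwa [hPh]) hdvd
    rw [hPh] at h1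
    nlinarith
  · refine not_isCoprime_map_of_approx hv hQα hX (by positivity) hξ1 hQn hc
      (BinForm.natDegree_toPoly ha) hval.le ?_ ?_ ((hirr.coprime_iff_not_dvd).2 hdvd)
    · rw [hPh]
      linarith
    · rw [hPh]
      have := lt_mul_of_quadratic (k := hdeg Q) hn' hr' hrn hh' hH' he (by linarith)
      linarith

lemma IsHyperRoot.wstarExp_le :
    wstarExp Fq L n ξ v ≤ (((Fintype.card Fq : ℝ) ^ t - 1 / 2 : ℝ) : EReal) := by
  refine sSup_le ?_
  rintro _ ⟨w, hw, rfl⟩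
  rw [EReal.coe_le_coe_iff]
  by_contra! hlt
  obtain ⟨c, hc⟩ := pow_unbounded_of_one_lt (((n : ℝ) + 1) * 2 ^ n) (one_lt_card_real Fq)
  set r := Fintype.card Fq ^ t with hr
  have hmono := hExp_strictMono (d := d) ht
  set I := 4 * n * (d + 1) + 2 * c + 2
  obtain ⟨α, ⟨hαn, -, hα⟩, hαK⟩ :=
    (hw.sdiff (finite_setOf_root_hdeg_le (Fq := Fq) (L := L) n (2 * (n * hExp r d I + c)))).nonempty
  obtain ⟨Q, hQ, hQd, hQn, hQα, hH⟩ := hαn.exists_heightA_eq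
  have hk : 2 * (n * hExp r d I + c) < hdeg Q := by
    by_contra! hk
    exact hαK ⟨Q, hQ, hQn, hk, hQα⟩
  have hX : v (algebraMap _ L ξ - α) ≤
      (Fintype.card Fq : ℝ) ^ (-(hdeg Q * (r + 1 / 2)) : ℝ) := by
    refine hα.trans ?_
    rw [hH, ← Real.rpow_natCast, ← Real.rpow_mul (card_real_pos Fq).le,
      Real.rpow_le_rpow_left_iff (one_lt_card_real Fq)]
    have : (0 : ℝ) ≤ hdeg Q := by positivity
    rw [hr]
    push_cast
    nlinarith
  have hex : ∃ j, 2 * r * hdeg Q ≤ 2 * (n * hExp r d j + c) + 3 * hdeg Q := by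
    refine ⟨2 * r * hdeg Q, ?_⟩
    have := hmono.le_apply (x := 2 * r * hdeg Q)
    nlinarith
  have hIlt : ∀ j ≤ I, ¬ 2 * r * hdeg Q ≤ 2 * (n * hExp r d j + c) + 3 * hdeg Q := by
    intro j hj hle
    have := Nat.mul_le_mul_left n (hmono.monotone hj)
    nlinarith
  classical
  obtain ⟨i, hi⟩ : ∃ i, Nat.find hex = i + 1 :=
    Nat.exists_eq_add_one_of_ne_zero fun h0 => hIlt 0 (Nat.zero_le _) (h0 ▸ Nat.find_spec hex)
  have hIi : I ≤ i := by
    by_contra! hiI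
    exact hIlt (i + 1) hiI (hi ▸ Nat.find_spec hex)
  refine (hξ.lt_of_approx hv hn ht hrn h hd hQ hQd hQn hQα hc.le (i := i) (by omega)
    ?_ ?_ ?_).not_ge hX
  · have : i ≤ hExp (Fintype.card Fq ^ t) d i := hmono.le_apply
    omega
  · exact not_le.1 (Nat.find_min hex (by omega))
  · exact hi ▸ Nat.find_spec hex

end UpperBound

end CFq

/-- for `q ≥ 4` and `r = q^t` large enough with respect to `n`, there is
an algebraic Laurent series of degree `r + 1` with `w_n(α) ≠ w_n^*(α)`. -/
theorem stmt14 (Fq : Type) [Field Fq] [Fintype Fq]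
    (n : ℕ) (hn : 2 ≤ n) (hq : 4 ≤ Fintype.card Fq)
    (t : ℕ) (ht : 1 ≤ t)
    (hr : ((3 * n + 2 : ℝ) + Real.sqrt (9 * n ^ 2 + 4 * n + 4)) / 2 ≤
      ((Fintype.card Fq : ℝ) ^ t)) :
    ∃ α : LaurentSeries Fq, CFq.degLS Fq α = Fintype.card Fq ^ t + 1 ∧
      ∀ (L : Type) [Field L] [Algebra (LaurentSeries Fq) L] [IsAlgClosed L]
        (v : AbsoluteValue L ℝ),
        (∀ x : LaurentSeries Fq, v (algebraMap (LaurentSeries Fq) L x) = CFq.absQ Fq x) →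
        CFq.wExp Fq n α ≠ CFq.wstarExp Fq L n α v := by
  have hcard : 4 ≤ Fintype.card Fq ^ t :=
    hq.trans (Nat.le_self_pow (Nat.one_le_iff_ne_zero.1 ht) _)
  have hrn : (3 * (n : ℝ) + 2) * (Fintype.card Fq ^ t : ℕ) ≤
      ((Fintype.card Fq ^ t : ℕ) : ℝ) ^ 2 + 2 * n := by
    push_cast
    have h1 : Real.sqrt (9 * n ^ 2 + 4 * n + 4) ≤ 2 * (Fintype.card Fq : ℝ) ^ t - (3 * n + 2) := by
      linarith
    have h2 := (Real.sqrt_le_iff.1 h1).2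
    linarith
  obtain ⟨a, b, h⟩ := CFq.FibPair.exists Fq (4 * (Fintype.card Fq ^ t) ^ 2)
  have hd : 8 * (Fintype.card Fq ^ t) ^ 2 ≤ 2 * (4 * (Fintype.card Fq ^ t) ^ 2) := by omega
  obtain ⟨ξ, hξ⟩ := CFq.exists_isHyperRoot h (t := t) (by omega)
  refine ⟨ξ, hξ.degLS_eq (by omega) h, fun L _ _ _ v hv => ne_of_gt ?_⟩
  refine (hξ.wstarExp_le hv hn hcard hrn h hd).trans_lt
    (lt_of_lt_of_le ?_ (hξ.le_wExp hn hcard h hd))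
  rw [EReal.coe_lt_coe_iff]
  linarith
end

section
/- Let q = 2^s, r = 2^t, ℓ ≥ 1, m ≤ ℓ, λ ∈ F_q* with λ ≠ 1, and let Φ = Φ_ℓᵗ(λ; ε) be the hyperquadratic Laurent series of Lasjaunias with λ₁ = λ, λᵢ = 1 for 2 ≤ i ≤ m, ε₁ = ε₂ = 1, and λ_{m+1} ≠ 1 if m < ℓ. Then w₂*(Φ) ≥ (m/ℓ)(r − 1) and w₂(Φ) ≥ 1 + (m/ℓ)(r − 1). Moreover, if m/ℓ > (r − 2)/(r − 1), then deg Φ = r + 1. -/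
open Polynomial
open scoped Classical

/-- The sequence `(λ_n)_{n ≥ 1}` of coefficients of the partial quotients of the
hyperquadratic continued fraction `Φ_ℓ^t(λ; ε)` of Lasjaunias in the case
`ε₁ = ε₂ = 1`:  `λ_n = init n` for `1 ≤ n ≤ ℓ`, and
`λ_{ℓ + r m + 1} = λ_{m+1}^r`, `λ_{ℓ + r m + i} = 1` for `m ≥ 0`, `2 ≤ i ≤ r`.
(The guard `(n - ℓ - 1)/r + 1 < n` is automatically satisfied when `ℓ ≥ 1`, `r ≥ 2`.) -/
noncomputable def lamSeq (Fq : Type) [Field Fq] (l r : ℕ) (init : ℕ → Fq) : ℕ → Fq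
  | n =>
    if n ≤ l then init n
    else if h : (n - l - 1) % r = 0 ∧ (n - l - 1) / r + 1 < n then
      lamSeq Fq l r init ((n - l - 1) / r + 1) ^ r
    else 1
termination_by n => n
decreasing_by exact h.2

namespace HyperquadraticCF

/-- `v` restricts along `φ` to the absolute value `f ↦ Q ^ deg f` on polynomials, and is
nonarchimedean. -/
structure IsDegreeAbs {F K : Type*} [Field F] [Field K] (v : AbsoluteValue K ℝ) (φ : F[X] →+* K)
    (Q : ℝ) : Prop where
  one_lt : 1 < Q
  nonarch : IsNonarchimedean v
  apply_ne : ∀ f : F[X], f ≠ 0 → v (φ f) = Q ^ f.natDegree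

section Liouville

variable {F K : Type*} [Field F] [Field K] {v : AbsoluteValue K ℝ} {φ : F[X] →+* K} {Q : ℝ}

lemma IsDegreeAbs.apply_le (h : IsDegreeAbs v φ Q) {f : F[X]} {n : ℕ} (hf : f.natDegree ≤ n) :
    v (φ f) ≤ Q ^ n := by
  have hQ := h.one_lt
  by_cases h0 : f = 0
  · simp only [h0, map_zero]; positivity
  · rw [h.apply_ne f h0]; exact pow_le_pow_right₀ hQ.le hf

lemma IsDegreeAbs.one_le (h : IsDegreeAbs v φ Q) {f : F[X]} (hf : f ≠ 0) : 1 ≤ v (φ f) := by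
  rw [h.apply_ne f hf]; exact one_le_pow₀ h.one_lt.le

lemma IsDegreeAbs.map_ne_zero (h : IsDegreeAbs v φ Q) {f : F[X]} (hf : f ≠ 0) : φ f ≠ 0 := by
  intro h0
  have := h.one_le hf
  rw [h0, map_zero] at this
  linarith

lemma IsDegreeAbs.injective (h : IsDegreeAbs v φ Q) : Function.Injective φ :=
  (injective_iff_map_eq_zero φ).2 fun _ hf => by_contra fun h0 => h.map_ne_zero h0 hf

lemma natDegree_det_le {ι : Type*} [Fintype ι] [DecidableEq ι] (M : Matrix ι ι F[X]) (r : ι)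
    (D : ℕ) (hr : ∀ j, (M r j).natDegree = 0) (hM : ∀ i j, (M i j).natDegree ≤ D) :
    M.det.natDegree ≤ (Fintype.card ι - 1) * D := by
  rw [Matrix.det_apply]
  refine natDegree_sum_le_of_forall_le _ _ fun σ _ => ?_
  refine (natDegree_smul_le _ _).trans ((natDegree_prod_le _ _).trans ?_)
  rw [← Finset.add_sum_erase _ _ (Finset.mem_univ (σ⁻¹ r))]
  have h0 : (M (σ (σ⁻¹ r)) (σ⁻¹ r)).natDegree = 0 := by simp [hr]
  rw [h0, zero_add]
  refine (Finset.sum_le_card_nsmul _ _ D fun i _ => hM _ _).trans ?_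
  simp [Finset.card_erase_of_mem, Finset.card_univ]

lemma natDegree_adjugate_le {ι : Type*} [Fintype ι] [DecidableEq ι] (M : Matrix ι ι F[X])
    (D : ℕ) (hM : ∀ i j, (M i j).natDegree ≤ D) (i j : ι) :
    (M.adjugate i j).natDegree ≤ (Fintype.card ι - 1) * D := by
  rw [Matrix.adjugate_apply]
  have hs : ∀ k, ((Pi.single i 1 : ι → F[X]) k).natDegree = 0 := fun k => by
    by_cases hk : k = i
    · subst hk; simp
    · simp [hk]
  refine natDegree_det_le _ j D (fun k => ?_) fun k k' => ?_
  · simp [hs]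
  · by_cases hk : k = j
    · subst hk; simp [hs]
    · simpa [Matrix.updateRow_ne hk] using hM k k'

/-- Pseudo-division of `a ^ k * X ^ k` by a polynomial with leading coefficient `a`. -/
lemma exists_pow_reduction (φ : F[X] →+* K) (ξ : K) (M : F[X][X]) (hd : 1 ≤ M.natDegree)
    (hM : M.eval₂ φ ξ = 0) (k : ℕ) :
    ∃ R : F[X][X], R.natDegree < M.natDegree ∧
      φ M.leadingCoeff ^ k * ξ ^ k = R.eval₂ φ ξ := by
  induction k with
  | zero => exact ⟨1, by rw [natDegree_one]; exact hd, by simp⟩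
  | succ k ih =>
    obtain ⟨R, hR, he⟩ := ih
    refine ⟨C M.leadingCoeff * (X * R) - C (R.coeff (M.natDegree - 1)) * M, ?_, ?_⟩
    · rw [Nat.lt_iff_le_pred hd, natDegree_le_iff_coeff_eq_zero]
      intro j hj
      replace hj : M.natDegree ≤ j := Nat.le_of_pred_lt hj
      obtain ⟨i, rfl⟩ : ∃ i, j = i + 1 := ⟨j - 1, by omega⟩
      rw [coeff_sub, coeff_C_mul, coeff_C_mul, coeff_X_mul]
      rcases hj.eq_or_lt with hj | hj
      · rw [← hj, show M.natDegree - 1 = i by omega, coeff_natDegree]; ring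
      · rw [coeff_eq_zero_of_natDegree_lt hj, coeff_eq_zero_of_natDegree_lt (by omega)]; ring
    · simp only [eval₂_sub, eval₂_mul, eval₂_C, eval₂_X, hM, ← he]
      ring

lemma eval₂_sum_fin (φ : F[X] →+* K) (ξ : K) {d : ℕ} {R : F[X][X]} (hR : R.natDegree < d) :
    R.eval₂ φ ξ = ∑ k : Fin d, φ (R.coeff k) * ξ ^ (k : ℕ) := by
  rw [eval₂_eq_sum_range' φ hR, Finset.sum_range]

/-- A Liouville inequality for values of polynomials of degree at most `n` at an algebraic
element. -/
theorem liouville_inequality (h : IsDegreeAbs v φ Q) (ξ : K) (M : F[X][X]) (hM0 : M ≠ 0)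
    (hM : M.eval₂ φ ξ = 0)
    (hmin : ∀ P : F[X][X], P ≠ 0 → P.natDegree < M.natDegree → P.eval₂ φ ξ ≠ 0) (n : ℕ) :
    ∃ c : ℝ, 0 < c ∧ ∀ (P : F[X][X]) (D : ℕ), P.natDegree ≤ n →
      (∀ i, (P.coeff i).natDegree ≤ D) → P.eval₂ φ ξ ≠ 0 →
      c ≤ Q ^ ((M.natDegree - 1) * D) * v (P.eval₂ φ ξ) := by
  have hQ := h.one_lt
  set d := M.natDegree with hd
  have hd1 : 1 ≤ d := by
    by_contra hlt
    have h0 : M.natDegree = 0 := by omega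
    rw [natDegree_eq_zero] at h0
    obtain ⟨c, rfl⟩ := h0
    rw [eval₂_C] at hM
    exact h.map_ne_zero (fun hc => hM0 (by rw [hc, C_0])) hM
  choose R hRdeg hR using exists_pow_reduction φ ξ M hd1 hM
  set a := M.leadingCoeff with ha
  have ha0 : φ a ≠ 0 := h.map_ne_zero (leadingCoeff_ne_zero.2 hM0)
  let S : Fin (n + 1) × Fin d × Fin d → F[X] := fun x =>
    a ^ (n + d - x.1 - x.2.1) * (R (x.1 + x.2.1)).coeff x.2.2
  obtain ⟨e, he⟩ := (Set.finite_range fun x => (S x).natDegree).bddAbove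
  replace he : ∀ x, (S x).natDegree ≤ e := fun x => he ⟨x, rfl⟩
  have hS : ∀ (i : Fin (n + 1)) (j : Fin d),
      ∑ k, φ (S (i, j, k)) * ξ ^ (k : ℕ) = φ a ^ (n + d) * ξ ^ (i + j : ℕ) := fun i j => by
    simp only [S, map_mul, map_pow, mul_assoc, ← Finset.mul_sum]
    rw [← eval₂_sum_fin φ ξ (hRdeg _), ← hR, ← mul_assoc, ← pow_add]
    congr 2
    omega
  have hpos : 0 < v (φ a) ^ (n + d) * Q ^ ((d - 1) * e) * ∑ j : Fin d, v ξ ^ (j : ℕ) := by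
    have : 0 < v (φ a) := v.pos ha0
    have : 0 < ∑ j : Fin d, v ξ ^ (j : ℕ) := by
      refine Finset.sum_pos' (fun _ _ => by positivity) ⟨⟨0, hd1⟩, Finset.mem_univ _, by simp⟩
    positivity
  refine ⟨_, inv_pos.2 hpos, fun P D hPn hPD hP0 => ?_⟩
  let B : Matrix (Fin d) (Fin d) F[X] := fun j k =>
    ∑ i : Fin (n + 1), P.coeff i * S (i, j, k)
  have hBdeg : ∀ j k, (B j k).natDegree ≤ D + e := fun j k =>
    natDegree_sum_le_of_forall_le _ _ fun i _ =>
      natDegree_mul_le.trans (add_le_add (hPD _) (he _))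
  have hB : ∀ j : Fin d, ∑ k, φ (B j k) * ξ ^ (k : ℕ) =
      φ a ^ (n + d) * P.eval₂ φ ξ * ξ ^ (j : ℕ) := fun j => by
    simp only [B, map_sum, map_mul, Finset.sum_mul]
    rw [Finset.sum_comm]
    simp only [mul_assoc, ← Finset.mul_sum, hS]
    rw [eval₂_sum_fin φ ξ (Nat.lt_succ_of_le hPn), Finset.sum_mul, Finset.mul_sum]
    refine Finset.sum_congr rfl fun i _ => by ring
  have hw0 : φ a ^ (n + d) * P.eval₂ φ ξ ≠ 0 := mul_ne_zero (pow_ne_zero _ ha0) hP0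
  have hdet : B.det ≠ 0 := by
    intro h0
    obtain ⟨u, hu0, hu⟩ := Matrix.exists_vecMul_eq_zero_iff.2 h0
    let U : F[X][X] := ∑ j : Fin d, monomial (j : ℕ) (u j)
    have hUc : ∀ j : Fin d, U.coeff j = u j := fun j => by
      simp [U, coeff_monomial, Fin.val_inj]
    have hUd : U.natDegree < d := by
      rw [Nat.lt_iff_le_pred hd1]
      exact natDegree_sum_le_of_forall_le _ _ fun j _ =>
        (natDegree_monomial_le _).trans (Nat.le_pred_of_lt j.2)
    refine hmin U (fun hU => hu0 ?_) hUd ?_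
    · ext1 j
      rw [← hUc, hU]; simp
    · refine (mul_eq_zero.1 ?_).resolve_left hw0
      rw [eval₂_sum_fin φ ξ hUd, Finset.mul_sum]
      calc _ = ∑ j, φ (u j) * ∑ k, φ (B j k) * ξ ^ (k : ℕ) :=
            Finset.sum_congr rfl fun j _ => by rw [hB, hUc]; ring
        _ = ∑ k, φ ((Matrix.vecMul u B) k) * ξ ^ (k : ℕ) := by
            simp only [Matrix.vecMul, dotProduct, map_sum, map_mul, Finset.mul_sum, Finset.sum_mul]
            rw [Finset.sum_comm]
            simp only [mul_assoc]
        _ = 0 := by simp [hu]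
  let i₀ : Fin d := ⟨0, hd1⟩
  have hadj : φ B.det =
      φ a ^ (n + d) * P.eval₂ φ ξ * ∑ j, φ (B.adjugate i₀ j) * ξ ^ (j : ℕ) := by
    calc φ B.det = ∑ k, φ ((B.adjugate * B) i₀ k) * ξ ^ (k : ℕ) := by
          rw [Matrix.adjugate_mul, Finset.sum_eq_single i₀]
          · simp [i₀]
          · intro k _ hk
            simp [Matrix.one_apply_ne hk.symm]
          · simp
      _ = ∑ j, φ (B.adjugate i₀ j) * ∑ k, φ (B j k) * ξ ^ (k : ℕ) := by
          simp only [Matrix.mul_apply, map_sum, map_mul, Finset.mul_sum, Finset.sum_mul]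
          rw [Finset.sum_comm]
          simp only [mul_assoc]
      _ = _ := by
          simp only [hB, Finset.mul_sum]
          exact Finset.sum_congr rfl fun j _ => by ring
  have hsum : v (∑ j, φ (B.adjugate i₀ j) * ξ ^ (j : ℕ)) ≤
      Q ^ ((d - 1) * (D + e)) * ∑ j : Fin d, v ξ ^ (j : ℕ) := by
    rw [Finset.mul_sum]
    refine (v.sum_le _ _).trans (Finset.sum_le_sum fun j _ => ?_)
    rw [map_mul, map_pow]
    refine mul_le_mul_of_nonneg_right (h.apply_le ?_) (by positivity)
    simpa using natDegree_adjugate_le B _ hBdeg i₀ j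
  rw [inv_le_iff_one_le_mul₀ hpos]
  calc (1 : ℝ) ≤ v (φ B.det) := h.one_le hdet
    _ = v (φ a) ^ (n + d) * v (P.eval₂ φ ξ) * v (∑ j, φ (B.adjugate i₀ j) * ξ ^ (j : ℕ)) := by
        rw [hadj, map_mul, map_mul, map_pow]
    _ ≤ v (φ a) ^ (n + d) * v (P.eval₂ φ ξ) *
        (Q ^ ((d - 1) * (D + e)) * ∑ j : Fin d, v ξ ^ (j : ℕ)) := by gcongr
    _ = _ := by rw [mul_add, pow_add]; ring

end Liouville

section ContinuedFraction

variable {F K : Type*} [Field F] [Field K] {v : AbsoluteValue K ℝ} {φ : F[X] →+* K} {Q : ℝ}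

lemma IsDegreeAbs.add_eq_of_lt (h : IsDegreeAbs v φ Q) {x y : K} (hxy : v y < v x) :
    v (x + y) = v x := by
  rw [IsNonarchimedean.add_eq_max_of_ne' v h.nonarch (fun a => (v.map_neg a).symm) hxy.ne',
    max_eq_left hxy.le]

lemma IsDegreeAbs.apply_add_inv (h : IsDegreeAbs v φ Q) {a : F[X]} (ha : a.natDegree = 1) {y : K}
    (hy : 1 < v y) : v (φ a + y⁻¹) = Q := by
  have ha' : v (φ a) = Q := by
    rw [h.apply_ne a (fun h0 => by simp [h0] at ha), ha, pow_one]
  rw [h.add_eq_of_lt, ha']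
  rw [map_inv₀, ha']
  exact (inv_lt_one_of_one_lt₀ hy).trans h.one_lt

/-- The value `[a 0; a 1, …, a (j - 1), z]` of a continued fraction with `j` partial quotients
and complete quotient `z`. -/
noncomputable def cfTrunc (φ : F[X] →+* K) : ℕ → (ℕ → F[X]) → K → K
  | 0, _, z => z
  | j + 1, a, z => φ (a 0) + (cfTrunc φ j (fun i => a (i + 1)) z)⁻¹

lemma eq_cfTrunc (j : ℕ) {a : ℕ → F[X]} {x : ℕ → K} (hx : ∀ i, x i = φ (a i) + (x (i + 1))⁻¹) :
    x 0 = cfTrunc φ j a (x j) := by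
  induction j generalizing a x with
  | zero => rfl
  | succ j ih =>
    have := ih (a := fun i => a (i + 1)) (x := fun i => x (i + 1)) fun i => hx _
    rw [cfTrunc, ← this]
    exact hx 0

lemma apply_cfTrunc (h : IsDegreeAbs v φ Q) (j : ℕ) {a : ℕ → F[X]}
    (ha : ∀ i, (a i).natDegree = 1) {z : K} (hz : v z = Q) : v (cfTrunc φ j a z) = Q := by
  induction j generalizing a with
  | zero => exact hz
  | succ j ih => exact h.apply_add_inv (ha 0) (by rw [ih fun i => ha _]; exact h.one_lt)

lemma IsDegreeAbs.ne_zero_of_eq (h : IsDegreeAbs v φ Q) {z : K} (hz : v z = Q) : z ≠ 0 := by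
  have := h.one_lt
  rintro rfl
  rw [map_zero] at hz
  linarith

lemma apply_cfTrunc_sub (h : IsDegreeAbs v φ Q) (j : ℕ) {a : ℕ → F[X]}
    (ha : ∀ i, (a i).natDegree = 1) {z w : K} (hz : v z = Q) (hw : v w = Q) :
    v (cfTrunc φ j a z - cfTrunc φ j a w) * Q ^ (2 * j) = v (z - w) := by
  induction j generalizing a with
  | zero => simp [cfTrunc]
  | succ j ih =>
    have hz' := apply_cfTrunc h j (fun i => ha (i + 1)) hz
    have hw' := apply_cfTrunc h j (fun i => ha (i + 1)) hw
    rw [← ih fun i => ha (i + 1), cfTrunc, cfTrunc]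
    set x := cfTrunc φ j (fun i => a (i + 1)) z
    set y := cfTrunc φ j (fun i => a (i + 1)) w
    have hx0 := h.ne_zero_of_eq hz'
    have hy0 := h.ne_zero_of_eq hw'
    have hQ : Q ≠ 0 := by have := h.one_lt; positivity
    rw [show φ (a 0) + x⁻¹ - (φ (a 0) + y⁻¹) = (y - x) / (x * y) by field_simp; ring, map_div₀,
      map_mul, hz', hw', v.map_sub y x]
    field_simp
    ring

lemma exists_quadratic [CharP K 2] (h : IsDegreeAbs v φ Q) (j : ℕ) {a : ℕ → F[X]}
    (ha : ∀ i, (a i).natDegree = 1) :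
    ∃ A B : F[X], A.natDegree ≤ 2 * j ∧ B.natDegree ≤ 2 * j ∧ ∀ z, v z = Q →
      ∃ e, v e * Q ^ j = 1 ∧
        φ A * cfTrunc φ j a z ^ 2 + φ X * cfTrunc φ j a z + φ B =
          (z ^ 2 + φ X * z + 1) * e ^ 2 := by
  have h2 : (2 : K) = 0 := CharTwo.two_eq_zero
  induction j generalizing a with
  | zero => exact ⟨1, 1, by simp, by simp, fun z _ => ⟨1, by simp, by simp [cfTrunc]⟩⟩
  | succ j ih =>
    obtain ⟨A, B, hA, hB, hAB⟩ := ih fun i => ha (i + 1)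
    refine ⟨B, A + X * a 0 + a 0 ^ 2 * B, by omega, ?_, fun z hz => ?_⟩
    · refine natDegree_add_le_of_degree_le (natDegree_add_le_of_degree_le (by omega) ?_) ?_
      · refine natDegree_mul_le.trans ?_
        rw [ha, natDegree_X]; omega
      · refine natDegree_mul_le.trans ?_
        have := natDegree_pow_le (p := a 0) (n := 2)
        rw [ha] at this; omega
    · obtain ⟨e, he, heq⟩ := hAB z hz
      have hx := apply_cfTrunc h j (fun i => ha (i + 1)) hz
      rw [cfTrunc]
      set x := cfTrunc φ j (fun i => a (i + 1)) z
      have hx0 := h.ne_zero_of_eq hx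
      have hQ : Q ≠ 0 := by have := h.one_lt; positivity
      refine ⟨e * x⁻¹, ?_, ?_⟩
      · rw [map_mul, map_inv₀, hx, ← he]
        field_simp
        ring
      · rw [mul_pow, ← mul_assoc, ← heq]
        simp only [map_add, map_mul, map_pow]
        field_simp
        linear_combination
          (x ^ 2 * φ (a 0) ^ 2 * φ B + φ B * x * φ (a 0) + x ^ 2 * φ X * φ (a 0)) * h2

lemma exists_ratio_of_cfTrunc (h : IsDegreeAbs v φ Q) (j : ℕ) {a : ℕ → F[X]}
    (ha : ∀ i, (a i).natDegree = 1) {z : K} (hz : v z = Q) {b c : F[X]} (hb : b ≠ 0)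
    (hbc : φ b * cfTrunc φ j a z = φ c) : ∃ b' c' : F[X], b' ≠ 0 ∧ φ b' * z = φ c' := by
  induction j generalizing a b c with
  | zero => exact ⟨b, c, hb, hbc⟩
  | succ j ih =>
    have hx0 := h.ne_zero_of_eq (apply_cfTrunc h j (fun i => ha (i + 1)) hz)
    rw [cfTrunc] at hbc
    have key : φ (c - a 0 * b) * cfTrunc φ j (fun i => a (i + 1)) z = φ b := by
      rw [map_sub, ← hbc, map_mul]
      field_simp
      ring
    refine ih (fun i => ha (i + 1)) (fun h0 => h.map_ne_zero hb ?_) key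
    rw [← key, h0, map_zero, zero_mul]

lemma eq_zero_of_mul_golden_eq (h : IsDegreeAbs v φ Q) {z : K} (hz : z ^ 2 + φ X * z + 1 = 0)
    {b c : F[X]} (hbc : φ b * z = φ c) : b = 0 := by
  by_contra hb
  have hrel : c ^ 2 + X * c * b + b ^ 2 = 0 := by
    apply h.injective
    simp only [map_add, map_mul, map_pow, ← hbc, map_zero]
    linear_combination φ b ^ 2 * hz
  obtain ⟨g, b', c', hcop, hb', hc'⟩ : ∃ g b' c' : F[X], IsCoprime b' c' ∧ b = g * b' ∧
      c = g * c' := by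
    obtain ⟨b', c', hb', hc', hu⟩ := extract_gcd b c
    exact ⟨_, b', c', (gcd_isUnit_iff _ _).1 hu, hb', hc'⟩
  have hg : g ≠ 0 := by rintro rfl; simp [hb'] at hb
  have hrel' : c' ^ 2 + X * c' * b' + b' ^ 2 = 0 := by
    refine (mul_eq_zero.1 ?_).resolve_left (pow_ne_zero 2 hg)
    rw [← hrel, hb', hc']; ring
  have hub : IsUnit b' := (hcop.pow_right (n := 2)).isUnit_of_dvd' dvd_rfl
    ⟨-(X * c' + b'), by linear_combination hrel'⟩
  have huc : IsUnit c' := (hcop.symm.pow_right (n := 2)).isUnit_of_dvd' dvd_rfl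
    ⟨-(X * b' + c'), by linear_combination hrel'⟩
  rw [isUnit_iff] at hub huc
  obtain ⟨β, hβ, rfl⟩ := hub
  obtain ⟨γ, hγ, rfl⟩ := huc
  have hlin : C (γ * β) * X + C (γ ^ 2 + β ^ 2) = 0 := by
    rw [← hrel']; simp only [C_mul, C_add, C_pow]; ring
  have := congrArg (fun p => coeff p 1) hlin
  simp only [coeff_add, coeff_C_mul, coeff_X_one, coeff_C_of_ne_zero one_ne_zero,
    coeff_zero] at this
  simp [hβ.ne_zero, hγ.ne_zero] at this

lemma exists_golden [CharP K 2] [IsAlgClosed K] (h : IsDegreeAbs v φ Q) :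
    ∃ β : K, β ^ 2 + φ X * β + 1 = 0 ∧ v β = Q := by
  have hQ := h.one_lt
  have h2 : (2 : K) = 0 := CharTwo.two_eq_zero
  have hX : v (φ X) = Q := by rw [h.apply_ne X X_ne_zero, natDegree_X, pow_one]
  obtain ⟨β, hβ⟩ : ∃ β : K, β ^ 2 + φ X * β + 1 = 0 := by
    obtain ⟨β, hβ⟩ := IsAlgClosed.exists_root (X ^ 2 + C (φ X) * X + 1 : K[X]) (by
      rw [show (X ^ 2 + C (φ X) * X + 1 : K[X]) = C 1 * X ^ 2 + C (φ X) * X + C 1 by simp,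
        degree_quadratic one_ne_zero]
      decide)
    exact ⟨β, by simpa [IsRoot] using hβ⟩
  have hprod : v β * v (φ X + β) = 1 := by
    rw [← map_mul, show β * (φ X + β) = 1 by linear_combination hβ - h2, map_one]
  rcases lt_trichotomy (v β) Q with hlt | heq | hgt
  · refine ⟨φ X + β, by linear_combination hβ + (φ X ^ 2 + φ X * β) * h2, ?_⟩
    rw [h.add_eq_of_lt (by rwa [hX]), hX]
  · exact ⟨β, hβ, heq⟩
  · rw [add_comm, h.add_eq_of_lt (by rwa [hX])] at hprod
    nlinarith

lemma apply_golden_form [CharP K 2] (h : IsDegreeAbs v φ Q) {β z : K}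
    (hβ : β ^ 2 + φ X * β + 1 = 0) (hβQ : v β = Q) (hz : v z = Q) :
    v (z ^ 2 + φ X * z + 1) = v (z - β) * Q := by
  have h2 : (2 : K) = 0 := CharTwo.two_eq_zero
  have hβ0 := h.ne_zero_of_eq hβQ
  have hQ := h.one_lt
  have key : z ^ 2 + φ X * z + 1 = (z - β) * (z + β⁻¹) := by
    have : β⁻¹ = φ X + β := by
      field_simp
      linear_combination h2 - hβ
    rw [this]
    linear_combination hβ
  rw [key, map_mul, h.add_eq_of_lt (y := β⁻¹), hz]
  rw [map_inv₀, hβQ, hz]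
  exact (inv_lt_one_of_one_lt₀ hQ).trans hQ

lemma apply_golden_form_run [CharP F 2] [CharP K 2] (h : IsDegreeAbs v φ Q) (n : ℕ)
    {a : ℕ → F[X]} {x : ℕ → K}
    (hx : ∀ i, x i = φ (a i) + (x (i + 1))⁻¹) (hxQ : ∀ i, v (x i) = Q)
    (hrun : ∀ i < n, a i = X) {μ : F} (hμ : μ ≠ 1) (hend : a n = C μ * X) :
    v (x 0 ^ 2 + φ X * x 0 + 1) * Q ^ (2 * n) = Q ^ 2 := by
  have h2 : (2 : K) = 0 := CharTwo.two_eq_zero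
  have hQ := h.one_lt
  induction n generalizing a x with
  | zero =>
    have hd : (C μ * X + X : F[X]).natDegree = 1 := by
      have : (C μ * X + X : F[X]) = C (μ + 1) * X := by simp [add_mul]
      rw [this, natDegree_C_mul_X]
      intro h0
      exact hμ (CharTwo.add_eq_zero.1 h0)
    have key : v (x 0 + φ X) = Q := by
      rw [hx 0, hend, add_right_comm, ← map_add]
      exact h.apply_add_inv hd (by rw [hxQ]; exact hQ)
    rw [show x 0 ^ 2 + φ X * x 0 + 1 = x 0 * (x 0 + φ X) + 1 by ring, h.add_eq_of_lt, map_mul, key,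
      hxQ]
    · ring
    · rw [map_mul, key, hxQ, map_one]; nlinarith
  | succ n ih =>
    have := ih (a := fun i => a (i + 1)) (x := fun i => x (i + 1)) (fun i => hx _)
      (fun i => hxQ _) (fun i hi => hrun _ (by omega)) hend
    have h10 := h.ne_zero_of_eq (hxQ 1)
    have hrec : x 0 ^ 2 + φ X * x 0 + 1 = (x 1 ^ 2 + φ X * x 1 + 1) / x 1 ^ 2 := by
      rw [hx 0, hrun 0 (by omega)]
      field_simp
      linear_combination (x 1 ^ 2 * φ X ^ 2 + x 1 * φ X) * h2
    rw [← this, hrec, map_div₀, map_pow, hxQ]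
    field_simp
    ring

/-- The quadratic form, and its root, obtained by replacing the complete quotient of index `p`
by `[X; X, X, …]`, when `p` is followed by `n` partial quotients equal to `X`. -/
theorem exists_quadratic_approximation [CharP F 2] [CharP K 2] (h : IsDegreeAbs v φ Q)
    {β : K} (hβ : β ^ 2 + φ X * β + 1 = 0) (hβQ : v β = Q)
    {a : ℕ → F[X]} {x : ℕ → K}
    (hx : ∀ i, x i = φ (a i) + (x (i + 1))⁻¹) (hxQ : ∀ i, v (x i) = Q)
    (ha : ∀ i, (a i).natDegree = 1) (p n : ℕ)
    (hrun : ∀ i < n, a (p + i) = X) {μ : F} (hμ : μ ≠ 1) (hend : a (p + n) = C μ * X) :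
    ∃ (A B : F[X]) (α : K), A.natDegree ≤ 2 * p ∧ B.natDegree ≤ 2 * p ∧
      v (φ A * x 0 ^ 2 + φ X * x 0 + φ B) * Q ^ (2 * p + 2 * n) = Q ^ 2 ∧
      φ A * α ^ 2 + φ X * α + φ B = 0 ∧
      v (x 0 - α) * Q ^ (2 * p + 2 * n) = Q ∧
      ∀ b c : F[X], φ b * α = φ c → b = 0 := by
  have hQ := h.one_lt
  obtain ⟨A, B, hA, hB, hAB⟩ := exists_quadratic h p ha
  have hform := apply_golden_form_run h n (a := fun i => a (p + i)) (x := fun i => x (p + i))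
    (fun i => hx _) (fun i => hxQ _) hrun hμ hend
  simp only [add_zero] at hform
  refine ⟨A, B, cfTrunc φ p a β, hA, hB, ?_, ?_, ?_, fun b c hbc => ?_⟩
  · obtain ⟨e, he, heq⟩ := hAB _ (hxQ p)
    rw [← eq_cfTrunc p hx] at heq
    rw [heq, map_mul, map_pow, ← hform]
    calc _ = v (x p ^ 2 + φ X * x p + 1) * Q ^ (2 * n) * (v e * Q ^ p) ^ 2 := by ring
      _ = _ := by rw [he]; ring
  · obtain ⟨e, -, heq⟩ := hAB _ hβQ
    rw [heq, hβ, zero_mul]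
  · have h1 := apply_cfTrunc_sub h p ha (hxQ p) hβQ
    rw [← eq_cfTrunc p hx] at h1
    rw [apply_golden_form h hβ hβQ (hxQ p), ← h1] at hform
    have hQ0 : Q ≠ 0 := by positivity
    apply mul_right_cancel₀ hQ0
    rw [← sq, ← hform]
    ring
  · by_contra hb
    obtain ⟨b', c', hb', hbc'⟩ := exists_ratio_of_cfTrunc h p ha hβQ hb hbc
    exact hb' (eq_zero_of_mul_golden_eq h hβ hbc')

end ContinuedFraction

section Algebraicity

variable {F K : Type*} [Field F] [Field K] {v : AbsoluteValue K ℝ} {φ : F[X] →+* K} {Q : ℝ}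

/-- The continuants of `[X; X, …, X]`, with index shifted so that the zeroth term vanishes. -/
noncomputable def fibPoly (F : Type*) [Field F] : ℕ → F[X]
  | 0 => 0
  | 1 => 1
  | n + 2 => X * fibPoly F (n + 1) + fibPoly F n

lemma natDegree_fibPoly_le (n : ℕ) : (fibPoly F (n + 1)).natDegree ≤ n := by
  induction n using Nat.strong_induction_on with
  | _ n ih =>
    match n with
    | 0 => simp [fibPoly]
    | 1 => simp [fibPoly]
    | n + 2 =>
      rw [fibPoly]
      refine natDegree_add_le_of_degree_le (natDegree_mul_le.trans ?_)
        ((ih n (by omega)).trans (by omega))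
      have := ih (n + 1) (by omega)
      rw [natDegree_X]; omega

lemma fibPoly_cassini [CharP F 2] (n : ℕ) :
    fibPoly F (n + 2) * fibPoly F n + fibPoly F (n + 1) ^ 2 = 1 := by
  have h2 : (2 : F[X]) = 0 := CharTwo.two_eq_zero
  induction n with
  | zero => simp [fibPoly]
  | succ n ih =>
    rw [fibPoly] at ih ⊢
    rw [← ih, fibPoly]
    linear_combination (X * fibPoly F (n + 1) * fibPoly F n + X ^ 2 * fibPoly F (n + 1) ^ 2) * h2

lemma fibPoly_double [CharP F 2] (n : ℕ) :
    fibPoly F (2 * n) = X * fibPoly F n ^ 2 ∧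
      fibPoly F (2 * n + 1) = fibPoly F (n + 1) ^ 2 + fibPoly F n ^ 2 := by
  have h2 : (2 : F[X]) = 0 := CharTwo.two_eq_zero
  induction n with
  | zero => simp [fibPoly]
  | succ n ih =>
    have h1 : fibPoly F (2 * (n + 1)) = X * fibPoly F (n + 1) ^ 2 := by
      rw [show 2 * (n + 1) = 2 * n + 2 by ring, fibPoly, ih.1, ih.2]
      linear_combination X * fibPoly F n ^ 2 * h2
    refine ⟨h1, ?_⟩
    rw [show 2 * (n + 1) + 1 = 2 * n + 1 + 2 by ring, fibPoly,
      show 2 * n + 1 + 1 = 2 * (n + 1) by ring, h1, ih.2, fibPoly]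
    linear_combination -(X * fibPoly F (n + 1) * fibPoly F n) * h2

lemma fibPoly_two_pow [CharP F 2] (t : ℕ) : fibPoly F (2 ^ t) = X ^ (2 ^ t - 1) := by
  induction t with
  | zero => simp [fibPoly]
  | succ t ih =>
    rw [pow_succ', (fibPoly_double _).1, ih, ← pow_mul, ← pow_succ']
    congr 1
    have : 0 < 2 ^ t := by positivity
    omega

lemma fibPoly_run {z : ℕ → K} (hz0 : ∀ i, z i ≠ 0) (j : ℕ)
    (hz : ∀ i ≤ j, z i = φ X + (z (i + 1))⁻¹) :
    z 0 * (φ (fibPoly F (j + 1)) * z (j + 1) + φ (fibPoly F j)) =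
      φ (fibPoly F (j + 2)) * z (j + 1) + φ (fibPoly F (j + 1)) := by
  induction j with
  | zero =>
    have := hz0 1
    rw [hz 0 le_rfl]
    simp only [fibPoly, zero_add, map_add, map_mul, map_one, map_zero]
    field_simp
    ring
  | succ j ih =>
    have ih := ih fun i hi => hz i (by omega)
    have h0 := hz0 (j + 1 + 1)
    rw [hz (j + 1) le_rfl] at ih
    have e1 : φ (fibPoly F (j + 1 + 1)) = φ X * φ (fibPoly F (j + 1)) + φ (fibPoly F j) := by
      rw [fibPoly, map_add, map_mul]
    have e2 : φ (fibPoly F (j + 1 + 2)) =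
        φ X * φ (fibPoly F (j + 1 + 1)) + φ (fibPoly F (j + 1)) := by
      rw [fibPoly, map_add, map_mul]
    rw [show φ (fibPoly F (j + 2)) = φ (fibPoly F (j + 1 + 1)) from rfl] at ih
    field_simp at ih
    rw [e2]
    linear_combination ih + z 0 * z (j + 1 + 1) * e1

/-- `λ Xʳ + 1 / G(w)` is the value of `G` at `[λ X; X, …, X, w]`, for `r = 2 ^ t`,
`r - 1` partial quotients `X`, and `G = fibPoly r * · + fibPoly (r - 1)`. -/
lemma fibPoly_step [CharP F 2] [CharP K 2] {z : ℕ → K} (hz0 : ∀ i, z i ≠ 0) {x : K} {μ : F}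
    {t s : ℕ} (hs : s + 2 = 2 ^ t) (hx : x = φ (C μ * X) + (z 0)⁻¹)
    (hz : ∀ i ≤ s, z i = φ X + (z (i + 1))⁻¹) :
    φ (fibPoly F (s + 2)) * x + φ (fibPoly F (s + 1)) =
      φ (C μ * X ^ 2 ^ t) +
        (φ (fibPoly F (s + 2)) * z (s + 1) + φ (fibPoly F (s + 1)))⁻¹ := by
  have h2 : (2 : K) = 0 := CharTwo.two_eq_zero
  have hrun := fibPoly_run hz0 s hz
  have hT : φ (fibPoly F (s + 2)) * φ X = φ X ^ 2 ^ t := by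
    rw [← map_mul, hs, fibPoly_two_pow, ← pow_succ, map_pow, ← hs]; rfl
  have hcas : φ (fibPoly F (s + 2)) * φ (fibPoly F s) + φ (fibPoly F (s + 1)) ^ 2 = 1 := by
    rw [← map_mul, ← map_pow, ← map_add, fibPoly_cassini, map_one]
  have hz00 := hz0 0
  rw [hx, map_mul, map_mul, map_pow, ← hT]
  generalize φ (fibPoly F (s + 2)) = u at *
  generalize φ (fibPoly F (s + 1)) = u' at *
  generalize φ (fibPoly F s) = u'' at *
  have key : u * (z 0)⁻¹ + u' = (u * z (s + 1) + u')⁻¹ := by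
    refine eq_inv_of_mul_eq_one_left ?_
    rw [← hcas]
    have : (z 0)⁻¹ * (u * z (s + 1) + u') = u' * z (s + 1) + u'' := by
      rw [← hrun]; field_simp
    linear_combination u * this + u' * u * z (s + 1) * h2
  rw [← key]
  ring

/-- The functional equation `xʳ = F_{r-1} x_ℓ + F_{r-2}` relating a hyperquadratic continued
fraction to its complete quotient of index `ℓ`. -/
theorem pow_eq_fibPoly_mul_add [CharP F 2] [CharP K 2] (h : IsDegreeAbs v φ Q) {t s l : ℕ}
    (hs : s + 2 = 2 ^ t) {c : ℕ → F} {x : ℕ → K}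
    (hx : ∀ i, x i = φ (C (c i) * X) + (x (i + 1))⁻¹) (hxQ : ∀ i, v (x i) = Q)
    (hc : ∀ j, c (l + 2 ^ t * j) = c j ^ 2 ^ t)
    (hc1 : ∀ j i, i ≤ s → c (l + 2 ^ t * j + 1 + i) = 1) :
    x 0 ^ 2 ^ t = φ (fibPoly F (s + 2)) * x l + φ (fibPoly F (s + 1)) := by
  have hQ := h.one_lt
  have hx0 : ∀ i, x i ≠ 0 := fun i => h.ne_zero_of_eq (hxQ i)
  let G : K → K := fun w => φ (fibPoly F (s + 2)) * w + φ (fibPoly F (s + 1))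
  have hG : ∀ w, v w = Q → v (G w) = Q ^ 2 ^ t := fun w hw => by
    have h1 : v (φ (fibPoly F (s + 2)) * w) = Q ^ 2 ^ t := by
      have : (2 : ℕ) ^ t - 1 + 1 = 2 ^ t := by omega
      rw [map_mul, hs, fibPoly_two_pow, h.apply_ne _ (pow_ne_zero _ X_ne_zero), natDegree_X_pow,
        hw, ← pow_succ, this]
    rw [← h1]
    refine h.add_eq_of_lt ((h.apply_le (natDegree_fibPoly_le s)).trans_lt ?_)
    rw [h1]
    exact pow_lt_pow_right₀ hQ (by omega)
  have hG0 : ∀ w, v w = Q → G w ≠ 0 := fun w hw h0 => by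
    have := hG w hw
    rw [h0, map_zero] at this
    have : 0 < Q ^ 2 ^ t := by positivity
    linarith
  have hstep : ∀ j, G (x (l + 2 ^ t * j)) =
      φ (C (c j) * X) ^ 2 ^ t + (G (x (l + 2 ^ t * (j + 1))))⁻¹ := fun j => by
    have := fibPoly_step (φ := φ) (z := fun i => x (l + 2 ^ t * j + 1 + i)) (fun i => hx0 _) hs
      (hx (l + 2 ^ t * j))
      (fun i hi => by rw [hx, hc1 j i hi, C_1, one_mul]; rfl)
    simp only [G]
    rw [this, hc]
    congr 1
    · rw [← map_pow, mul_pow, C_pow]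
    · rw [show l + 2 ^ t * (j + 1) = l + 2 ^ t * j + 1 + (s + 1) by rw [mul_add, ← hs]; ring]
  have hpow : ∀ j, x j ^ 2 ^ t = φ (C (c j) * X) ^ 2 ^ t + (x (j + 1) ^ 2 ^ t)⁻¹ := fun j => by
    rw [← inv_pow, ← add_pow_char_pow, ← hx]
  let E : ℕ → ℝ := fun j => v (x j ^ 2 ^ t - G (x (l + 2 ^ t * j)))
  have hE : ∀ j, E j * Q ^ (2 * 2 ^ t) = E (j + 1) := fun j => by
    have hy := pow_ne_zero (2 ^ t) (hx0 (j + 1))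
    have hg := hG0 _ (hxQ (l + 2 ^ t * (j + 1)))
    have hdiff : x j ^ 2 ^ t - G (x (l + 2 ^ t * j)) =
        -(x (j + 1) ^ 2 ^ t - G (x (l + 2 ^ t * (j + 1)))) /
          (x (j + 1) ^ 2 ^ t * G (x (l + 2 ^ t * (j + 1)))) := by
      rw [hstep, hpow]
      field_simp
      ring
    simp only [E]
    rw [hdiff, map_div₀, v.map_neg, map_mul, map_pow, hxQ, hG _ (hxQ _), two_mul, pow_add]
    field_simp
  have hEle : ∀ j, E j ≤ Q ^ 2 ^ t := fun j => by
    simp only [E]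
    rw [sub_eq_add_neg]
    refine (h.nonarch _ _).trans (max_le ?_ ?_)
    · rw [map_pow, hxQ]
    · rw [v.map_neg, hG _ (hxQ _)]
  have hEj : ∀ j, E 0 * (Q ^ (2 * 2 ^ t)) ^ j = E j := fun j => by
    induction j with
    | zero => simp
    | succ j ih => rw [pow_succ, ← mul_assoc, ih, hE]
  have hE0 : E 0 = 0 := by
    by_contra hne
    have hpos : 0 < E 0 := lt_of_le_of_ne (v.nonneg _) (Ne.symm hne)
    obtain ⟨j, hj⟩ := pow_unbounded_of_one_lt (Q ^ 2 ^ t / E 0)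
      (one_lt_pow₀ hQ (show 2 * 2 ^ t ≠ 0 by positivity))
    rw [div_lt_iff₀ hpos, mul_comm, hEj] at hj
    exact absurd (hEle j) (not_le.2 hj)
  have := sub_eq_zero.1 (v.eq_zero.1 hE0)
  simpa [G] using this

lemma exists_moebius {a : ℕ → F[X]} {x : ℕ → K}
    (hx : ∀ i, x i = φ (a i) + (x (i + 1))⁻¹) (hx0 : ∀ i, x i ≠ 0) (j : ℕ) :
    ∃ b c b' c' : F[X], φ b * x 0 + φ c ≠ 0 ∧
      x j * (φ b * x 0 + φ c) = φ b' * x 0 + φ c' := by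
  induction j with
  | zero => exact ⟨0, 1, 1, 0, by simp, by simp⟩
  | succ j ih =>
    obtain ⟨b, c, b', c', hne, heq⟩ := ih
    have h1 : φ (b' - a j * b) * x 0 + φ (c' - a j * c) = (x (j + 1))⁻¹ * (φ b * x 0 + φ c) := by
      rw [hx j] at heq
      simp only [map_sub, map_mul]
      linear_combination -heq
    refine ⟨b' - a j * b, c' - a j * c, b, c, ?_, ?_⟩
    · rw [h1]
      exact mul_ne_zero (inv_ne_zero (hx0 _)) hne
    · rw [h1, mul_inv_cancel_left₀ (hx0 _)]

/-- A hyperquadratic continued fraction is algebraic of degree at most `r + 1`. -/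
theorem exists_annihilator [CharP F 2] [CharP K 2] (h : IsDegreeAbs v φ Q) {t s l : ℕ}
    (hs : s + 2 = 2 ^ t) {c : ℕ → F} {x : ℕ → K}
    (hx : ∀ i, x i = φ (C (c i) * X) + (x (i + 1))⁻¹) (hxQ : ∀ i, v (x i) = Q)
    (hc : ∀ j, c (l + 2 ^ t * j) = c j ^ 2 ^ t)
    (hc1 : ∀ j i, i ≤ s → c (l + 2 ^ t * j + 1 + i) = 1) :
    ∃ P : F[X][X], P ≠ 0 ∧ P.natDegree ≤ 2 ^ t + 1 ∧ P.eval₂ φ (x 0) = 0 := by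
  have heq := pow_eq_fibPoly_mul_add h hs hx hxQ hc hc1
  obtain ⟨b, d, b', d', hne, hl⟩ :=
    exists_moebius hx (fun i => h.ne_zero_of_eq (hxQ i)) l
  let e := fibPoly F (s + 1) * b + fibPoly F (s + 2) * b'
  let f := fibPoly F (s + 1) * d + fibPoly F (s + 2) * d'
  refine ⟨(C b * X + C d) * X ^ 2 ^ t - (C e * X + C f), fun h0 => ?_, ?_, ?_⟩
  · have hcoeff : ∀ i < 2, ((C b * X + C d) * X ^ 2 ^ t - (C e * X + C f)).coeff (i + 2 ^ t) =
        (C b * X + C d).coeff i := fun i _ => by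
      have h1 : (C e * X + C f).coeff (i + 2 ^ t) = 0 :=
        coeff_eq_zero_of_natDegree_lt (natDegree_linear_le.trans_lt (by omega))
      rw [coeff_sub, coeff_mul_X_pow, h1, sub_zero]
    have hd := hcoeff 0 (by omega)
    have hb := hcoeff 1 (by omega)
    rw [h0, coeff_zero] at hb hd
    simp at hb hd
    apply hne
    rw [← hb, ← hd]
    simp
  · refine (natDegree_sub_le _ _).trans (max_le ?_ (natDegree_linear_le.trans (by omega)))
    refine natDegree_mul_le.trans ?_
    have := natDegree_linear_le (a := b) (b := d)
    rw [natDegree_X_pow]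
    omega
  · simp only [eval₂_sub, eval₂_mul, eval₂_add, eval₂_C, eval₂_X, eval₂_pow, e, f, map_add, map_mul,
      heq]
    linear_combination φ (fibPoly F (s + 2)) * hl

end Algebraicity

section Runs

variable {Fq : Type} [Field Fq] {l r m : ℕ} {init : ℕ → Fq}

lemma lamSeq_of_le {n : ℕ} (hn : n ≤ l) : lamSeq Fq l r init n = init n := by
  rw [lamSeq, if_pos hn]

lemma lamSeq_block (hl : 1 ≤ l) (hr : 1 ≤ r) (j : ℕ) :
    lamSeq Fq l r init (l + r * j + 1) = lamSeq Fq l r init (j + 1) ^ r := by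
  have h1 : l + r * j + 1 - l - 1 = r * j := by omega
  have h2 : r * j / r = j := Nat.mul_div_cancel_left j hr
  have h3 : j ≤ r * j := Nat.le_mul_of_pos_left j hr
  rw [lamSeq, if_neg (by omega), dif_pos, h1, h2]
  rw [h1, h2]
  exact ⟨Nat.mul_mod_right r j, by omega⟩

lemma lamSeq_block_one {j i : ℕ} (hi : i + 1 < r) :
    lamSeq Fq l r init (l + r * j + 1 + i + 1) = 1 := by
  have h1 : l + r * j + 1 + i + 1 - l - 1 = r * j + (i + 1) := by omega
  rw [lamSeq, if_neg (by omega), dif_neg]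
  rw [h1, Nat.mul_add_mod, Nat.mod_eq_of_lt hi]
  omega

/-- The position of the partial quotient preceding the `k`-th distinguished run of partial
quotients equal to `T`. -/
def runStart (l r : ℕ) : ℕ → ℕ
  | 0 => 0
  | k + 1 => l + r * runStart l r k

lemma strictMono_runStart (hl : 1 ≤ l) (hr : 1 ≤ r) : StrictMono (runStart l r) :=
  strictMono_nat_of_lt_succ fun k => by
    have : runStart l r k ≤ r * runStart l r k := Nat.le_mul_of_pos_left _ hr
    rw [runStart]; omega

lemma pow_two_pow_ne_one [CharP Fq 2] {x : Fq} (hx : x ≠ 1) (t : ℕ) : x ^ 2 ^ t ≠ 1 := by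
  intro h
  refine hx (sub_eq_zero.1 (pow_eq_zero_iff (n := 2 ^ t) (by positivity) |>.1 ?_))
  rw [sub_pow_char_pow, one_pow, h, sub_self]

lemma lamSeq_run [CharP Fq 2] {t : ℕ} (hm : 1 ≤ m) (hml : m ≤ l)
    (h1 : init 1 ≠ 1) (hmid : ∀ i, 2 ≤ i → i ≤ m → init i = 1)
    (hnext : m < l → init (m + 1) ≠ 1) (k : ℕ) :
    (∀ i, 1 ≤ i → i < m * (2 ^ t) ^ k →
      lamSeq Fq l (2 ^ t) init (runStart l (2 ^ t) k + i + 1) = 1) ∧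
    lamSeq Fq l (2 ^ t) init (runStart l (2 ^ t) k + m * (2 ^ t) ^ k + 1) ≠ 1 := by
  have hr : 1 ≤ 2 ^ t := Nat.one_le_two_pow
  induction k with
  | zero =>
    simp only [runStart, pow_zero, mul_one, zero_add]
    refine ⟨fun i hi him => ?_, ?_⟩
    · rw [lamSeq_of_le (by omega), hmid _ (by omega) (by omega)]
    · rcases hml.lt_or_eq with hlt | rfl
      · rw [lamSeq_of_le (by omega)]; exact hnext hlt
      · have := lamSeq_block (init := init) hm hr 0
        simp only [mul_zero, add_zero, zero_add] at this
        rw [this, lamSeq_of_le hm]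
        exact pow_two_pow_ne_one h1 t
  | succ k ih =>
    have hl : 1 ≤ l := hm.trans hml
    set s := runStart l (2 ^ t) k
    have hs : runStart l (2 ^ t) (k + 1) = l + 2 ^ t * s := rfl
    rw [hs]
    refine ⟨fun i hi him => ?_, ?_⟩
    · obtain ⟨j, e, he, rfl⟩ : ∃ j e, e < 2 ^ t ∧ i = 2 ^ t * j + e :=
        ⟨i / 2 ^ t, i % 2 ^ t, Nat.mod_lt _ hr, (Nat.div_add_mod _ _).symm⟩
      rcases Nat.eq_zero_or_pos e with rfl | he0
      · have hj : 1 ≤ j := Nat.pos_of_ne_zero fun h0 => by simp [h0] at hi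
        have hj' : j < m * (2 ^ t) ^ k := by
          rw [pow_succ', mul_left_comm, add_zero] at him
          exact lt_of_mul_lt_mul_left him (Nat.zero_le _)
        rw [show l + 2 ^ t * s + (2 ^ t * j + 0) + 1 = l + 2 ^ t * (s + j) + 1 by ring,
          lamSeq_block hl hr, ih.1 j hj hj', one_pow]
      · obtain ⟨e, rfl⟩ : ∃ f, e = f + 1 := ⟨e - 1, by omega⟩
        rw [show l + 2 ^ t * s + (2 ^ t * j + (e + 1)) + 1 = l + 2 ^ t * (s + j) + 1 + e + 1 by
          ring]
        exact lamSeq_block_one he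
    · rw [show l + 2 ^ t * s + m * (2 ^ t) ^ (k + 1) + 1 =
        l + 2 ^ t * (s + m * (2 ^ t) ^ k) + 1 by ring, lamSeq_block hl hr]
      exact pow_two_pow_ne_one ih.2 t

lemma exists_runStart_mul_le (hl : 1 ≤ l) (hr : 2 ≤ r) {w : ℝ} (hw0 : 0 ≤ w)
    (hw : w < (m : ℝ) / l * ((r : ℝ) - 1)) :
    ∃ N : ℕ, ∀ k ≥ N, ((runStart l r k + 1 : ℕ) : ℝ) * w ≤ m * (r : ℝ) ^ k - 2 := by
  have hr' : (2 : ℝ) ≤ r := by exact_mod_cast hr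
  have hl' : (1 : ℝ) ≤ l := by exact_mod_cast hl
  have hs : ∀ k, (runStart l r k : ℝ) * (r - 1) + l = l * (r : ℝ) ^ k := fun k => by
    induction k with
    | zero => simp [runStart]
    | succ k ih =>
      rw [pow_succ, ← mul_assoc, ← ih, runStart]
      push_cast
      ring
  have hδ : 0 < m * ((r : ℝ) - 1) - l * w := by
    rw [div_mul_eq_mul_div, lt_div_iff₀ (by linarith)] at hw
    linarith
  obtain ⟨N, hN⟩ := pow_unbounded_of_one_lt
    ((w + 2) * ((r : ℝ) - 1) / (m * ((r : ℝ) - 1) - l * w)) (show (1 : ℝ) < r by linarith)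
  refine ⟨N, fun k hk => ?_⟩
  have hk' := hN.trans_le (pow_le_pow_right₀ (show (1 : ℝ) ≤ r by linarith) hk)
  rw [div_lt_iff₀ hδ] at hk'
  have hsk := hs k
  push_cast
  refine le_of_mul_le_mul_right ?_ (show (0 : ℝ) < r - 1 by linarith)
  have hlw : 0 ≤ l * w := by positivity
  calc ((runStart l r k : ℝ) + 1) * w * (r - 1)
      = (runStart l r k * (r - 1) + l) * w - l * w + w * (r - 1) := by ring
    _ = l * (r : ℝ) ^ k * w - l * w + w * (r - 1) := by rw [hsk]
    _ ≤ (m * (r : ℝ) ^ k - 2) * (r - 1) := by linarith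

end Runs

section Heights

open CFq

variable {Fq : Type} [Field Fq] [Fintype Fq] {L : Type} [Field L] [Algebra (LaurentSeries Fq) L]
  {v : AbsoluteValue L ℝ}

lemma isNonarchimedean_of_charTwo {K : Type*} [Field K] [CharP K 2] (v : AbsoluteValue K ℝ) :
    IsNonarchimedean v := by
  intro x y
  by_contra! hlt
  set M := max (v x) (v y)
  have hM : 0 < M := by
    rcases eq_or_ne x 0 with rfl | hx
    · rw [zero_add] at hlt
      exact absurd (le_max_right _ _) (not_le.2 hlt)
    · exact (v.pos hx).trans_le (le_max_left _ _)
  obtain ⟨n, hn⟩ := pow_unbounded_of_one_lt 2 ((one_lt_div hM).2 hlt)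
  have h1 := hn.trans_le (pow_le_pow_right₀ ((one_lt_div hM).2 hlt).le Nat.lt_two_pow_self.le)
  rw [div_pow, lt_div_iff₀ (by positivity), ← map_pow, add_pow_char_pow] at h1
  have h2 := v.add_le (x ^ 2 ^ n) (y ^ 2 ^ n)
  rw [map_pow, map_pow] at h2
  have h3 := pow_le_pow_left₀ (v.nonneg x) (le_max_left (v x) (v y)) (2 ^ n)
  have h4 := pow_le_pow_left₀ (v.nonneg y) (le_max_right (v x) (v y)) (2 ^ n)
  linarith

lemma isDegreeAbs_embRing [CharP L 2]
    (hv : ∀ x : LaurentSeries Fq, v (algebraMap (LaurentSeries Fq) L x) = absQ Fq x) :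
    IsDegreeAbs v (embRing Fq L) (Fintype.card Fq) := by
  have hq : (1 : ℝ) < Fintype.card Fq := by exact_mod_cast Fintype.one_lt_card
  have hna := isNonarchimedean_of_charTwo v
  have hX : v (embRing Fq L X) = Fintype.card Fq := by
    have : embRing Fq L X = algebraMap (LaurentSeries Fq) L (Tls Fq) := by
      simp [embRing, toLS]
    rw [this, hv, absQ, if_neg (by simp [Tls]), Tls, HahnSeries.order_single one_ne_zero]
    simp
  have hC : ∀ c : Fq, c ≠ 0 → v (embRing Fq L (C c)) = 1 := fun c hc => by
    have h1 : v (embRing Fq L (C c)) ^ (Fintype.card Fq - 1) = 1 := by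
      rw [← map_pow, ← map_pow, ← C_pow, FiniteField.pow_card_sub_one_eq_one c hc]
      simp
    have h2 : Fintype.card Fq - 1 ≠ 0 := by
      have := Fintype.one_lt_card (α := Fq)
      omega
    exact (pow_eq_one_iff_of_nonneg (v.nonneg _) h2).1 h1
  refine ⟨hq, hna, fun f => ?_⟩
  induction hn : f.natDegree generalizing f with
  | zero =>
    intro hf
    obtain ⟨c, rfl⟩ := natDegree_eq_zero.1 hn
    rw [hC c (by rintro rfl; simp at hf), pow_zero]
  | succ n ih =>
    intro hf
    have hd : f.divX.natDegree = n := by rw [natDegree_divX_eq_natDegree_tsub_one, hn]; rfl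
    have hd0 : f.divX ≠ 0 := fun h0 => by
      rw [divX_eq_zero_iff] at h0
      rw [h0, natDegree_C] at hn
      omega
    have hmain : v (embRing Fq L (f.divX * X)) = (Fintype.card Fq : ℝ) ^ (n + 1) := by
      rw [map_mul, map_mul, ih _ hd hd0, hX, pow_succ]
    have hlt : v (embRing Fq L (C (f.coeff 0))) < v (embRing Fq L (f.divX * X)) := by
      rw [hmain]
      refine lt_of_le_of_lt ?_ (one_lt_pow₀ hq (Nat.succ_ne_zero n))
      by_cases h0 : f.coeff 0 = 0
      · simp [h0]
      · exact (hC _ h0).le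
    rw [← divX_mul_X_add f, map_add,
      IsNonarchimedean.add_eq_max_of_ne' v hna (fun a => (v.map_neg a).symm) hlt.ne',
      max_eq_left hlt.le, hmain]

omit [Fintype Fq] in
lemma algebraMap_evalLS (P : Fq[X][X]) (ξ : LaurentSeries Fq) :
    algebraMap (LaurentSeries Fq) L (evalLS Fq P ξ) =
      P.eval₂ (embRing Fq L) (algebraMap (LaurentSeries Fq) L ξ) :=
  hom_eval₂ _ _ _ _

omit [Fintype Fq] in
lemma evalLS_eq_zero_iff (P : Fq[X][X]) (ξ : LaurentSeries Fq) :
    evalLS Fq P ξ = 0 ↔ P.eval₂ (embRing Fq L) (algebraMap (LaurentSeries Fq) L ξ) = 0 := by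
  rw [← algebraMap_evalLS, map_eq_zero]

omit [Fintype Fq] in
lemma exists_natDegree_coeff_le (P : Fq[X][X]) : ∃ D, ∀ i, (P.coeff i).natDegree ≤ D := by
  refine ⟨P.support.sup fun i => (P.coeff i).natDegree, fun i => ?_⟩
  by_cases hi : i ∈ P.support
  · exact Finset.le_sup (f := fun i => (P.coeff i).natDegree) hi
  · rw [notMem_support_iff.1 hi, natDegree_zero]
    exact Nat.zero_le _

section

variable (h : IsDegreeAbs v (embRing Fq L) (Fintype.card Fq))
  (hv : ∀ x : LaurentSeries Fq, v (algebraMap (LaurentSeries Fq) L x) = absQ Fq x)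

include h hv

lemma pabs_le {f : Fq[X]} {n : ℕ} (hf : f.natDegree ≤ n) :
    pabs Fq f ≤ (Fintype.card Fq : ℝ) ^ n :=
  (hv _).symm.trans_le (h.apply_le hf)

lemma Hpoly_le {P : Fq[X][X]} {D : ℕ} (hP : ∀ i, (P.coeff i).natDegree ≤ D) :
    Hpoly Fq P ≤ (Fintype.card Fq : ℝ) ^ D := by
  refine csSup_le ⟨_, 0, rfl⟩ ?_
  rintro _ ⟨i, rfl⟩
  exact pabs_le h hv (hP i)

lemma one_le_Hpoly {P : Fq[X][X]} (hP : P ≠ 0) : 1 ≤ Hpoly Fq P := by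
  obtain ⟨D, hD⟩ := exists_natDegree_coeff_le P
  refine le_csSup_of_le ⟨(Fintype.card Fq : ℝ) ^ D, ?_⟩ ⟨P.natDegree, rfl⟩
    ((h.one_le (leadingCoeff_ne_zero.2 hP)).trans_eq (hv _))
  rintro _ ⟨i, rfl⟩
  exact pabs_le h hv (hD i)

lemma one_le_heightA {α : L} (hα : ∃ P : Fq[X][X], P ≠ 0 ∧ evalA Fq L P α = 0) :
    1 ≤ heightA Fq L α := by
  obtain ⟨P, hP, hPα⟩ := hα
  obtain ⟨M, hM, hMd, hMα⟩ := Nat.sInf_mem (s := {d | ∃ P : Fq[X][X], P ≠ 0 ∧ P.natDegree = d ∧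
    evalA Fq L P α = 0}) ⟨_, P, hP, rfl, hPα⟩
  refine le_csInf ⟨_, M, hM, hMd, hMα, rfl⟩ ?_
  rintro _ ⟨R, hR, -, -, rfl⟩
  exact one_le_Hpoly h hv hR

lemma heightA_le {P : Fq[X][X]} {α : L} (hP : P ≠ 0) (hdeg : P.natDegree = degA Fq L α)
    (hPα : evalA Fq L P α = 0) : heightA Fq L α ≤ Hpoly Fq P := by
  refine csInf_le ⟨1, ?_⟩ ⟨P, hP, hdeg, hPα, rfl⟩
  rintro _ ⟨R, hR, -, -, rfl⟩
  exact one_le_Hpoly h hv hR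

end

omit [Fintype Fq] in
lemma degA_eq_two {P : Fq[X][X]} {α : L} (hP : P ≠ 0) (hdeg : P.natDegree ≤ 2)
    (hPα : evalA Fq L P α = 0)
    (hirr : ∀ b c : Fq[X], embRing Fq L b * α = embRing Fq L c → b = 0) :
    P.natDegree = 2 ∧ degA Fq L α = 2 := by
  have hlow : ∀ R : Fq[X][X], R ≠ 0 → evalA Fq L R α = 0 → 2 ≤ R.natDegree := by
    intro R hR hRα
    by_contra! hlt
    obtain ⟨b, c, rfl⟩ := exists_eq_X_add_C_of_natDegree_le_one (Nat.le_of_lt_succ hlt)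
    simp only [evalA, eval₂_add, eval₂_mul, eval₂_C, eval₂_X] at hRα
    have hb : b = 0 := hirr b (-c) (by rw [map_neg]; linear_combination hRα)
    have hc : (-c : Fq[X]) = 0 := by
      by_contra hc
      refine one_ne_zero (hirr 1 0 ?_)
      have hc' : embRing Fq L c = 0 := by simpa [hb] using hRα
      have hc0 : c ≠ 0 := neg_ne_zero.1 hc
      have := hirr c 0 (by rw [hc']; simp)
      exact absurd this hc0
    exact hR (by rw [hb, neg_eq_zero.1 hc]; simp)
  have h2 : P.natDegree = 2 := le_antisymm hdeg (hlow P hP hPα)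
  refine ⟨h2, le_antisymm (Nat.sInf_le ⟨P, hP, h2, hPα⟩) ?_⟩
  refine le_csInf ⟨2, P, hP, h2, hPα⟩ ?_
  rintro _ ⟨R, hR, rfl, hRα⟩
  exact hlow R hR hRα

/-- The quadratic polynomial `A Y² + T Y + B`. -/
noncomputable def quadPoly (A B : Fq[X]) : Fq[X][X] := C A * X ^ 2 + C X * X + C B

omit [Fintype Fq] in
lemma natDegree_quadPoly_le (A B : Fq[X]) : (quadPoly A B).natDegree ≤ 2 :=
  natDegree_quadratic_le

omit [Fintype Fq] in
lemma quadPoly_ne_zero (A B : Fq[X]) : quadPoly A B ≠ 0 := fun h0 => by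
  have : (quadPoly A B).coeff 1 = X := by simp [quadPoly, coeff_C]
  rw [h0, coeff_zero] at this
  exact X_ne_zero this.symm

omit [Fintype Fq] in
lemma natDegree_coeff_quadPoly_le {A B : Fq[X]} {D : ℕ} (hD : 1 ≤ D) (hA : A.natDegree ≤ D)
    (hB : B.natDegree ≤ D) (i : ℕ) : ((quadPoly A B).coeff i).natDegree ≤ D := by
  match i with
  | 0 => simpa [quadPoly] using hB
  | 1 => simpa [quadPoly, coeff_X, coeff_C] using hD
  | 2 => simpa [quadPoly, coeff_X, coeff_C] using hA
  | i + 3 =>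
    rw [coeff_eq_zero_of_natDegree_lt ((natDegree_quadPoly_le A B).trans_lt (by omega))]
    simp

omit [Fintype Fq] [Algebra (LaurentSeries Fq) L] in
lemma eval₂_quadPoly (φ : Fq[X] →+* L) (A B : Fq[X]) (α : L) :
    (quadPoly A B).eval₂ φ α = φ A * α ^ 2 + φ X * α + φ B := by
  simp [quadPoly]

lemma le_rpow_neg_of_mul_pow_eq {Q V H W : ℝ} {N e D : ℕ} (hQ : 1 < Q)
    (hV : V * Q ^ N = Q ^ e) (hH1 : 1 ≤ H) (hH : H ≤ Q ^ D) (hW : 0 ≤ W)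
    (hWN : D * W ≤ N - e) : V ≤ H ^ (-W) := by
  have hQ0 : 0 < Q := by linarith
  calc V = Q ^ ((e : ℝ) - N) := by
        rw [Real.rpow_sub hQ0, Real.rpow_natCast, Real.rpow_natCast, ← hV]
        field_simp
    _ ≤ Q ^ ((D : ℝ) * -W) := Real.rpow_le_rpow_of_exponent_le hQ.le (by linarith)
    _ = (Q ^ D) ^ (-W) := by rw [Real.rpow_mul hQ0.le, Real.rpow_natCast]
    _ ≤ H ^ (-W) := Real.rpow_le_rpow_of_nonpos (by linarith) hH (by linarith)

lemma coe_le_sSup_image {S : Set ℝ} {θ b : ℝ} (hb : b < θ) (hS : ∀ w, b ≤ w → w < θ → w ∈ S) :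
    (θ : EReal) ≤ sSup ((fun w : ℝ => (w : EReal)) '' S) := by
  refine le_of_forall_lt_imp_le_of_dense fun a ha => ?_
  induction a with
  | bot => exact bot_le
  | top => exact absurd ha (not_lt.2 le_top)
  | coe a =>
    have ha' : a < θ := EReal.coe_lt_coe_iff.1 ha
    refine le_trans (EReal.coe_le_coe_iff.2 (le_max_left a b))
      (le_sSup ⟨_, hS _ (le_max_right a b) (max_lt ha' hb), rfl⟩)

end Heights

/-- A value of Diophantine exponent exceeding `d - 1` is incompatible with the Liouville lower
bound in degree `d`. -/
lemma exists_lt_of_exponent_gap {Q c W : ℝ} {e : ℕ} (hQ : 1 < Q) (hc : 0 < c) (hW : (e : ℝ) < W)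
    {V : ℕ → ℝ} {D : ℕ → ℕ} (hD : ∀ k, k ≤ D k) {N : ℕ}
    (hV : ∀ k ≥ N, V k ≤ (Q ^ D k) ^ (-W)) : ∃ k, Q ^ (e * D k) * V k < c := by
  have hQ0 : 0 < Q := by linarith
  have hρ : 1 < Q ^ (W - e) := Real.one_lt_rpow hQ (by linarith)
  obtain ⟨M, hM⟩ := pow_unbounded_of_one_lt c⁻¹ hρ
  let k := max N M
  refine ⟨k, ?_⟩
  have h1 := hM.trans_le (pow_le_pow_right₀ hρ.le ((le_max_right N M).trans (hD k)))
  have h2 : Q ^ (e * D k) * (Q ^ D k) ^ (-W) = ((Q ^ (W - e)) ^ D k)⁻¹ := by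
    rw [← Real.rpow_natCast, ← Real.rpow_natCast, ← Real.rpow_natCast, ← Real.rpow_mul hQ0.le,
      ← Real.rpow_mul hQ0.le, ← Real.rpow_add hQ0, ← Real.rpow_neg hQ0.le]
    congr 1
    push_cast
    ring
  calc Q ^ (e * D k) * V k ≤ Q ^ (e * D k) * (Q ^ D k) ^ (-W) :=
        mul_le_mul_of_nonneg_left (hV k (le_max_left N M)) (by positivity)
    _ = ((Q ^ (W - e)) ^ D k)⁻¹ := h2
    _ < c := inv_lt_of_inv_lt₀ hc h1

open CFq

section Exponents

variable {Fq : Type} [Field Fq] [Fintype Fq] {L : Type} [Field L] [Algebra (LaurentSeries Fq) L]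
  {v : AbsoluteValue L ℝ}

lemma injective_of_mul_pow_eq {β : Type*} {Q : ℝ} (hQ : 1 < Q) {e : ℕ} {N : ℕ → ℕ}
    (hN : StrictMono N) {f : ℕ → β} (V : β → ℝ) (hV : ∀ k, V (f k) * Q ^ N k = Q ^ e) :
    Function.Injective f := fun i j hij => by
  have hQ0 : 0 < Q := by linarith
  have hne : V (f j) ≠ 0 := fun h0 => by
    have := hV j
    rw [h0, zero_mul] at this
    exact (pow_pos hQ0 e).ne this
  have h1 := (hV i).trans (hV j).symm
  rw [hij] at h1
  exact hN.injective (pow_right_injective₀ hQ0 hQ.ne' (mul_left_cancel₀ hne h1))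

lemma pos_of_mul_pow_eq {Q V : ℝ} (hQ : 1 < Q) {e N : ℕ} (hV : V * Q ^ N = Q ^ e) : 0 < V := by
  have hQ0 : 0 < Q := by linarith
  exact pos_of_mul_pos_left (hV ▸ pow_pos hQ0 e) (pow_pos hQ0 N).le

/-- A sequence of polynomials `P k` of degree at most `n` and height at most `q ^ D k` with
`|P k (ξ)| = q ^ (e - N k)` bounds the exponent `w_n(ξ)` from below. -/
lemma le_wExp (h : IsDegreeAbs v (embRing Fq L) (Fintype.card Fq))
    (hv : ∀ x : LaurentSeries Fq, v (algebraMap (LaurentSeries Fq) L x) = absQ Fq x)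
    {ξ : LaurentSeries Fq} {θ b : ℝ} (hb : 0 ≤ b) (hbθ : b < θ) {n e : ℕ} {P : ℕ → Fq[X][X]}
    {D N : ℕ → ℕ}
    (hN : StrictMono N) (hP : ∀ k, (P k).natDegree ≤ n)
    (hD : ∀ k i, ((P k).coeff i).natDegree ≤ D k)
    (hval : ∀ k, v ((P k).eval₂ (embRing Fq L) (algebraMap (LaurentSeries Fq) L ξ)) *
      (Fintype.card Fq : ℝ) ^ N k = (Fintype.card Fq : ℝ) ^ e)
    (hgap : ∀ w, b ≤ w → w < θ → ∃ k₀, ∀ k ≥ k₀, D k * w ≤ N k - e) :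
    (θ : EReal) ≤ wExp Fq n ξ := by
  refine coe_le_sSup_image hbθ fun w hw hwθ => ?_
  obtain ⟨k₀, hk₀⟩ := hgap w hw hwθ
  have hinj := injective_of_mul_pow_eq h.one_lt hN (fun P : Fq[X][X] =>
    v (P.eval₂ (embRing Fq L) (algebraMap (LaurentSeries Fq) L ξ))) hval
  refine Set.infinite_of_injective_forall_mem (hinj.comp (add_left_injective k₀)) fun k => ?_
  have hpos := pos_of_mul_pow_eq h.one_lt (hval (k + k₀))
  have hP0 : P (k + k₀) ≠ 0 := fun h0 => by simp [h0] at hpos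
  simp only [Function.comp_apply, Set.mem_ofPred_eq]
  rw [← hv, algebraMap_evalLS]
  exact ⟨hP _, hpos, le_rpow_neg_of_mul_pow_eq h.one_lt (hval _) (one_le_Hpoly h hv hP0)
    (Hpoly_le h hv (hD _)) (hb.trans hw) (hk₀ _ (Nat.le_add_left _ _))⟩

/-- A sequence of quadratic irrationals `α k` of height at most `q ^ D k` with
`|ξ - α k| = q ^ (e - N k)` bounds the exponent `w₂*(ξ)` from below. -/
lemma le_wstarExp (h : IsDegreeAbs v (embRing Fq L) (Fintype.card Fq))
    (hv : ∀ x : LaurentSeries Fq, v (algebraMap (LaurentSeries Fq) L x) = absQ Fq x)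
    {ξ : LaurentSeries Fq} {θ : ℝ} (hθ : 0 < θ) {e : ℕ} {P : ℕ → Fq[X][X]} {α : ℕ → L}
    {D N : ℕ → ℕ}
    (hN : StrictMono N) (hP0 : ∀ k, P k ≠ 0) (hP : ∀ k, (P k).natDegree ≤ 2)
    (hD : ∀ k i, ((P k).coeff i).natDegree ≤ D k)
    (hα : ∀ k, (P k).eval₂ (embRing Fq L) (α k) = 0)
    (hirr : ∀ k, ∀ b c : Fq[X], embRing Fq L b * α k = embRing Fq L c → b = 0)
    (hval : ∀ k, v (algebraMap (LaurentSeries Fq) L ξ - α k) *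
      (Fintype.card Fq : ℝ) ^ N k = (Fintype.card Fq : ℝ) ^ e)
    (hgap : ∀ w, 0 ≤ w → w < θ → ∃ k₀, ∀ k ≥ k₀, D k * (w + 1) ≤ N k - e) :
    (θ : EReal) ≤ wstarExp Fq L 2 ξ v := by
  refine coe_le_sSup_image hθ fun w hw hwθ => ?_
  obtain ⟨k₀, hk₀⟩ := hgap w hw hwθ
  have hinj := injective_of_mul_pow_eq h.one_lt hN (fun a : L =>
    v (algebraMap (LaurentSeries Fq) L ξ - a)) hval
  refine Set.infinite_of_injective_forall_mem (hinj.comp (add_left_injective k₀)) fun k => ?_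
  obtain ⟨h2, hdeg⟩ := degA_eq_two (hP0 (k + k₀)) (hP _) (hα _) (hirr _)
  refine ⟨⟨_, hP0 (k + k₀), hP _, hα _⟩, pos_of_mul_pow_eq h.one_lt (hval _), ?_⟩
  rw [show -w - 1 = -(w + 1) by ring]
  exact le_rpow_neg_of_mul_pow_eq h.one_lt (hval _)
    (one_le_heightA h hv ⟨_, hP0 (k + k₀), hα _⟩)
    ((heightA_le h hv (hP0 (k + k₀)) (h2.trans hdeg.symm) (hα _)).trans (Hpoly_le h hv (hD _)))
    (by linarith) (hk₀ _ (Nat.le_add_left _ _))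

/-- Approximations by polynomials of bounded degree with exponent larger than `d - 1` force the
degree of `ξ` to exceed `d`. -/
lemma lt_degLS (h : IsDegreeAbs v (embRing Fq L) (Fintype.card Fq))
    {ξ : LaurentSeries Fq} (halg : ∃ P : Fq[X][X], P ≠ 0 ∧ evalLS Fq P ξ = 0)
    {d n : ℕ} (hd : 1 ≤ d) {W : ℝ} (hW : (d : ℝ) - 1 < W) {e : ℕ} {P : ℕ → Fq[X][X]}
    {D N : ℕ → ℕ} (hDk : ∀ k, k ≤ D k) (hP : ∀ k, (P k).natDegree ≤ n)
    (hD : ∀ k i, ((P k).coeff i).natDegree ≤ D k)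
    (hval : ∀ k, v ((P k).eval₂ (embRing Fq L) (algebraMap (LaurentSeries Fq) L ξ)) *
      (Fintype.card Fq : ℝ) ^ N k = (Fintype.card Fq : ℝ) ^ e)
    (hgap : ∃ k₀, ∀ k ≥ k₀, D k * W ≤ N k - e) :
    d < degLS Fq ξ := by
  by_contra! hle
  obtain ⟨P₀, hP₀, hP₀ξ⟩ := halg
  obtain ⟨M, hM0, hMd, hM⟩ := Nat.sInf_mem (s := {d | ∃ P : Fq[X][X], P ≠ 0 ∧ P.natDegree = d ∧
    evalLS Fq P ξ = 0}) ⟨_, P₀, hP₀, rfl, hP₀ξ⟩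
  obtain ⟨c, hc, hcP⟩ := liouville_inequality h (algebraMap (LaurentSeries Fq) L ξ) M hM0
    ((evalLS_eq_zero_iff M ξ).1 hM) (fun R hR hlt hRξ => by
      rw [hMd] at hlt
      exact Nat.notMem_of_lt_sInf hlt ⟨R, hR, rfl, (evalLS_eq_zero_iff R ξ).2 hRξ⟩) n
  have hMle : M.natDegree ≤ d := hMd.trans_le hle
  have hMW : ((M.natDegree - 1 : ℕ) : ℝ) < W := by
    refine lt_of_le_of_lt ?_ hW
    rw [← Nat.cast_pred hd]
    exact_mod_cast Nat.sub_le_sub_right hMle 1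
  have hQ := h.one_lt
  obtain ⟨k₀, hk₀⟩ := hgap
  obtain ⟨k, hk⟩ := exists_lt_of_exponent_gap hQ hc hMW hDk (N := k₀)
    (V := fun k => v ((P k).eval₂ (embRing Fq L) (algebraMap (LaurentSeries Fq) L ξ)))
    fun k hk => le_rpow_neg_of_mul_pow_eq hQ (hval k) (one_le_pow₀ hQ.le) le_rfl
      (by linarith [(Nat.cast_nonneg (M.natDegree - 1) : (0 : ℝ) ≤ _)]) (hk₀ k hk)
  have hne : (P k).eval₂ (embRing Fq L) (algebraMap (LaurentSeries Fq) L ξ) ≠ 0 := fun h0 => by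
    have := pos_of_mul_pow_eq hQ (hval k)
    rw [h0, map_zero] at this
    exact this.false
  exact (hcP (P k) (D k) (hP k) (hD k) hne).not_gt hk

end Exponents

end HyperquadraticCF

open HyperquadraticCF

/-- lower bounds for `w₂*(Φ)` and `w₂(Φ)`, and the exact degree of `Φ`,
for `Φ = Φ_ℓ^t(λ; ε)` in characteristic `2` with `ε₁ = ε₂ = 1`, `λ₁ = λ ≠ 1`,
`λᵢ = 1` for `2 ≤ i ≤ m`, and `λ_{m+1} ≠ 1` if `m < ℓ`. -/
theorem stmt17 (Fq : Type) [Field Fq] [Fintype Fq] (hchar : ringChar Fq = 2)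
    (t : ℕ) (ht : 1 ≤ t) (l m : ℕ) (hm : 1 ≤ m) (hml : m ≤ l)
    (init : ℕ → Fq) (hinit : ∀ i, 1 ≤ i → i ≤ l → init i ≠ 0)
    (lam : Fq) (hlam1 : lam ≠ 1)
    (h1 : init 1 = lam) (hmid : ∀ i, 2 ≤ i → i ≤ m → init i = 1)
    (hnext : m < l → init (m + 1) ≠ 1)
    (Φ : LaurentSeries Fq)
    (hcf : CFq.IsCF Fq Φ
      (fun n => Polynomial.C (lamSeq Fq l (2 ^ t) init (n + 1)) * Polynomial.X))
    (L : Type) [Field L] [Algebra (LaurentSeries Fq) L] [IsAlgClosed L]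
    (v : AbsoluteValue L ℝ)
    (hv : ∀ x : LaurentSeries Fq, v (algebraMap (LaurentSeries Fq) L x) = CFq.absQ Fq x) :
    (((m : ℝ) / l * ((2 ^ t : ℝ) - 1) : ℝ) ≤ CFq.wstarExp Fq L 2 Φ v) ∧
    ((1 + (m : ℝ) / l * ((2 ^ t : ℝ) - 1) : ℝ) ≤ CFq.wExp Fq 2 Φ) ∧
    (((2 ^ t : ℝ) - 2) / ((2 ^ t : ℝ) - 1) < (m : ℝ) / l →
      CFq.degLS Fq Φ = 2 ^ t + 1) := by
  have hpc : CharP Fq 2 := (ringChar.eq_iff).1 hchar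
  have : CharP L 2 :=
    charP_of_injective_ringHom ((CFq.embRing Fq L).comp C).injective 2
  have h := isDegreeAbs_embRing (Fq := Fq) hv
  have hQ := h.one_lt
  set φ := CFq.embRing Fq L
  set Q : ℝ := (Fintype.card Fq : ℝ)
  obtain ⟨s, hs⟩ : ∃ s, s + 2 = 2 ^ t :=
    ⟨2 ^ t - 2, Nat.sub_add_cancel (by simpa using Nat.pow_le_pow_right (n := 2) (by norm_num) ht)⟩
  have hr1 : 1 ≤ 2 ^ t := Nat.one_le_two_pow
  have hr2 : 2 ≤ 2 ^ t := hs ▸ Nat.le_add_left _ _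
  have hl : 1 ≤ l := hm.trans hml
  let c : ℕ → Fq := fun n => lamSeq Fq l (2 ^ t) init (n + 1)
  obtain ⟨hpos, y, hy0, hy, hy1⟩ := hcf
  let x : ℕ → L := fun i => algebraMap (LaurentSeries Fq) L (y i)
  have hc0 : ∀ i, c i ≠ 0 := fun i => by
    rcases i with _ | i
    · simpa only [c, zero_add, lamSeq_of_le hl] using hinit 1 le_rfl hl
    · intro h0
      have := hpos (i + 1) (Nat.le_add_left _ _)
      simp only [c] at h0
      simp [h0] at this
  have ha : ∀ i, (C (c i) * X).natDegree = 1 := fun i => natDegree_C_mul_X _ (hc0 i)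
  have hx : ∀ i, x i = φ (C (c i) * X) + (x (i + 1))⁻¹ := fun i => by
    simp only [x]
    rw [hy i, map_add, map_inv₀]
    rfl
  have hxQ : ∀ i, v (x i) = Q := fun i => by
    rw [hx i]
    exact h.apply_add_inv (ha i) ((hy1 _ (Nat.le_add_left _ _)).trans_eq (hv _).symm)
  have hx0 : x 0 = algebraMap (LaurentSeries Fq) L Φ := by simp only [x, hy0]
  obtain ⟨β, hβ, hβQ⟩ := exists_golden h
  have hrun := lamSeq_run hm hml (h1 ▸ hlam1) hmid hnext (t := t)
  let p : ℕ → ℕ := fun k => runStart l (2 ^ t) k + 1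
  let n : ℕ → ℕ := fun k => m * (2 ^ t) ^ k - 1
  have hn : ∀ k, n k + 1 = m * (2 ^ t) ^ k := fun k =>
    Nat.sub_add_cancel (Nat.mul_pos hm (pow_pos hr1 k))
  choose A B α hA hB hval hα hdist hirr using fun k =>
    exists_quadratic_approximation h hβ hβQ hx hxQ ha (p k) (n k)
      (μ := c (p k + n k)) (fun i hi => by
        have := (hrun k).1 (i + 1) (Nat.le_add_left _ _) (by rw [← hn k]; omega)
        rw [← add_assoc, add_right_comm _ i 1] at this
        simp only [c, p, this, C_1, one_mul])
      (by
        have := (hrun k).2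
        rwa [← hn k, ← add_assoc, add_right_comm _ (n k) 1] at this) rfl
  have hpk : StrictMono p := (strictMono_runStart hl hr1).add_const 1
  have hN : StrictMono fun k => 2 * p k + 2 * n k := strictMono_nat_of_lt_succ fun k => by
    have h1 := hpk (Nat.lt_add_one k)
    have h2 : m * (2 ^ t) ^ k ≤ m * (2 ^ t) ^ (k + 1) :=
      Nat.mul_le_mul_left _ (Nat.pow_le_pow_right hr1 (Nat.le_succ k))
    rw [← hn, ← hn] at h2
    omega
  have hD : ∀ k i, ((quadPoly (A k) (B k)).coeff i).natDegree ≤ 2 * p k := fun k =>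
    natDegree_coeff_quadPoly_le (by simp only [p]; omega) (hA k) (hB k)
  have hval' : ∀ k, v ((quadPoly (A k) (B k)).eval₂ φ (algebraMap (LaurentSeries Fq) L Φ)) *
      Q ^ (2 * p k + 2 * n k) = Q ^ 2 := fun k => by
    rw [eval₂_quadPoly, ← hx0]
    exact hval k
  have hθ0 : 0 < (m : ℝ) / l * ((2 ^ t : ℝ) - 1) := by
    have h1 : (2 : ℝ) ≤ 2 ^ t := by exact_mod_cast hr2
    have h2 : (0 : ℝ) < m := by exact_mod_cast hm
    have h3 : (0 : ℝ) < l := by exact_mod_cast hl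
    exact mul_pos (div_pos h2 h3) (by linarith)
  have hgap : ∀ w : ℝ, 0 ≤ w → w < (m : ℝ) / l * ((2 ^ t : ℝ) - 1) → ∃ k₀, ∀ k ≥ k₀,
      ((2 * p k : ℕ) : ℝ) * (w + 1) ≤ ((2 * p k + 2 * n k : ℕ) : ℝ) - (2 : ℕ) := fun w hw hwθ => by
    obtain ⟨k₀, hk₀⟩ := exists_runStart_mul_le (r := 2 ^ t) hl hr2 hw (by push_cast; exact hwθ)
    refine ⟨k₀, fun k hk => ?_⟩
    have h1 : (p k : ℝ) * w ≤ m * ((2 ^ t : ℕ) : ℝ) ^ k - 2 := hk₀ k hk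
    have h2 : (n k : ℝ) + 1 = m * ((2 ^ t : ℕ) : ℝ) ^ k := by exact_mod_cast hn k
    push_cast at *
    linarith
  refine ⟨?_, ?_, fun hθ => ?_⟩
  · refine le_wstarExp h hv hθ0 (e := 1) hN (fun k => quadPoly_ne_zero (A k) (B k))
      (fun k => natDegree_quadPoly_le _ _) hD (fun k => (eval₂_quadPoly φ _ _ _).trans (hα k)) hirr
      (fun k => by rw [← hx0, pow_one]; exact hdist k) fun w hw hwθ => ?_
    obtain ⟨k₀, hk₀⟩ := hgap w hw hwθ
    refine ⟨k₀, fun k hk => (hk₀ k hk).trans ?_⟩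
    push_cast
    linarith
  · refine le_wExp h hv zero_le_one (by linarith) hN (fun k => natDegree_quadPoly_le _ _) hD hval'
      fun w hw hwθ => ?_
    obtain ⟨k₀, hk₀⟩ := hgap (w - 1) (by linarith) (by linarith)
    exact ⟨k₀, fun k hk => by simpa using hk₀ k hk⟩
  · obtain ⟨P, hP0, hPd, hP⟩ := exists_annihilator h hs hx hxQ (c := c) (l := l)
      (lamSeq_block hl hr1) fun j i hi => by
        have := lamSeq_block_one (l := l) (init := init) (r := 2 ^ t) (i := i) (by omega) (j := j)
        exact this
    rw [hx0] at hP
    have hPΦ := (evalLS_eq_zero_iff P Φ).2 hP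
    have hle : CFq.degLS Fq Φ ≤ P.natDegree := Nat.sInf_le ⟨P, hP0, rfl, hPΦ⟩
    refine le_antisymm (hle.trans hPd) ?_
    have hr2' : (2 : ℝ) ≤ 2 ^ t := by exact_mod_cast hr2
    rw [div_lt_iff₀ (by linarith)] at hθ
    obtain ⟨w, hw, hwθ⟩ := exists_between hθ
    refine lt_degLS h ⟨P, hP0, hPΦ⟩ hr1 (W := w + 1) (by push_cast; linarith) (fun k => ?_)
      (fun k => natDegree_quadPoly_le _ _) hD hval' (hgap w (by linarith) hwθ)
    exact (hpk.id_le k).trans (Nat.le_mul_of_pos_left _ two_pos)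
end
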